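/- arXiv:1507.01211 — 5 statements merged into one kernel-verified Lean document; each statement's English description precedes it below -/
import Mathlib

section
/- Let 1 < p, q < ∞, let s ∈ ℝ, and let p' and q' be the conjugate exponents (1/p + 1/p' = 1, 1/q + 1/q' = 1). There exists a constant C (depending only on p, q, s and φ₀) with the following property: if E is a finite set of Haar indices and A₀ ≥ 0 is such that ‖P_E g‖_{F^{−s}_{p',q'}} ≤ A₀ · ‖g‖_{F^{−s}_{p',q'}} for every Schwartz function g : ℝ → ℂ, then ‖P_E f‖_{F^{s}_{p,q}} ≤ C · A₀ · ‖f‖_{F^{s}_{p,q}} for every Schwartz function f : ℝ → ℂ. -/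
open MeasureTheory Real FourierTransform
open scoped ENNReal

noncomputable section

def haarFn (j : ℕ) (μ : ℤ) : ℝ → ℂ := fun x =>
  (Set.Ico ((2:ℝ)^(-(j:ℤ)) * μ) ((2:ℝ)^(-(j:ℤ)) * (μ + 1/2))).indicator (fun _ => (1:ℂ)) x
  - (Set.Ico ((2:ℝ)^(-(j:ℤ)) * (μ + 1/2)) ((2:ℝ)^(-(j:ℤ)) * (μ + 1))).indicator (fun _ => (1:ℂ)) x

def haarProj (E : Finset (ℕ × ℤ)) (f : ℝ → ℂ) : ℝ → ℂ := fun x =>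
  ∑ e ∈ E, (2:ℂ)^e.1 * (∫ y : ℝ, f y * haarFn e.1 e.2 y) * haarFn e.1 e.2 x

def HFset (E : Finset (ℕ × ℤ)) : Finset ℕ := E.image Prod.fst

def conv (f g : ℝ → ℂ) : ℝ → ℂ := fun x => ∫ t : ℝ, f t * g (x - t)

def LPop (φ₀ : ℝ → ℂ) (k : ℕ) (g : ℝ → ℂ) : ℝ → ℂ :=
  if k = 0 then conv g (𝓕⁻ φ₀)
  else conv g (fun x => (2:ℂ)^k * (𝓕⁻ (fun ξ => φ₀ ξ - φ₀ (2*ξ))) ((2:ℝ)^k * x))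

def FNorm (φ₀ : ℝ → ℂ) (p q s : ℝ) (g : ℝ → ℂ) : ℝ≥0∞ :=
  (∫⁻ x : ℝ, (∑' k : ℕ, ENNReal.ofReal ((2:ℝ)^((k:ℝ)*s*q)) *
      (ENNReal.ofReal ‖LPop φ₀ k g x‖)^q)^(p/q) ∂volume)^(1/p)

theorem ENNReal.rpow_lintegral_mul_le {α : Type*} [MeasurableSpace α] (μ : Measure α)
    {P : ℝ} (hP : 1 ≤ P) {w f : α → ℝ≥0∞} (hw : Measurable w) (hf : Measurable f) :
    (∫⁻ a, w a * f a ∂μ) ^ P ≤ (∫⁻ a, w a ∂μ) ^ (P - 1) * ∫⁻ a, w a * f a ^ P ∂μ := by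
  rcases hP.eq_or_lt with rfl | hP
  · simp
  have hc : P.HolderConjugate (P / (P - 1)) := Real.HolderConjugate.conjExponent hP
  have hP0 : 0 < P := by linarith
  have h1 : ∀ a, w a * f a = (w a ^ (1 / P) * f a) * w a ^ ((P - 1) / P) := fun a => by
    rw [mul_right_comm, ← ENNReal.rpow_add_of_nonneg _ _ (by positivity)
      (div_nonneg (by linarith) hP0.le), ← add_div, add_sub_cancel, div_self hP0.ne',
      ENNReal.rpow_one]
  have h2 := ENNReal.lintegral_mul_le_Lp_mul_Lq μ hc
    (f := fun a => w a ^ (1 / P) * f a) (g := fun a => w a ^ ((P - 1) / P))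
    (by fun_prop) (by fun_prop)
  simp only [Pi.mul_apply, ← h1] at h2
  have h3 : ∀ a, (w a ^ (1 / P) * f a) ^ P = w a * f a ^ P := fun a => by
    rw [ENNReal.mul_rpow_of_nonneg _ _ hP0.le, ← ENNReal.rpow_mul, one_div_mul_cancel hP0.ne',
      ENNReal.rpow_one]
  have h4 : ∀ a, (w a ^ ((P - 1) / P)) ^ (P / (P - 1)) = w a := fun a => by
    have : P - 1 ≠ 0 := by linarith
    rw [← ENNReal.rpow_mul, show (P - 1) / P * (P / (P - 1)) = 1 by field_simp, ENNReal.rpow_one]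
  simp only [h3, h4] at h2
  calc _ ≤ ((∫⁻ a, w a * f a ^ P ∂μ) ^ (1 / P) * (∫⁻ a, w a ∂μ) ^ (1 / (P / (P - 1)))) ^ P :=
        ENNReal.rpow_le_rpow h2 hP0.le
    _ = _ := by
        rw [ENNReal.mul_rpow_of_nonneg _ _ hP0.le, ← ENNReal.rpow_mul, ← ENNReal.rpow_mul,
          one_div_mul_cancel hP0.ne', ENNReal.rpow_one, mul_comm,
          show 1 / (P / (P - 1)) * P = P - 1 by field_simp]

theorem ENNReal.rpow_tsum_mul_le {ι : Type*} [Countable ι] {P : ℝ} (hP : 1 ≤ P)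
    (w f : ι → ℝ≥0∞) :
    (∑' i, w i * f i) ^ P ≤ (∑' i, w i) ^ (P - 1) * ∑' i, w i * f i ^ P := by
  let _ : MeasurableSpace ι := ⊤
  have := ENNReal.rpow_lintegral_mul_le (Measure.count (α := ι)) hP
    (measurable_from_top (f := w)) (measurable_from_top (f := f))
  simpa [lintegral_count] using this

theorem ENNReal.add_rpow_le_rpow_add_mul {P : ℝ} (hP : 1 ≤ P) (x a : ℝ≥0∞) :
    (x + a) ^ P ≤ x ^ P + ENNReal.ofReal P * ((x + a) ^ (P - 1) * a) := by
  have hP0 : 0 < P := by linarith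
  rcases eq_or_ne x ⊤ with rfl | hx
  · simp [hP0]
  rcases eq_or_ne a ⊤ with rfl | ha
  · have h0 : ENNReal.ofReal P ≠ 0 := by simpa using hP0
    have h1 : (⊤ : ℝ≥0∞) ^ (P - 1) ≠ 0 := by simp [hP]
    simp [ENNReal.mul_top, h0, h1, hP0]
  lift x to NNReal using hx
  lift a to NNReal using ha
  have hPP : ENNReal.ofReal P = ((P.toNNReal : NNReal) : ℝ≥0∞) := rfl
  rw [hPP, ← ENNReal.coe_add, ← ENNReal.coe_rpow_of_nonneg _ hP0.le,
    ← ENNReal.coe_rpow_of_nonneg _ hP0.le,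
    ← ENNReal.coe_rpow_of_nonneg _ (by linarith : 0 ≤ P - 1)]
  norm_cast
  rw [← NNReal.coe_le_coe]
  push_cast
  rw [Real.coe_toNNReal _ hP0.le]
  have hx := x.coe_nonneg
  have ha := a.coe_nonneg
  generalize (x : ℝ) = x at *
  generalize (a : ℝ) = a at *
  rcases (add_nonneg hx ha).eq_or_lt with h | h
  · have : x = 0 := by linarith
    have : a = 0 := by linarith
    subst_vars; simp [Real.zero_rpow hP0.ne']
  have hb := one_add_mul_self_le_rpow_one_add (s := -a / (x + a)) (p := P)
    (by rw [neg_div, neg_le_neg_iff, div_le_one h]; linarith) hP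
  rw [show 1 + -a / (x + a) = x / (x + a) by field_simp; ring, Real.div_rpow hx h.le,
    le_div_iff₀ (by positivity)] at hb
  rw [Real.rpow_sub_one h.ne']
  have : (1 + P * (-a / (x + a))) * (x + a) ^ P = (x + a) ^ P - P * ((x + a) ^ P / (x + a) * a) := by
    field_simp
    ring
  linarith

theorem ENNReal.rpow_sum_range_le {P : ℝ} (hP : 1 ≤ P) (a : ℕ → ℝ≥0∞) (n : ℕ) :
    (∑ k ∈ Finset.range n, a k) ^ P ≤ ENNReal.ofReal P *
      ∑ k ∈ Finset.range n, (∑ j ∈ Finset.range (k + 1), a j) ^ (P - 1) * a k := by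
  induction n with
  | zero => simp [show (0:ℝ) < P by linarith]
  | succ n ih =>
    rw [Finset.sum_range_succ (fun k => (∑ j ∈ Finset.range (k + 1), a j) ^ (P - 1) * a k), mul_add,
      Finset.sum_range_succ]
    refine (ENNReal.add_rpow_le_rpow_add_mul hP _ _).trans ?_
    gcongr

/-- Averaging over the atom of the partition given by the level sets of `b`. -/
def atomAverage (b : ℝ → ℤ) (c : ℝ≥0∞) (h : ℝ → ℝ≥0∞) (x : ℝ) : ℝ≥0∞ :=
  ∫⁻ y, (if b y = b x then c else 0) * h y

theorem measurable_atomKernel {b : ℝ → ℤ} (hb : Measurable b) (c : ℝ≥0∞) :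
    Measurable fun z : ℝ × ℝ => if b z.2 = b z.1 then c else 0 :=
  Measurable.ite (measurableSet_eq_fun (hb.comp measurable_snd) (hb.comp measurable_fst))
    measurable_const measurable_const

theorem measurable_atomAverage {b : ℝ → ℤ} (hb : Measurable b) (c : ℝ≥0∞) {h : ℝ → ℝ≥0∞}
    (hh : Measurable h) : Measurable (atomAverage b c h) :=
  Measurable.lintegral_prod_right' (f := fun z : ℝ × ℝ => (if b z.2 = b z.1 then c else 0) * h z.2)
    ((measurable_atomKernel hb c).mul (hh.comp measurable_snd))

theorem atomAverage_congr {b : ℝ → ℤ} (c : ℝ≥0∞) (h : ℝ → ℝ≥0∞) {x y : ℝ} (hxy : b x = b y) :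
    atomAverage b c h x = atomAverage b c h y := by
  simp [atomAverage, hxy]

theorem lintegral_mul_atomAverage_le {b : ℝ → ℤ} (hb : Measurable b) {c : ℝ≥0∞}
    (hmass : ∀ x, ∫⁻ y, (if b y = b x then c else 0) ≤ 1) {h S : ℝ → ℝ≥0∞}
    (hh : Measurable h) (hS : Measurable S) (hSb : ∀ x y, b x = b y → S x = S y) :
    ∫⁻ x, S x * atomAverage b c h x ≤ ∫⁻ x, S x * h x := by
  have hk := measurable_atomKernel hb c
  have hk' : ∀ x, Measurable fun y => if b y = b x then c else 0 := fun x =>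
    hk.comp (measurable_const.prodMk measurable_id)
  simp only [atomAverage]
  calc _ = ∫⁻ x, ∫⁻ y, S x * ((if b y = b x then c else 0) * h y) := by
        refine lintegral_congr fun x => ?_
        rw [lintegral_const_mul _ (f := fun y => _ * h y) ((hk' x).mul hh)]
    _ = ∫⁻ y, ∫⁻ x, S x * ((if b y = b x then c else 0) * h y) := by
        refine lintegral_lintegral_swap ?_
        exact ((hS.comp measurable_fst).mul (hk.mul (hh.comp measurable_snd))).aemeasurable
    _ = ∫⁻ y, ∫⁻ x, (S y * h y) * (if b x = b y then c else 0) := by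
        refine lintegral_congr fun y => lintegral_congr fun x => ?_
        by_cases hxy : b x = b y
        · simp [hxy, hSb x y hxy]; ring
        · simp [hxy, Ne.symm hxy]
    _ ≤ ∫⁻ y, (S y * h y) * 1 := by
        refine lintegral_mono fun y => ?_
        rw [lintegral_const_mul _ (hk' y)]
        gcongr
        exact hmass y
    _ = _ := by simp

theorem lintegral_rpow_atomAverage_le {b : ℝ → ℤ} (hb : Measurable b) {c : ℝ≥0∞}
    (hmass : ∀ x, ∫⁻ y, (if b y = b x then c else 0) ≤ 1) {P : ℝ} (hP : 1 ≤ P) {h : ℝ → ℝ≥0∞}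
    (hh : Measurable h) :
    ∫⁻ x, atomAverage b c h x ^ P ≤ ∫⁻ x, h x ^ P := by
  calc _ ≤ ∫⁻ x, 1 * atomAverage b c (fun y => h y ^ P) x := by
        refine lintegral_mono fun x => ?_
        refine (ENNReal.rpow_lintegral_mul_le volume hP ((measurable_atomKernel hb c).comp
          (measurable_const.prodMk measurable_id : Measurable fun y : ℝ => (x, y))) hh).trans ?_
        refine mul_le_mul_left (ENNReal.rpow_le_one (hmass x) (by linarith)) _
    _ ≤ ∫⁻ x, 1 * h x ^ P := lintegral_mul_atomAverage_le hb hmass (by fun_prop) measurable_const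
        (fun _ _ _ => rfl)
    _ = _ := by simp

/-- The dual form of Doob's maximal inequality for a nested sequence of partitions. -/
theorem lintegral_rpow_sum_atomAverage_le {b : ℕ → ℝ → ℤ} (hb : ∀ k, Measurable (b k))
    {c : ℕ → ℝ≥0∞} (hmass : ∀ k x, ∫⁻ y, (if b k y = b k x then c k else 0) ≤ 1)
    (hnest : ∀ k N, k ≤ N → ∀ x y, b N x = b N y → b k x = b k y)
    {P : ℝ} (hP : 1 ≤ P) {h : ℕ → ℝ → ℝ≥0∞} (hh : ∀ k, Measurable (h k)) (n : ℕ) :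
    ∫⁻ x, (∑ k ∈ Finset.range n, atomAverage (b k) (c k) (h k) x) ^ P ≤
      ENNReal.ofReal P ^ P * ∫⁻ x, (∑ k ∈ Finset.range n, h k x) ^ P := by
  rcases hP.eq_or_lt with rfl | hP1
  · simp only [ENNReal.rpow_one, ENNReal.ofReal_one, one_mul]
    rw [lintegral_finsetSum _ (fun k _ => measurable_atomAverage (hb k) _ (hh k)),
      lintegral_finsetSum _ (fun k _ => hh k)]
    refine Finset.sum_le_sum fun k _ => ?_
    simpa using lintegral_rpow_atomAverage_le (hb k) (hmass k) le_rfl (hh k)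
  have hP0 : 0 < P := by linarith
  set a : ℕ → ℝ → ℝ≥0∞ := fun k => atomAverage (b k) (c k) (h k) with ha
  have ham : ∀ k, Measurable (a k) := fun k => measurable_atomAverage (hb k) _ (hh k)
  set X := ∫⁻ x, (∑ k ∈ Finset.range n, a k x) ^ P with hX
  set H := ∫⁻ x, (∑ k ∈ Finset.range n, h k x) ^ P with hH
  change X ≤ _
  rcases eq_or_ne H ⊤ with htop | htop
  · rw [htop, ENNReal.mul_top]
    · exact le_top
    · simp [hP0]
  have hXfin : X ≠ ⊤ := by
    have h1 : X ≤ (n : ℝ≥0∞) ^ (P - 1) * ∑ k ∈ Finset.range n, ∫⁻ x, a k x ^ P := by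
      rw [← lintegral_finsetSum _ (fun k _ => (ham k).pow_const P),
        ← lintegral_const_mul _ (by fun_prop)]
      refine lintegral_mono fun x => ?_
      simpa using ENNReal.rpow_sum_le_const_mul_sum_rpow (Finset.range n) (fun k => a k x) hP
    refine ne_top_of_le_ne_top ?_ h1
    refine ENNReal.mul_ne_top (ENNReal.rpow_ne_top_of_nonneg (by linarith) (by simp)) ?_
    refine ENNReal.sum_ne_top.2 fun k hk => ?_
    refine ne_top_of_le_ne_top htop ?_
    refine (lintegral_rpow_atomAverage_le (hb k) (hmass k) hP (hh k)).trans ?_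
    refine lintegral_mono fun x => ENNReal.rpow_le_rpow ?_ hP0.le
    exact Finset.single_le_sum (f := fun k => h k x) (fun _ _ => zero_le) hk
  have hc : P.HolderConjugate (P / (P - 1)) := Real.HolderConjugate.conjExponent hP1
  have hm : ∀ k, Measurable fun x =>
      (∑ j ∈ Finset.range (k + 1), a j x) ^ (P - 1) * a k x := fun k => by fun_prop
  have hm' : ∀ k, Measurable fun x =>
      (∑ j ∈ Finset.range n, a j x) ^ (P - 1) * h k x := fun k => by fun_prop
  have key : X ≤ ENNReal.ofReal P * (H ^ (1 / P) * X ^ ((P - 1) / P)) := by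
    calc X ≤ ∫⁻ x, ENNReal.ofReal P *
          ∑ k ∈ Finset.range n, (∑ j ∈ Finset.range (k + 1), a j x) ^ (P - 1) * a k x :=
          lintegral_mono fun x => ENNReal.rpow_sum_range_le hP (fun k => a k x) n
      _ = ENNReal.ofReal P * ∑ k ∈ Finset.range n,
          ∫⁻ x, (∑ j ∈ Finset.range (k + 1), a j x) ^ (P - 1) * a k x := by
          rw [lintegral_const_mul _ (Finset.measurable_sum _ fun k _ => hm k),
            lintegral_finsetSum _ (fun k _ => hm k)]
      _ ≤ ENNReal.ofReal P * ∑ k ∈ Finset.range n,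
          ∫⁻ x, (∑ j ∈ Finset.range n, a j x) ^ (P - 1) * h k x := by
          gcongr ENNReal.ofReal P * ?_
          refine Finset.sum_le_sum fun k hk => ?_
          refine (lintegral_mul_atomAverage_le (hb k) (hmass k) (hh k)
            (S := fun x => (∑ j ∈ Finset.range (k + 1), a j x) ^ (P - 1)) (by fun_prop) ?_).trans ?_
          · intro x y hxy
            congr 1
            refine Finset.sum_congr rfl fun j hj => atomAverage_congr _ _ ?_
            exact hnest j k (by simpa [Nat.lt_succ_iff] using hj) x y hxy
          · refine lintegral_mono fun x => ?_
            refine mul_le_mul_left (ENNReal.rpow_le_rpow ?_ (by linarith)) _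
            exact Finset.sum_le_sum_of_subset (Finset.range_mono (by simpa using hk))
      _ = ENNReal.ofReal P *
          ∫⁻ x, (∑ k ∈ Finset.range n, h k x) * (∑ j ∈ Finset.range n, a j x) ^ (P - 1) := by
          rw [← lintegral_finsetSum _ (fun k _ => hm' k)]
          congr 1
          refine lintegral_congr fun x => ?_
          rw [← Finset.mul_sum, mul_comm]
      _ ≤ ENNReal.ofReal P * (H ^ (1 / P) * X ^ ((P - 1) / P)) := by
          gcongr
          have := ENNReal.lintegral_mul_le_Lp_mul_Lq volume hc
            (f := fun x => ∑ k ∈ Finset.range n, h k x)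
            (g := fun x => (∑ j ∈ Finset.range n, a j x) ^ (P - 1)) (by fun_prop) (by fun_prop)
          have hP10 : P - 1 ≠ 0 := by linarith
          simpa only [Pi.mul_apply, ← ENNReal.rpow_mul, mul_div_cancel₀ _ hP10, one_div_div]
            using this
  rcases eq_or_ne X 0 with h0 | h0
  · rw [h0]; exact zero_le
  have hXP : X = X ^ (1 / P) * X ^ ((P - 1) / P) := by
    rw [← ENNReal.rpow_add _ _ h0 hXfin, ← add_div, add_sub_cancel, div_self hP0.ne',
      ENNReal.rpow_one]
  have key2 : X ^ (1 / P) ≤ ENNReal.ofReal P * H ^ (1 / P) := by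
    have h3 : X ^ (1 / P) * X ^ ((P - 1) / P) ≤
        (ENNReal.ofReal P * H ^ (1 / P)) * X ^ ((P - 1) / P) := by
      rw [← hXP, mul_assoc]; exact key
    refine (ENNReal.mul_le_mul_iff_left ?_ ?_).1 h3
    · simp [h0, hXfin]
    · exact ENNReal.rpow_ne_top_of_nonneg (div_nonneg (by linarith) hP0.le) hXfin
  calc X = (X ^ (1 / P)) ^ P := by
        rw [← ENNReal.rpow_mul, one_div_mul_cancel hP0.ne', ENNReal.rpow_one]
    _ ≤ (ENNReal.ofReal P * H ^ (1 / P)) ^ P := ENNReal.rpow_le_rpow key2 hP0.le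
    _ = _ := by
        rw [ENNReal.mul_rpow_of_nonneg _ _ hP0.le, ← ENNReal.rpow_mul,
          one_div_mul_cancel hP0.ne', ENNReal.rpow_one]

/-- The norm of `L^p(ℓ^q)` for sequences of nonnegative functions. -/
def mixedNorm (p q : ℝ) (u : ℕ → ℝ → ℝ≥0∞) : ℝ≥0∞ :=
  (∫⁻ x, (∑' k, u k x ^ q) ^ (p / q)) ^ (1 / p)

theorem mixedNorm_mono {p q : ℝ} (hp : 0 ≤ p) (hq : 0 ≤ q) {u v : ℕ → ℝ → ℝ≥0∞}
    (h : ∀ k x, u k x ≤ v k x) : mixedNorm p q u ≤ mixedNorm p q v := by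
  unfold mixedNorm
  refine ENNReal.rpow_le_rpow (lintegral_mono fun x => ENNReal.rpow_le_rpow
    (ENNReal.tsum_le_tsum fun k => ENNReal.rpow_le_rpow (h k x) hq) (by positivity)) (by positivity)

theorem mixedNorm_const_mul {p q : ℝ} (hp : 0 < p) (hq : 0 < q) (c : ℝ≥0∞)
    {u : ℕ → ℝ → ℝ≥0∞} (hu : ∀ k, Measurable (u k)) :
    mixedNorm p q (fun k x => c * u k x) = c * mixedNorm p q u := by
  unfold mixedNorm
  have h1 : ∀ x, (∑' k, (c * u k x) ^ q) ^ (p / q) = c ^ p * (∑' k, u k x ^ q) ^ (p / q) := by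
    intro x
    simp only [ENNReal.mul_rpow_of_nonneg _ _ hq.le]
    rw [ENNReal.tsum_mul_left, ENNReal.mul_rpow_of_nonneg _ _ (by positivity), ← ENNReal.rpow_mul,
      mul_div_cancel₀ _ hq.ne']
  simp only [h1]
  rw [lintegral_const_mul _ (by fun_prop), ENNReal.mul_rpow_of_nonneg _ _ (by positivity),
    ← ENNReal.rpow_mul, mul_one_div_cancel hp.ne', ENNReal.rpow_one]

theorem mixedNorm_adjacent_le {p q : ℝ} (hp : 0 < p) (hq : 1 ≤ q) {u : ℕ → ℝ → ℝ≥0∞}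
    (hu : ∀ k, Measurable (u k)) :
    mixedNorm p q (fun k x => ∑ l ∈ Finset.Icc (k - 1) (k + 1), u l x) ≤
      4 * mixedNorm p q u := by
  have hq0 : 0 < q := by linarith
  rw [← mixedNorm_const_mul hp hq0 _ hu]
  unfold mixedNorm
  refine ENNReal.rpow_le_rpow (lintegral_mono fun x => ENNReal.rpow_le_rpow ?_ (by positivity))
    (by positivity)
  have h1 : ∀ k, (∑ l ∈ Finset.Icc (k - 1) (k + 1), u l x) ^ q ≤
      3 ^ (q - 1) * (u (k - 1) x ^ q + u k x ^ q + u (k + 1) x ^ q) := by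
    intro k
    refine (ENNReal.rpow_sum_le_const_mul_sum_rpow _ _ hq).trans ?_
    refine mul_le_mul' (ENNReal.rpow_le_rpow ?_ (by linarith)) ?_
    · rw [Nat.card_Icc, show (3 : ℝ≥0∞) = ((3 : ℕ) : ℝ≥0∞) by norm_num, Nat.cast_le]
      omega
    · rcases k with _ | k
      · simp only [Finset.sum_Icc_succ_top (Nat.zero_le _), zero_tsub, zero_add]
        simp
        gcongr
        exact le_add_self
      · rw [show k + 1 - 1 = k from rfl, Finset.sum_Icc_succ_top (by omega),
          Finset.sum_Icc_succ_top (by omega), Finset.Icc_self, Finset.sum_singleton]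
  calc _ ≤ ∑' k, 3 ^ (q - 1) * (u (k - 1) x ^ q + u k x ^ q + u (k + 1) x ^ q) :=
        ENNReal.tsum_le_tsum h1
    _ = 3 ^ (q - 1) * (∑' k, u (k - 1) x ^ q + ∑' k, u k x ^ q + ∑' k, u (k + 1) x ^ q) := by
        rw [ENNReal.tsum_mul_left, ENNReal.tsum_add, ENNReal.tsum_add]
    _ ≤ 4 ^ (q - 1) * ((∑' k, u k x ^ q + ∑' k, u k x ^ q) + ∑' k, u k x ^ q
          + ∑' k, u k x ^ q) := by
        refine mul_le_mul' (ENNReal.rpow_le_rpow (by norm_num) (by linarith))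
          (add_le_add (add_le_add ?_ le_rfl) ?_)
        · rw [tsum_eq_zero_add' ENNReal.summable]
          simp only [zero_tsub, add_tsub_cancel_right]
          gcongr
          exact ENNReal.le_tsum 0
        · exact ENNReal.tsum_comp_le_tsum_of_injective (add_left_injective 1) (fun k => u k x ^ q)
    _ = ∑' k, (4 * u k x) ^ q := by
        simp only [ENNReal.mul_rpow_of_nonneg _ _ hq0.le]
        rw [ENNReal.tsum_mul_left, ENNReal.rpow_sub _ _ (by simp) (by simp), ENNReal.rpow_one,
          div_eq_mul_inv]
        have : (4:ℝ≥0∞)⁻¹ * 4 = 1 := ENNReal.inv_mul_cancel (by simp) (by simp)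
        generalize (∑' k, u k x ^ q) = S
        calc _ = (4:ℝ≥0∞) ^ q * ((4:ℝ≥0∞)⁻¹ * 4) * S := by ring
          _ = _ := by rw [this]; ring

theorem tsum_lintegral_mul_le_mixedNorm_mul_mixedNorm {p q p' q' : ℝ} (hp : p.HolderConjugate p')
    (hq : q.HolderConjugate q') {u v : ℕ → ℝ → ℝ≥0∞} (hu : ∀ k, Measurable (u k))
    (hv : ∀ k, Measurable (v k)) :
    ∑' k, ∫⁻ x, u k x * v k x ≤ mixedNorm p q u * mixedNorm p' q' v := by
  rw [← lintegral_tsum (f := fun k x => u k x * v k x) (fun k => ((hu k).mul (hv k)).aemeasurable)]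
  have h1 : ∀ x, ∑' k, u k x * v k x ≤ (∑' k, u k x ^ q) ^ (1 / q) * (∑' k, v k x ^ q') ^ (1 / q') := by
    intro x
    have := ENNReal.lintegral_mul_le_Lp_mul_Lq Measure.count hq (f := fun k => u k x)
      (g := fun k => v k x) (measurable_from_top).aemeasurable (measurable_from_top).aemeasurable
    simpa [lintegral_count] using this
  refine (lintegral_mono h1).trans ?_
  have h2 := ENNReal.lintegral_mul_le_Lp_mul_Lq volume hp
    (f := fun x => (∑' k, u k x ^ q) ^ (1 / q)) (g := fun x => (∑' k, v k x ^ q') ^ (1 / q'))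
    (by fun_prop) (by fun_prop)
  simpa only [mixedNorm, Pi.mul_apply, ← ENNReal.rpow_mul, one_div_mul_eq_div] using h2

theorem lintegral_rpow_tsum_le_of_forall_range {u : ℕ → ℝ → ℝ≥0∞} (hu : ∀ k, Measurable (u k))
    {P : ℝ} (hP : 0 ≤ P) {B : ℝ≥0∞}
    (h : ∀ n, ∫⁻ x, (∑ k ∈ Finset.range n, u k x) ^ P ≤ B) : ∫⁻ x, (∑' k, u k x) ^ P ≤ B := by
  refine le_of_tendsto' (lintegral_tendsto_of_tendsto_of_monotone
    (f := fun n x => (∑ k ∈ Finset.range n, u k x) ^ P) (fun n => by fun_prop) ?_ ?_) h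
  · refine Filter.Eventually.of_forall fun x n m hnm => ENNReal.rpow_le_rpow ?_ hP
    exact Finset.sum_le_sum_of_subset (Finset.range_mono hnm)
  · refine Filter.Eventually.of_forall fun x => ?_
    exact (ENNReal.continuous_rpow_const.tendsto _).comp (ENNReal.tendsto_nat_tsum fun k => u k x)

/-- The truncation of a sequence of functions to the first `n` terms, to `[-n, n]`, and to
values at most `n`. -/
def truncSeq (u : ℕ → ℝ → ℝ≥0∞) (n k : ℕ) (x : ℝ) : ℝ≥0∞ :=
  if k < n ∧ |x| ≤ n then min (u k x) n else 0

theorem measurable_truncSeq {u : ℕ → ℝ → ℝ≥0∞} (hu : ∀ k, Measurable (u k)) (n k : ℕ) :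
    Measurable (truncSeq u n k) := by
  refine Measurable.ite ?_ ((hu k).min measurable_const) measurable_const
  exact (MeasurableSet.const _).inter (measurableSet_le measurable_norm measurable_const)

theorem truncSeq_mono (u : ℕ → ℝ → ℝ≥0∞) (k : ℕ) (x : ℝ) : Monotone fun n => truncSeq u n k x := by
  intro n m hnm
  have hnm' : (n : ℝ) ≤ m := by exact_mod_cast hnm
  simp only [truncSeq]
  split_ifs with h1 h2
  · exact min_le_min le_rfl (by exact_mod_cast hnm)
  · exact absurd ⟨by omega, h1.2.trans hnm'⟩ h2
  · exact zero_le
  · exact zero_le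

theorem truncSeq_le (u : ℕ → ℝ → ℝ≥0∞) (n k : ℕ) (x : ℝ) : truncSeq u n k x ≤ u k x := by
  unfold truncSeq
  split_ifs
  · exact min_le_left _ _
  · exact zero_le

theorem tendsto_truncSeq (u : ℕ → ℝ → ℝ≥0∞) (k : ℕ) (x : ℝ) :
    Filter.Tendsto (fun n => truncSeq u n k x) Filter.atTop (nhds (u k x)) := by
  have h1 : Filter.Tendsto (fun n : ℕ => min (u k x) (n : ℝ≥0∞)) Filter.atTop (nhds (u k x)) := by
    have := (tendsto_const_nhds (x := u k x) (f := Filter.atTop)).min ENNReal.tendsto_nat_nhds_top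
    simpa using this
  refine h1.congr' ?_
  obtain ⟨N, hN⟩ := exists_nat_ge |x|
  filter_upwards [Filter.eventually_gt_atTop k, Filter.eventually_ge_atTop N] with n hn hn'
  have : (N : ℝ) ≤ n := by exact_mod_cast hn'
  simp [truncSeq, hn, hN.trans this]

theorem mixedNorm_le_of_forall_truncSeq {p q : ℝ} (hp : 0 < p) (hq : 0 < q)
    {u : ℕ → ℝ → ℝ≥0∞} (hu : ∀ k, Measurable (u k)) {A : ℝ≥0∞}
    (h : ∀ n, mixedNorm p q (truncSeq u n) ≤ A) : mixedNorm p q u ≤ A := by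
  unfold mixedNorm at h ⊢
  rw [one_div, ENNReal.rpow_inv_le_iff hp]
  simp only [one_div, ENNReal.rpow_inv_le_iff hp] at h
  refine lintegral_rpow_tsum_le_of_forall_range (fun k => (hu k).pow_const q) (by positivity)
    fun N => ?_
  have hm := fun n k => measurable_truncSeq hu n k
  refine le_of_tendsto' (lintegral_tendsto_of_tendsto_of_monotone
    (f := fun n x => (∑ k ∈ Finset.range N, truncSeq u n k x ^ q) ^ (p / q))
    (fun n => by fun_prop) ?_ ?_) fun n => le_trans ?_ (h n)
  · refine Filter.Eventually.of_forall fun x n m hnm => ?_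
    refine ENNReal.rpow_le_rpow (Finset.sum_le_sum fun k _ => ?_) (by positivity)
    exact ENNReal.rpow_le_rpow (truncSeq_mono u k x hnm) hq.le
  · refine Filter.Eventually.of_forall fun x => ?_
    refine (ENNReal.continuous_rpow_const.tendsto _).comp (tendsto_finsetSum _ fun k _ => ?_)
    exact (ENNReal.continuous_rpow_const.tendsto _).comp (tendsto_truncSeq u k x)
  · refine lintegral_mono fun x => ENNReal.rpow_le_rpow (ENNReal.sum_le_tsum _) (by positivity)

/-- The converse of Hölder's inequality for mixed norms. -/
theorem mixedNorm_le_of_forall_dual {p q p' q' : ℝ} (hp : p.HolderConjugate p')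
    (hq : q.HolderConjugate q') {u : ℕ → ℝ → ℝ≥0∞} (hu : ∀ k, Measurable (u k)) {A : ℝ≥0∞}
    (h : ∀ (v : ℕ → ℝ → ℝ≥0∞) (n : ℕ), (∀ k, Measurable (v k)) →
      (∀ k x, n ≤ k → v k x = 0) → (∀ k (x : ℝ), n < |x| → v k x = 0) →
      (∃ B : NNReal, ∀ k x, v k x ≤ B) →
      ∑' k, ∫⁻ x, u k x * v k x ≤ A * mixedNorm p' q' v) :
    mixedNorm p q u ≤ A := by
  have hp0 := hp.pos
  have hq0 := hq.pos
  have hp1 := hp.lt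
  have hq1 := hq.lt
  have hp'0 := hp.symm.pos
  have hq'0 := hq.symm.pos
  have hpp := hp.mul_eq_add
  have hqq := hq.mul_eq_add
  refine mixedNorm_le_of_forall_truncSeq hp0 hq0 hu fun n => ?_
  set t := truncSeq u n with ht
  have htm : ∀ k, Measurable (t k) := fun k => measurable_truncSeq hu n k
  set V : ℝ → ℝ≥0∞ := fun x => ∑' k, t k x ^ q with hV
  have hVm : Measurable V := by fun_prop
  have htV : ∀ k x, t k x ≤ V x ^ (1 / q) := fun k x => by
    rw [one_div, ENNReal.le_rpow_inv_iff hq0]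
    exact ENNReal.le_tsum (f := fun k => t k x ^ q) k
  set b : ℝ≥0∞ := n * (n : ℝ≥0∞) ^ q with hb
  have hbtop : b ≠ ⊤ := ENNReal.mul_ne_top (by simp) (ENNReal.rpow_ne_top_of_nonneg hq0.le (by simp))
  have ht0 : ∀ k x, n ≤ k → t k x = 0 := fun k x hk => by
    simp [ht, truncSeq, hk.not_gt]
  have ht0' : ∀ k (x : ℝ), n < |x| → t k x = 0 := fun k x hk => by
    simp [ht, truncSeq, hk.not_ge]
  have htn : ∀ k x, t k x ≤ n := fun k x => by
    simp only [ht, truncSeq]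
    split_ifs
    · exact min_le_right _ _
    · exact zero_le
  have hVb : ∀ x, V x ≤ b := fun x => by
    simp only [hV]
    rw [tsum_eq_sum (s := Finset.range n)
      (fun k hk => by rw [ht0 k x (by simpa using hk), ENNReal.zero_rpow_of_pos hq0])]
    refine (Finset.sum_le_card_nsmul _ _ _ fun k _ => ENNReal.rpow_le_rpow (htn k x) hq0.le).trans ?_
    simp [hb]
  have hVtop : ∀ x, V x ≠ ⊤ := fun x => ne_top_of_le_ne_top hbtop (hVb x)
  have hV0 : ∀ x : ℝ, n < |x| → V x = 0 := fun x hx => by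
    simp [hV, ht0' _ x hx, hq0]
  set X := ∫⁻ x, V x ^ (p / q) with hX
  have hXtop : X ≠ ⊤ := by
    have : X ≤ ∫⁻ x in Set.Icc (-n : ℝ) n, b ^ (p / q) := by
      rw [← lintegral_indicator measurableSet_Icc]
      refine lintegral_mono fun x => ?_
      by_cases hx : x ∈ Set.Icc (-n : ℝ) n
      · rw [Set.indicator_of_mem hx]
        exact ENNReal.rpow_le_rpow (hVb x) (by positivity)
      · rw [hV0 x (by rw [← not_le, abs_le]; exact hx), ENNReal.zero_rpow_of_pos (by positivity)]
        exact zero_le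
    refine ne_top_of_le_ne_top ?_ this
    simp only [setLIntegral_const, Real.volume_Icc]
    exact ENNReal.mul_ne_top (ENNReal.rpow_ne_top_of_nonneg (by positivity) hbtop) (by simp)
  set w : ℕ → ℝ → ℝ≥0∞ := fun k x => t k x ^ (q - 1) * V x ^ (p / q - 1) with hw
  have hwm : ∀ k, Measurable (w k) := fun k => by fun_prop
  have hw0 : ∀ k x, t k x = 0 → w k x = 0 := fun k x hk => by
    simp [hw, hk, ENNReal.zero_rpow_of_pos (by linarith : 0 < q - 1)]
  have hVz : ∀ k x, V x = 0 → t k x = 0 := fun k x hx => by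
    have := htV k x
    rw [hx, ENNReal.zero_rpow_of_pos (by positivity)] at this
    simpa using this
  have hwB : ∀ k x, w k x ≤ b ^ ((p - 1) / q) := fun k x => by
    rcases eq_or_ne (V x) 0 with h0 | h0
    · rw [hw0 k x (hVz k x h0)]; exact zero_le
    calc w k x ≤ (V x ^ (1 / q)) ^ (q - 1) * V x ^ (p / q - 1) := by
          simp only [hw]
          exact mul_le_mul_left (ENNReal.rpow_le_rpow (htV k x) (by linarith)) _
      _ = V x ^ ((p - 1) / q) := by
          rw [← ENNReal.rpow_mul, ← ENNReal.rpow_add _ _ h0 (hVtop x)]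
          congr 1
          field_simp
          ring
      _ ≤ _ := ENNReal.rpow_le_rpow (hVb x) (div_nonneg (by linarith) hq0.le)
  have hsum : ∀ x, ∑' k, t k x * w k x = V x ^ (p / q) := fun x => by
    rcases eq_or_ne (V x) 0 with h0 | h0
    · rw [h0, ENNReal.zero_rpow_of_pos (by positivity)]
      simp [hVz _ x h0]
    have : ∀ k, t k x * w k x = t k x ^ q * V x ^ (p / q - 1) := fun k => by
      simp only [hw]
      rw [← mul_assoc]
      congr 1
      conv_lhs => enter [1]; rw [← ENNReal.rpow_one (t k x)]
      rw [← ENNReal.rpow_add_of_nonneg _ _ (by simp) (by linarith), add_sub_cancel]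
    simp only [this]
    rw [ENNReal.tsum_mul_right]
    conv_lhs => enter [1]; rw [← ENNReal.rpow_one (tsum _)]
    rw [← ENNReal.rpow_add _ _ h0 (hVtop x), add_sub_cancel]
  have hnorm : mixedNorm p' q' w = X ^ (1 / p') := by
    unfold mixedNorm
    congr 1
    refine lintegral_congr fun x => ?_
    rcases eq_or_ne (V x) 0 with h0 | h0
    · rw [h0, ENNReal.zero_rpow_of_pos (by positivity)]
      simp [hw0 _ x (hVz _ x h0), hq'0, hp'0]
    have : ∀ k, w k x ^ q' = t k x ^ q * V x ^ ((p / q - 1) * q') := fun k => by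
      simp only [hw]
      rw [ENNReal.mul_rpow_of_nonneg _ _ hq'0.le, ← ENNReal.rpow_mul, ← ENNReal.rpow_mul]
      congr 2
      linarith
    simp only [this]
    rw [ENNReal.tsum_mul_right]
    conv_lhs => enter [1, 1]; rw [← ENNReal.rpow_one (tsum _)]
    rw [← ENNReal.rpow_add _ _ h0 (hVtop x), ← ENNReal.rpow_mul]
    congr 1
    field_simp
    nlinarith
  have hmain : X ≤ A * X ^ (1 / p') := by
    rw [← hnorm]
    refine le_trans ?_ (h w n hwm (fun k x hk => hw0 k x (ht0 k x hk))
      (fun k x hk => hw0 k x (ht0' k x hk))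
      ⟨(b ^ ((p - 1) / q)).toNNReal, fun k x => ?_⟩)
    · rw [← lintegral_tsum (f := fun k x => u k x * w k x)
        (fun k => ((hu k).mul (hwm k)).aemeasurable)]
      refine lintegral_mono fun x => ?_
      rw [← hsum x]
      exact ENNReal.tsum_le_tsum fun k => mul_le_mul_left (truncSeq_le u n k x) _
    · rw [ENNReal.coe_toNNReal (ENNReal.rpow_ne_top_of_nonneg (div_nonneg (by linarith) hq0.le) hbtop)]
      exact hwB k x
  change X ^ (1 / p) ≤ A
  rcases eq_or_ne X 0 with h0 | h0
  · rw [h0, ENNReal.zero_rpow_of_pos (by positivity)]; exact zero_le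
  have hXX : X = X ^ (1 / p) * X ^ (1 / p') := by
    rw [← ENNReal.rpow_add _ _ h0 hXtop, one_div, one_div, hp.inv_add_inv_eq_one, ENNReal.rpow_one]
  refine (ENNReal.mul_le_mul_iff_left ?_ ?_).1 (hXX ▸ hmain : X ^ (1 / p) * X ^ (1 / p') ≤ _)
  · simp [h0, hXtop]
  · exact ENNReal.rpow_ne_top_of_nonneg (by positivity) hXtop

theorem lintegral_floor_atom_le_one {α : ℝ} (hα : 0 < α) (β : ℝ) (n : ℤ) :
    ∫⁻ y : ℝ, (if ⌊α * y + β⌋ = n then ENNReal.ofReal α else 0) ≤ 1 := by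
  calc _ ≤ ∫⁻ y in Set.Ico ((n - β) / α) ((n + 1 - β) / α), ENNReal.ofReal α := by
        rw [← lintegral_indicator measurableSet_Ico]
        refine lintegral_mono fun y => ?_
        beta_reduce
        split_ifs with h
        · rw [Set.indicator_of_mem]
          rw [Int.floor_eq_iff] at h
          rw [Set.mem_Ico, div_le_iff₀ hα, lt_div_iff₀ hα]
          constructor <;> linarith [h.1, h.2]
        · exact zero_le
    _ = 1 := by
        rw [setLIntegral_const, Real.volume_Ico, ← ENNReal.ofReal_mul hα.le,
          show α * ((n + 1 - β) / α - (n - β) / α) = 1 by field_simp; ring, ENNReal.ofReal_one]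

theorem floor_eq_floor_of_floor_natCast_mul_eq {M : ℕ} (hM : 0 < M) {a b : ℝ}
    (h : ⌊M * a⌋ = ⌊M * b⌋) : ⌊a⌋ = ⌊b⌋ := by
  have hM' : (0 : ℝ) < M := by exact_mod_cast hM
  symm
  rw [Int.floor_eq_iff]
  have h1 : (M : ℤ) * ⌊a⌋ ≤ ⌊M * a⌋ := by
    rw [Int.le_floor]; push_cast
    exact mul_le_mul_of_nonneg_left (Int.floor_le a) hM'.le
  have h2 : ⌊M * a⌋ < (M : ℤ) * (⌊a⌋ + 1) := by
    rw [Int.floor_lt]; push_cast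
    exact mul_lt_mul_of_pos_left (Int.lt_floor_add_one a) hM'
  rw [h, Int.le_floor] at h1
  rw [h, Int.floor_lt] at h2
  push_cast at h1 h2
  exact ⟨le_of_mul_le_mul_left h1 hM', lt_of_mul_lt_mul_left h2 hM'.le⟩

theorem floor_eq_or_floor_add_eq_of_abs_sub_le {a b : ℝ} (h : |a - b| ≤ 1 / 3) (k : ℕ) :
    ⌊a⌋ = ⌊b⌋ ∨ ⌊a + 2 ^ k / 3⌋ = ⌊b + 2 ^ k / 3⌋ := by
  wlog hab : a ≤ b generalizing a b
  · have := this (a := b) (b := a) (by rwa [abs_sub_comm]) (by linarith)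
    tauto
  rw [abs_le] at h
  have hk : ∃ m : ℤ, (2 : ℝ) ^ k / 3 = m + 1 / 3 ∨ (2 : ℝ) ^ k / 3 = m + 2 / 3 := by
    induction k with
    | zero => exact ⟨0, by norm_num⟩
    | succ k ih =>
      obtain ⟨m, hm | hm⟩ := ih
      · exact ⟨2 * m, Or.inr (by rw [pow_succ]; push_cast; linarith)⟩
      · exact ⟨2 * m + 1, Or.inl (by rw [pow_succ]; push_cast; linarith)⟩
  by_cases hf : ⌊a⌋ = ⌊b⌋
  · exact Or.inl hf
  right
  have h1 : ⌊a⌋ + 1 ≤ ⌊b⌋ := lt_of_le_of_ne (Int.floor_le_floor hab) hf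
  have h1' : (⌊a⌋ : ℝ) + 1 ≤ ⌊b⌋ := by exact_mod_cast h1
  have h2 := Int.floor_le b
  have h3 := Int.lt_floor_add_one a
  obtain ⟨m, hm⟩ := hk
  trans ⌊a⌋ + 1 + m
  · rw [Int.floor_eq_iff]
    push_cast
    rcases hm with hm | hm <;> rw [hm] <;> constructor <;> linarith
  · symm
    rw [Int.floor_eq_iff]
    push_cast
    rcases hm with hm | hm <;> rw [hm] <;> constructor <;> linarith

/-- The dyadic grid of mesh `2^(m-k)`, translated by `i * 2^m / 3`. -/
def gridIndex (j : ℕ × Fin 2) (k : ℕ) (x : ℝ) : ℤ :=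
  ⌊2 ^ k / 2 ^ j.1 * x + (j.2 : ℕ) * (2 ^ k / 3)⌋

def gridDensity (j : ℕ × Fin 2) (k : ℕ) : ℝ≥0∞ := ENNReal.ofReal (2 ^ k / 2 ^ j.1)

def gridWeight (j : ℕ × Fin 2) : ℝ≥0∞ := ENNReal.ofReal (36 * (1 / 2) ^ j.1)

theorem measurable_gridIndex (j : ℕ × Fin 2) (k : ℕ) : Measurable (gridIndex j k) :=
  Int.measurable_floor.comp (by fun_prop)

theorem lintegral_gridDensity_le_one (j : ℕ × Fin 2) (k : ℕ) (x : ℝ) :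
    ∫⁻ y, (if gridIndex j k y = gridIndex j k x then gridDensity j k else 0) ≤ 1 :=
  lintegral_floor_atom_le_one (by positivity) _ _

theorem gridIndex_eq_of_le (j : ℕ × Fin 2) (k N : ℕ) (hkN : k ≤ N) (x y : ℝ)
    (h : gridIndex j N x = gridIndex j N y) : gridIndex j k x = gridIndex j k y := by
  refine floor_eq_floor_of_floor_natCast_mul_eq (M := 2 ^ (N - k)) (by positivity) ?_
  have h1 : (2 : ℝ) ^ N = 2 ^ (N - k) * 2 ^ k := by rw [← pow_add, Nat.sub_add_cancel hkN]
  unfold gridIndex at h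
  rw [h1] at h
  push_cast
  convert h using 2 <;> ring

theorem tsum_gridWeight_ne_top : ∑' j, gridWeight j ≠ ⊤ := by
  rw [ENNReal.tsum_prod']
  simp only [gridWeight, tsum_fintype, Finset.sum_const, Finset.card_univ, Fintype.card_fin]
  simp only [nsmul_eq_mul]
  rw [ENNReal.tsum_mul_left, ← ENNReal.ofReal_tsum_of_nonneg (fun n => by positivity)
    (summable_geometric_two.mul_left 36)]
  exact ENNReal.mul_ne_top (by simp) (by simp)

/-- The dilates of the kernel `1 / (1 + x²)`. -/
def decayKernel (k : ℕ) (x : ℝ) : ℝ≥0∞ := ENNReal.ofReal (2 ^ k / (1 + (2 ^ k * x) ^ 2))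

def decayConv (k : ℕ) (g : ℝ → ℝ≥0∞) (x : ℝ) : ℝ≥0∞ := ∫⁻ y, decayKernel k (x - y) * g y

theorem measurable_decayKernel (k : ℕ) : Measurable (decayKernel k) := by
  unfold decayKernel
  fun_prop

theorem measurable_decayConv (k : ℕ) {g : ℝ → ℝ≥0∞} (hg : Measurable g) :
    Measurable (decayConv k g) :=
  Measurable.lintegral_prod_right' (f := fun z : ℝ × ℝ => decayKernel k (z.1 - z.2) * g z.2)
    (((measurable_decayKernel k).comp (measurable_fst.sub measurable_snd)).mul
      (hg.comp measurable_snd))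

theorem decayKernel_sub_comm (k : ℕ) (x y : ℝ) : decayKernel k (x - y) = decayKernel k (y - x) := by
  unfold decayKernel
  congr 3
  ring

theorem lintegral_decayConv_mul (k : ℕ) {g h : ℝ → ℝ≥0∞} (hg : Measurable g) (hh : Measurable h) :
    ∫⁻ x, decayConv k g x * h x = ∫⁻ x, g x * decayConv k h x := by
  have hK : Measurable fun z : ℝ × ℝ => decayKernel k (z.1 - z.2) :=
    (measurable_decayKernel k).comp (measurable_fst.sub measurable_snd)
  have hK1 : ∀ x, Measurable fun y => decayKernel k (x - y) := fun x =>
    (measurable_decayKernel k).comp (measurable_const.sub measurable_id)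
  calc _ = ∫⁻ x, ∫⁻ y, decayKernel k (x - y) * g y * h x := by
        refine lintegral_congr fun x => ?_
        rw [lintegral_mul_const _ (f := fun y => decayKernel k (x - y) * g y) ((hK1 x).mul hg)]
        rfl
    _ = ∫⁻ y, ∫⁻ x, decayKernel k (x - y) * g y * h x := by
        refine lintegral_lintegral_swap ?_
        exact ((hK.mul (hg.comp measurable_snd)).mul (hh.comp measurable_fst)).aemeasurable
    _ = ∫⁻ y, ∫⁻ x, g y * (decayKernel k (y - x) * h x) := by
        refine lintegral_congr fun y => lintegral_congr fun x => ?_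
        rw [decayKernel_sub_comm]
        ring
    _ = _ := by
        refine lintegral_congr fun x => ?_
        rw [lintegral_const_mul _ (f := fun y => decayKernel k (x - y) * h y) ((hK1 x).mul hh)]
        rfl

theorem decayKernel_sub_le_tsum (k : ℕ) (x y : ℝ) :
    decayKernel k (x - y) ≤ ∑' j, gridWeight j *
      (if gridIndex j k y = gridIndex j k x then gridDensity j k else 0) := by
  have hex : ∃ m : ℕ, |2 ^ k * (x - y)| ≤ 2 ^ m / 3 := by
    obtain ⟨m, hm⟩ := pow_unbounded_of_one_lt (3 * |2 ^ k * (x - y)|) (one_lt_two (α := ℝ))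
    exact ⟨m, by linarith⟩
  classical
  set m := Nat.find hex with hm
  have hle : |2 ^ k * (x - y)| ≤ 2 ^ m / 3 := Nat.find_spec hex
  have hpos : (0 : ℝ) < 2 ^ m := by positivity
  have hker : decayKernel k (x - y) ≤
      ENNReal.ofReal (36 * (1 / 2) ^ m) * ENNReal.ofReal (2 ^ k / 2 ^ m) := by
    rw [← ENNReal.ofReal_mul (by positivity)]
    refine ENNReal.ofReal_le_ofReal ?_
    rw [show 36 * (1 / 2 : ℝ) ^ m * (2 ^ k / 2 ^ m) = 2 ^ k / ((2 ^ m) ^ 2 / 36) by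
      rw [one_div, inv_pow]; field_simp]
    refine div_le_div_of_nonneg_left (by positivity) (by positivity) ?_
    rcases Nat.eq_zero_or_pos m with h0 | h0
    · rw [h0]
      nlinarith [sq_nonneg (2 ^ k * (x - y))]
    · have := Nat.find_min hex (m := m - 1) (by omega)
      rw [not_le, show (2 : ℝ) ^ (m - 1) = 2 ^ m / 2 by
        rw [eq_div_iff two_ne_zero, ← pow_succ, Nat.sub_add_cancel h0]] at this
      rw [← sq_abs (2 ^ k * (x - y))]
      nlinarith
  have hdist : |2 ^ k / 2 ^ m * y - 2 ^ k / 2 ^ m * x| ≤ 1 / 3 := by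
    rw [show 2 ^ k / 2 ^ m * y - 2 ^ k / 2 ^ m * x = -(2 ^ k * (x - y)) / 2 ^ m by ring, abs_div,
      abs_neg, abs_of_pos hpos, div_le_iff₀ hpos]
    linarith
  have : ∃ i : Fin 2, gridIndex (m, i) k y = gridIndex (m, i) k x := by
    rcases floor_eq_or_floor_add_eq_of_abs_sub_le hdist k with h | h
    · exact ⟨0, by simpa [gridIndex] using h⟩
    · exact ⟨1, by simpa [gridIndex] using h⟩
  obtain ⟨i, hi⟩ := this
  refine hker.trans (le_trans ?_ (ENNReal.le_tsum (m, i)))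
  rw [if_pos hi]
  rfl

theorem decayConv_le_tsum (k : ℕ) {g : ℝ → ℝ≥0∞} (hg : Measurable g) (x : ℝ) :
    decayConv k g x ≤
      ∑' j, gridWeight j * atomAverage (gridIndex j k) (gridDensity j k) g x := by
  have hm : ∀ j, Measurable fun y => (if gridIndex j k y = gridIndex j k x then gridDensity j k else 0) * g y :=
    fun j => Measurable.mul ((measurable_atomKernel (measurable_gridIndex j k) _).comp
      (measurable_const.prodMk measurable_id : Measurable fun y : ℝ => (x, y))) hg
  calc _ ≤ ∫⁻ y, ∑' j, gridWeight j *
        ((if gridIndex j k y = gridIndex j k x then gridDensity j k else 0) * g y) := by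
        refine lintegral_mono fun y => ?_
        simp only [← mul_assoc]
        rw [ENNReal.tsum_mul_right]
        exact mul_le_mul_left (decayKernel_sub_le_tsum k x y) _
    _ = _ := by
        rw [lintegral_tsum (fun j => ((hm j).const_mul _).aemeasurable)]
        refine tsum_congr fun j => ?_
        rw [lintegral_const_mul _ (hm j)]
        rfl

theorem lintegral_decayKernel_le (k : ℕ) (x : ℝ) :
    ∫⁻ y, decayKernel k (x - y) ≤ ∑' j, gridWeight j := by
  have := decayConv_le_tsum k (measurable_const (a := (1 : ℝ≥0∞))) x
  simp only [decayConv, atomAverage, mul_one] at this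
  refine this.trans (ENNReal.tsum_le_tsum fun j => ?_)
  calc _ ≤ gridWeight j * 1 := by
        gcongr
        exact lintegral_gridDensity_le_one j k x
    _ = _ := mul_one _

theorem exists_mixedNorm_decayConv_le_of_le {p q : ℝ} (hq : 1 < q) (hpq : q ≤ p) :
    ∃ C : ℝ≥0∞, C ≠ ⊤ ∧ ∀ g : ℕ → ℝ → ℝ≥0∞, (∀ k, Measurable (g k)) →
      mixedNorm p q (fun k => decayConv k (g k)) ≤ C * mixedNorm p q g := by
  have hq0 : 0 < q := by linarith
  have hp0 : 0 < p := by linarith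
  set P := p / q with hPdef
  have hP : 1 ≤ P := by rwa [hPdef, one_le_div hq0]
  have hP0 : 0 < P := by linarith
  set W := ∑' j, gridWeight j with hW
  have hWtop : W ≠ ⊤ := tsum_gridWeight_ne_top
  set D : ℝ≥0∞ := (W ^ (q - 1)) ^ P * (W ^ (P - 1) * (W * ENNReal.ofReal P ^ P)) with hD
  have hDtop : D ≠ ⊤ := by
    have h1 := ENNReal.rpow_ne_top_of_nonneg (by linarith : 0 ≤ q - 1) hWtop
    have h2 := ENNReal.rpow_ne_top_of_nonneg hP0.le h1
    have h3 := ENNReal.rpow_ne_top_of_nonneg (by linarith : 0 ≤ P - 1) hWtop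
    have h4 := ENNReal.rpow_ne_top_of_nonneg hP0.le (ENNReal.ofReal_ne_top (r := P))
    exact ENNReal.mul_ne_top h2 (ENNReal.mul_ne_top h3 (ENNReal.mul_ne_top hWtop h4))
  refine ⟨D ^ (1 / p), ENNReal.rpow_ne_top_of_nonneg (by positivity) hDtop, fun g hg => ?_⟩
  unfold mixedNorm
  rw [← ENNReal.mul_rpow_of_nonneg _ _ (by positivity)]
  refine ENNReal.rpow_le_rpow ?_ (by positivity)
  have hdm : ∀ k, Measurable (decayConv k (g k)) := fun k => measurable_decayConv k (hg k)
  refine lintegral_rpow_tsum_le_of_forall_range (fun k => (hdm k).pow_const q) hP0.le fun n => ?_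
  set Y : ℕ × Fin 2 → ℝ → ℝ≥0∞ := fun j x => ∑ k ∈ Finset.range n,
    atomAverage (gridIndex j k) (gridDensity j k) (fun y => g k y ^ q) x with hY
  have hYm : ∀ j, Measurable (Y j) := fun j => Finset.measurable_sum _ fun k _ =>
    measurable_atomAverage (measurable_gridIndex j k) _ ((hg k).pow_const q)
  have hpt : ∀ x, ∑ k ∈ Finset.range n, decayConv k (g k) x ^ q ≤
      W ^ (q - 1) * ∑' j, gridWeight j * Y j x := fun x => by
    calc _ ≤ ∑ k ∈ Finset.range n, W ^ (q - 1) * ∑' j, gridWeight j *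
          atomAverage (gridIndex j k) (gridDensity j k) (fun y => g k y ^ q) x := by
          refine Finset.sum_le_sum fun k _ => ?_
          refine (ENNReal.rpow_lintegral_mul_le volume hq.le ((measurable_decayKernel k).comp
            (measurable_const.sub measurable_id)) (hg k)).trans ?_
          refine mul_le_mul' (ENNReal.rpow_le_rpow (lintegral_decayKernel_le k x) (by linarith)) ?_
          exact decayConv_le_tsum k ((hg k).pow_const q) x
      _ = _ := by
          rw [← Finset.mul_sum]
          congr 1
          simp only [hY, Finset.mul_sum]
          exact (Summable.tsum_finsetSum fun k _ => ENNReal.summable).symm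
  calc _ ≤ ∫⁻ x, (W ^ (q - 1)) ^ P * (W ^ (P - 1) * ∑' j, gridWeight j * Y j x ^ P) := by
        refine lintegral_mono fun x => ?_
        refine (ENNReal.rpow_le_rpow (hpt x) hP0.le).trans ?_
        rw [ENNReal.mul_rpow_of_nonneg _ _ hP0.le]
        exact mul_le_mul_right (ENNReal.rpow_tsum_mul_le hP _ _) _
    _ = (W ^ (q - 1)) ^ P * (W ^ (P - 1) * ∑' j, gridWeight j * ∫⁻ x, Y j x ^ P) := by
        rw [lintegral_const_mul _ (by fun_prop), lintegral_const_mul _ (by fun_prop),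
          lintegral_tsum (fun j => by fun_prop)]
        congr 3
        ext j
        rw [lintegral_const_mul _ (by fun_prop)]
    _ ≤ (W ^ (q - 1)) ^ P * (W ^ (P - 1) * ∑' j, gridWeight j *
          (ENNReal.ofReal P ^ P * ∫⁻ x, (∑' k, g k x ^ q) ^ P)) := by
        refine mul_le_mul_right (mul_le_mul_right (ENNReal.tsum_le_tsum fun j =>
          mul_le_mul_right ?_ _) _) _
        refine (lintegral_rpow_sum_atomAverage_le (measurable_gridIndex j)
          (lintegral_gridDensity_le_one j) (gridIndex_eq_of_le j) hP
          (fun k => (hg k).pow_const q) n).trans ?_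
        refine mul_le_mul_right (lintegral_mono fun x => ENNReal.rpow_le_rpow ?_ hP0.le) _
        exact ENNReal.sum_le_tsum _
    _ = _ := by
        rw [ENNReal.tsum_mul_right, hD]
        ring

/-- A vector-valued maximal inequality for convolutions with dilates of a decaying kernel. -/
theorem exists_mixedNorm_decayConv_le {p q p' q' : ℝ} (hp : p.HolderConjugate p')
    (hq : q.HolderConjugate q') :
    ∃ C : ℝ≥0∞, C ≠ ⊤ ∧ ∀ g : ℕ → ℝ → ℝ≥0∞, (∀ k, Measurable (g k)) →
      mixedNorm p q (fun k => decayConv k (g k)) ≤ C * mixedNorm p q g := by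
  rcases le_total q p with h | h
  · exact exists_mixedNorm_decayConv_le_of_le hq.lt h
  have hpq' : q' ≤ p' := by
    rw [hp.conjugate_eq, hq.conjugate_eq]
    rw [div_le_div_iff₀ (by linarith [hq.lt]) (by linarith [hp.lt])]
    nlinarith
  obtain ⟨C, hC, hCg⟩ := exists_mixedNorm_decayConv_le_of_le hq.symm.lt hpq'
  refine ⟨C, hC, fun g hg => ?_⟩
  refine mixedNorm_le_of_forall_dual hp hq (fun k => measurable_decayConv k (hg k))
    fun v n hv _ _ _ => ?_
  simp only [lintegral_decayConv_mul _ (hg _) (hv _)]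
  refine (tsum_lintegral_mul_le_mixedNorm_mul_mixedNorm hp hq hg
    (fun k => measurable_decayConv k (hv k))).trans ?_
  calc _ ≤ mixedNorm p q g * (C * mixedNorm p' q' v) := by
        gcongr
        exact hCg v hv
    _ = _ := by ring

/-- The Fourier multiplier which `LPop φ₀ k` implements. -/
def lpMultiplier (φ₀ : ℝ → ℂ) (k : ℕ) : ℝ → ℂ := fun ξ =>
  if k = 0 then φ₀ ξ else φ₀ (ξ / 2 ^ k) - φ₀ (2 * (ξ / 2 ^ k))

theorem fourierInv_comp_div (ψ : ℝ → ℂ) {a : ℝ} (ha : 0 < a) (x : ℝ) :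
    𝓕⁻ (fun ξ => ψ (ξ / a)) x = a * 𝓕⁻ ψ (a * x) := by
  rw [Real.fourierInv_eq', Real.fourierInv_eq']
  have := Measure.integral_comp_div
    (fun ξ : ℝ => Complex.exp (((2 * π * inner ℝ ξ (a * x) : ℝ) : ℂ) * Complex.I) • ψ ξ) a
  rw [abs_of_pos ha] at this
  rw [← Complex.real_smul, ← this]
  congr 1
  ext ξ
  simp only [RCLike.inner_apply, conj_trivial]
  congr 5
  field_simp

theorem LPop_eq_conv_fourierInv (φ₀ : ℝ → ℂ) (k : ℕ) (g : ℝ → ℂ) :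
    LPop φ₀ k g = conv g (𝓕⁻ (lpMultiplier φ₀ k)) := by
  unfold LPop lpMultiplier
  split_ifs with hk
  · rfl
  · congr 1
    ext x
    rw [fourierInv_comp_div (fun ξ => φ₀ ξ - φ₀ (2 * ξ)) (by positivity : (0:ℝ) < 2 ^ k)]
    push_cast
    rfl

theorem sum_range_lpMultiplier (φ₀ : ℝ → ℂ) (n : ℕ) (ξ : ℝ) :
    ∑ k ∈ Finset.range (n + 1), lpMultiplier φ₀ k ξ = φ₀ (ξ / 2 ^ n) := by
  induction n with
  | zero => simp [lpMultiplier]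
  | succ n ih =>
    rw [Finset.sum_range_succ, ih, lpMultiplier, if_neg n.succ_ne_zero]
    have : 2 * (ξ / 2 ^ (n + 1)) = ξ / 2 ^ n := by field_simp; ring
    rw [this]
    ring

theorem lpMultiplier_eq_zero_of_le_abs {φ₀ : ℝ → ℂ}
    (hφzero : ∀ ξ : ℝ, 3/2 ≤ |ξ| → φ₀ ξ = 0) {k : ℕ} {ξ : ℝ} (h : 3 / 2 * 2 ^ k ≤ |ξ|) :
    lpMultiplier φ₀ k ξ = 0 := by
  have h2 : (0:ℝ) < 2 ^ k := by positivity
  have h3 : 3 / 2 ≤ |ξ / 2 ^ k| := by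
    rw [abs_div, abs_of_pos h2, le_div_iff₀ h2]; exact h
  unfold lpMultiplier
  split_ifs with hk
  · subst hk; simpa using hφzero _ h3
  · rw [hφzero _ h3, hφzero, sub_zero]
    rw [abs_mul, abs_two]; linarith

theorem lpMultiplier_eq_zero_of_abs_le {φ₀ : ℝ → ℂ}
    (hφone : ∀ ξ : ℝ, |ξ| ≤ 4/3 → φ₀ ξ = 1) {k : ℕ} (hk : k ≠ 0) {ξ : ℝ}
    (h : |ξ| ≤ 2 / 3 * 2 ^ k) : lpMultiplier φ₀ k ξ = 0 := by
  have h2 : (0:ℝ) < 2 ^ k := by positivity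
  have h3 : |ξ / 2 ^ k| ≤ 2 / 3 := by
    rw [abs_div, abs_of_pos h2, div_le_iff₀ h2]; exact h
  unfold lpMultiplier
  rw [if_neg hk, hφone, hφone, sub_self]
  · rw [abs_mul, abs_two]; linarith
  · linarith

theorem lpMultiplier_mul_eq_zero {φ₀ : ℝ → ℂ}
    (hφone : ∀ ξ : ℝ, |ξ| ≤ 4/3 → φ₀ ξ = 1)
    (hφzero : ∀ ξ : ℝ, 3/2 ≤ |ξ| → φ₀ ξ = 0) {k l : ℕ} (hkl : l ∉ Finset.Icc (k - 1) (k + 1))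
    {ξ η : ℝ} (h : |ξ| = |η|) :
    lpMultiplier φ₀ k ξ * lpMultiplier φ₀ l η = 0 := by
  have key : ∀ {k l : ℕ}, k + 2 ≤ l → ∀ {ξ η : ℝ}, |ξ| = |η| →
      lpMultiplier φ₀ k ξ * lpMultiplier φ₀ l η = 0 := by
    intro k l hkl ξ η h
    rcases le_total (3 / 2 * 2 ^ k) |ξ| with h1 | h1
    · rw [lpMultiplier_eq_zero_of_le_abs hφzero h1, zero_mul]
    · rw [lpMultiplier_eq_zero_of_abs_le hφone (k := l) (by omega), mul_zero]
      have : (2:ℝ) ^ (k + 2) ≤ 2 ^ l := pow_le_pow_right₀ one_le_two hkl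
      rw [pow_add] at this
      have : (0:ℝ) < 2 ^ k := by positivity
      linarith
  rw [Finset.mem_Icc, not_and_or] at hkl
  rcases hkl with h1 | h1
  · rw [mul_comm]
    exact key (by omega) h.symm
  · exact key (by omega) h

theorem sum_lpMultiplier_mul_lpMultiplier {φ₀ : ℝ → ℂ}
    (hφone : ∀ ξ : ℝ, |ξ| ≤ 4/3 → φ₀ ξ = 1)
    (hφzero : ∀ ξ : ℝ, 3/2 ≤ |ξ| → φ₀ ξ = 0) (k : ℕ) {ξ η : ℝ} (h : |ξ| = |η|) :
    ∑ l ∈ Finset.Icc (k - 1) (k + 1), lpMultiplier φ₀ l η * lpMultiplier φ₀ k ξ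
      = lpMultiplier φ₀ k ξ := by
  have hsub : Finset.Icc (k - 1) (k + 1) ⊆ Finset.range (k + 1 + 1) := by
    intro l hl
    rw [Finset.mem_Icc] at hl
    rw [Finset.mem_range]
    omega
  rw [Finset.sum_subset hsub fun l _ hl => by
    rw [mul_comm]; exact lpMultiplier_mul_eq_zero hφone hφzero hl h]
  rw [← Finset.sum_mul, sum_range_lpMultiplier]
  rcases le_total (3 / 2 * 2 ^ k) |ξ| with h1 | h1
  · rw [lpMultiplier_eq_zero_of_le_abs hφzero h1, mul_zero]
  · rw [hφone, one_mul]
    have h2 : (0:ℝ) < 2 ^ (k + 1) := by positivity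
    rw [abs_div, abs_of_pos h2, div_le_iff₀ h2, pow_succ, ← h]
    have : (0:ℝ) < 2 ^ k := by positivity
    linarith

theorem contDiff_lpMultiplier {φ₀ : ℝ → ℂ} (hφsmooth : ContDiff ℝ (⊤ : ℕ∞) φ₀) (k : ℕ) :
    ContDiff ℝ (⊤ : ℕ∞) (lpMultiplier φ₀ k) := by
  unfold lpMultiplier
  split_ifs
  · exact hφsmooth
  · fun_prop

theorem hasCompactSupport_lpMultiplier {φ₀ : ℝ → ℂ}
    (hφzero : ∀ ξ : ℝ, 3/2 ≤ |ξ| → φ₀ ξ = 0) (k : ℕ) :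
    HasCompactSupport (lpMultiplier φ₀ k) := by
  refine HasCompactSupport.intro (K := Metric.closedBall 0 (3 / 2 * 2 ^ k))
    (isCompact_closedBall _ _) fun ξ hξ => lpMultiplier_eq_zero_of_le_abs hφzero ?_
  rw [Metric.mem_closedBall, dist_zero_right, norm_eq_abs, not_le] at hξ
  exact hξ.le

/-- The cutoff functions from which inhomogeneous Littlewood–Paley decompositions are built. -/
structure IsLPCutoff (φ : ℝ → ℂ) : Prop where
  contDiff : ContDiff ℝ (⊤ : ℕ∞) φ
  eq_one : ∀ ξ : ℝ, |ξ| ≤ 4 / 3 → φ ξ = 1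
  eq_zero : ∀ ξ : ℝ, 3 / 2 ≤ |ξ| → φ ξ = 0

theorem integrable_norm_pow_mul_norm {u : ℝ → ℂ} (hu : Measurable u) {B R : ℝ}
    (hB : ∀ x, ‖u x‖ ≤ B) (hR : ∀ x, R < |x| → u x = 0) (n : ℕ) :
    Integrable fun v => ‖v‖ ^ n * ‖u v‖ := by
  have hm : AEStronglyMeasurable (fun v => ‖v‖ ^ n * ‖u v‖) :=
    ((measurable_norm.pow_const n).mul hu.norm).aestronglyMeasurable
  have hz : ∀ v ∉ Set.Icc (-R) R, ‖v‖ ^ n * ‖u v‖ = 0 := by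
    intro v hv
    rw [hR v, norm_zero, mul_zero]
    rw [Set.mem_Icc, ← abs_le] at hv
    exact not_le.1 hv
  rw [← integrableOn_iff_integrable_of_support_subset (s := Set.Icc (-R) R)
    fun v hv => by_contra fun hv' => hv (hz v hv')]
  refine Measure.integrableOn_of_bounded (M := |R| ^ n * |B|) (by simp) hm ?_
  refine (ae_restrict_mem measurableSet_Icc).mono fun v hv => ?_
  rw [norm_mul, norm_pow, norm_norm, norm_norm]
  have h1 : ‖v‖ ≤ |R| := (abs_le.2 hv).trans (le_abs_self R)
  have h2 : ‖u v‖ ≤ |B| := (hB v).trans (le_abs_self B)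
  gcongr

theorem integrable_of_bounded_of_support {u : ℝ → ℂ} (hu : Measurable u) {B R : ℝ}
    (hB : ∀ x, ‖u x‖ ≤ B) (hR : ∀ x, R < |x| → u x = 0) : Integrable u := by
  have := integrable_norm_pow_mul_norm hu hB hR 0
  simp only [pow_zero, one_mul] at this
  exact (integrable_norm_iff hu.aestronglyMeasurable).1 this

namespace IsLPCutoff

variable {φ : ℝ → ℂ}

theorem lpMultiplier_comp_neg (φ : ℝ → ℂ) (k : ℕ) (ξ : ℝ) :
    lpMultiplier (fun ξ => φ (-ξ)) k ξ = lpMultiplier φ k (-ξ) := by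
  simp [lpMultiplier, neg_div]

theorem comp_neg (h : IsLPCutoff φ) : IsLPCutoff fun ξ => φ (-ξ) where
  contDiff := h.contDiff.comp contDiff_neg
  eq_one ξ hξ := h.eq_one _ (by rwa [abs_neg])
  eq_zero ξ hξ := h.eq_zero _ (by rwa [abs_neg])

/-- The Littlewood–Paley multiplier as a Schwartz function. -/
def schwartzMultiplier (h : IsLPCutoff φ) (k : ℕ) : SchwartzMap ℝ ℂ :=
  (hasCompactSupport_lpMultiplier h.eq_zero k).toSchwartzMap (contDiff_lpMultiplier h.contDiff k)

theorem coe_schwartzMultiplier (h : IsLPCutoff φ) (k : ℕ) :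
    ⇑(h.schwartzMultiplier k) = lpMultiplier φ k := rfl

/-- The Littlewood–Paley kernel as a Schwartz function. -/
def kernel (h : IsLPCutoff φ) (k : ℕ) : SchwartzMap ℝ ℂ := 𝓕⁻ (h.schwartzMultiplier k)

theorem coe_kernel (h : IsLPCutoff φ) (k : ℕ) :
    ⇑(h.kernel k) = 𝓕⁻ (lpMultiplier φ k) := by
  rw [kernel, SchwartzMap.fourierInv_coe, coe_schwartzMultiplier]

theorem LPop_eq_conv (h : IsLPCutoff φ) (k : ℕ) (u : ℝ → ℂ) :
    LPop φ k u = conv u (h.kernel k) := by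
  rw [LPop_eq_conv_fourierInv, coe_kernel]

theorem LPop_eq_convolution (h : IsLPCutoff φ) (k : ℕ) (u : ℝ → ℂ) :
    LPop φ k u = convolution u (h.kernel k) (ContinuousLinearMap.mul ℂ ℂ) volume := by
  rw [h.LPop_eq_conv]
  rfl

theorem integrable_LPop (h : IsLPCutoff φ) (k : ℕ) {u : ℝ → ℂ} (hu : Integrable u) :
    Integrable (LPop φ k u) := by
  rw [h.LPop_eq_convolution]
  exact hu.integrable_convolution _ (h.kernel k).integrable

theorem exists_norm_kernel_le (h : IsLPCutoff φ) (k : ℕ) : ∃ B, ∀ x, ‖h.kernel k x‖ ≤ B := by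
  obtain ⟨B, -, hB⟩ := (h.kernel k).decay 0 0
  exact ⟨B, fun x => by simpa using hB x⟩

theorem continuous_LPop (h : IsLPCutoff φ) (k : ℕ) {u : ℝ → ℂ} (hu : Integrable u) :
    Continuous (LPop φ k u) := by
  rw [h.LPop_eq_convolution]
  obtain ⟨B, hB⟩ := h.exists_norm_kernel_le k
  exact BddAbove.continuous_convolution_right_of_integrable _
    ⟨B, by rintro _ ⟨x, rfl⟩; exact hB x⟩ hu (h.kernel k).continuous

theorem fourier_LPop (h : IsLPCutoff φ) (k : ℕ) {u : ℝ → ℂ} (hu : Integrable u) (ξ : ℝ) :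
    𝓕 (LPop φ k u) ξ = 𝓕 u ξ * lpMultiplier φ k ξ := by
  rw [h.LPop_eq_convolution, Real.fourier_mul_convolution_eq hu (h.kernel k).integrable,
    ← SchwartzMap.fourier_coe, kernel, FourierTransform.fourier_fourierInv_eq,
    coe_schwartzMultiplier]

theorem continuous_fourier_of_integrable {u : ℝ → ℂ} (hu : Integrable u) : Continuous (𝓕 u) :=
  VectorFourier.fourierIntegral_continuous Real.continuous_fourierChar (by fun_prop) hu

theorem norm_fourier_le {u : ℝ → ℂ} (ξ : ℝ) : ‖𝓕 u ξ‖ ≤ ∫ x, ‖u x‖ :=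
  VectorFourier.norm_fourierIntegral_le_integral_norm _ _ _ _ _

theorem integrable_fourier_mul_lpMultiplier (h : IsLPCutoff φ) (k : ℕ) {u : ℝ → ℂ}
    (hu : Integrable u) : Integrable fun ξ => 𝓕 u ξ * lpMultiplier φ k ξ :=
  (h.schwartzMultiplier k).integrable.bdd_mul
    (continuous_fourier_of_integrable hu).aestronglyMeasurable
    (Filter.Eventually.of_forall fun ξ => norm_fourier_le ξ)

theorem LPop_eq_fourierInv (h : IsLPCutoff φ) (k : ℕ) {u : ℝ → ℂ} (hu : Integrable u) :
    LPop φ k u = 𝓕⁻ fun ξ => 𝓕 u ξ * lpMultiplier φ k ξ := by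
  have hF : 𝓕 (LPop φ k u) = fun ξ => 𝓕 u ξ * lpMultiplier φ k ξ :=
    funext (h.fourier_LPop k hu)
  rw [← hF]
  refine ((h.continuous_LPop k hu).fourierInv_fourier_eq (h.integrable_LPop k hu) ?_).symm
  rw [hF]
  exact h.integrable_fourier_mul_lpMultiplier k hu

theorem kernel_comp_neg (h : IsLPCutoff φ) (k : ℕ) (x : ℝ) :
    h.comp_neg.kernel k x = h.kernel k (-x) := by
  have := Real.fourierInv_comp_linearIsometry (LinearIsometryEquiv.neg ℝ) (lpMultiplier φ k) x
  rw [LinearIsometryEquiv.coe_neg] at this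
  rw [coe_kernel, coe_kernel, ← this]
  exact congrArg (fun f : ℝ → ℂ => 𝓕⁻ f x) (funext (lpMultiplier_comp_neg φ k))

theorem integral_LPop_mul (h : IsLPCutoff φ) (k : ℕ) {u v : ℝ → ℂ} (hu : Integrable u)
    (hv : Integrable v) :
    ∫ x, LPop φ k u x * v x = ∫ x, u x * LPop (fun ξ => φ (-ξ)) k v x := by
  rw [h.LPop_eq_conv, h.comp_neg.LPop_eq_conv]
  simp only [conv, ← integral_mul_const, ← integral_const_mul]
  rw [integral_integral_swap]
  · refine integral_congr_ae (.of_forall fun t => integral_congr_ae (.of_forall fun x => ?_))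
    simp only [h.kernel_comp_neg, neg_sub]
    ring
  · obtain ⟨B, hB⟩ := h.exists_norm_kernel_le k
    have := (hv.mul_prod hu).bdd_mul (c := B) (f := fun z : ℝ × ℝ => h.kernel k (z.1 - z.2))
      ((h.kernel k).continuous.comp (by fun_prop)).aestronglyMeasurable
      (.of_forall fun z => hB _)
    refine this.congr (.of_forall fun z => ?_)
    simp only [Function.uncurry]
    ring

theorem LPop_LPop_comp_neg_eq_zero (h : IsLPCutoff φ) {k l : ℕ}
    (hkl : l ∉ Finset.Icc (k - 1) (k + 1)) {u : ℝ → ℂ} (hu : Integrable u) (x : ℝ) :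
    LPop φ k (LPop (fun ξ => φ (-ξ)) l u) x = 0 := by
  rw [h.LPop_eq_fourierInv k (h.comp_neg.integrable_LPop l hu)]
  have : (fun ξ => 𝓕 (LPop (fun ξ => φ (-ξ)) l u) ξ * lpMultiplier φ k ξ) = fun _ => 0 := by
    ext ξ
    have := lpMultiplier_mul_eq_zero h.eq_one h.eq_zero hkl (abs_neg ξ).symm
    rw [h.comp_neg.fourier_LPop l hu, mul_assoc, mul_comm (lpMultiplier _ l ξ)]
    rw [lpMultiplier_comp_neg, this, mul_zero]
  rw [this, Real.fourierInv_eq]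
  simp

theorem sum_LPop_comp_neg_LPop (h : IsLPCutoff φ) (k : ℕ) {u : ℝ → ℂ} (hu : Integrable u)
    (x : ℝ) :
    ∑ l ∈ Finset.Icc (k - 1) (k + 1), LPop (fun ξ => φ (-ξ)) l (LPop φ k u) x = LPop φ k u x := by
  have hi := h.integrable_LPop k hu
  rw [Finset.sum_congr rfl fun l _ => congrFun (h.comp_neg.LPop_eq_fourierInv l hi) x]
  conv_rhs => rw [h.LPop_eq_fourierInv k hu]
  simp only [Real.fourierInv_eq]
  rw [← integral_finsetSum]
  · refine integral_congr_ae (.of_forall fun ξ => ?_)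
    simp only [← Finset.smul_sum]
    congr 1
    rw [← Finset.mul_sum, h.fourier_LPop k hu, mul_assoc, mul_comm (lpMultiplier φ k ξ),
      Finset.sum_mul]
    simp only [lpMultiplier_comp_neg]
    rw [sum_lpMultiplier_mul_lpMultiplier h.eq_one h.eq_zero k (abs_neg ξ).symm]
  · intro l _
    have := h.comp_neg.integrable_fourier_mul_lpMultiplier l hi
    refine this.norm.mono' ?_ (.of_forall fun ξ => by rw [Circle.norm_smul])
    exact (Continuous.aestronglyMeasurable (by fun_prop)).smul this.aestronglyMeasurable

theorem exists_schwartzMap_eq_LPop (h : IsLPCutoff φ) (k : ℕ) {u : ℝ → ℂ} (hu : Measurable u)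
    {B R : ℝ} (hB : ∀ x, ‖u x‖ ≤ B) (hR : ∀ x, R < |x| → u x = 0) :
    ∃ G : SchwartzMap ℝ ℂ, ⇑G = LPop φ k u := by
  have hmoment := integrable_norm_pow_mul_norm hu hB hR
  have hui := integrable_of_bounded_of_support hu hB hR
  have hs : ContDiff ℝ (⊤ : ℕ∞) fun ξ => 𝓕 u ξ * lpMultiplier φ k ξ :=
    (Real.contDiff_fourier fun n _ => hmoment n).mul (contDiff_lpMultiplier h.contDiff k)
  have hc : HasCompactSupport fun ξ => 𝓕 u ξ * lpMultiplier φ k ξ :=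
    (hasCompactSupport_lpMultiplier h.eq_zero k).mul_left
  refine ⟨𝓕⁻ (hc.toSchwartzMap hs), ?_⟩
  rw [SchwartzMap.fourierInv_coe, h.LPop_eq_fourierInv k hui]
  rfl

end IsLPCutoff

theorem SchwartzMap.exists_norm_le_div_one_add_sq (f : SchwartzMap ℝ ℂ) :
    ∃ C : ℝ, 0 ≤ C ∧ ∀ x, ‖f x‖ ≤ C / (1 + x ^ 2) := by
  obtain ⟨C₀, hC₀, h₀⟩ := f.decay 0 0
  obtain ⟨C₂, hC₂, h₂⟩ := f.decay 2 0
  refine ⟨C₀ + C₂, by positivity, fun x => ?_⟩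
  have h0 := h₀ x
  have h2 := h₂ x
  simp only [pow_zero, one_mul, norm_iteratedFDeriv_zero, norm_eq_abs, sq_abs] at h0 h2
  rw [le_div_iff₀ (by positivity)]
  linarith

theorem lpMultiplier_succ (φ : ℝ → ℂ) (k : ℕ) (ξ : ℝ) :
    lpMultiplier φ (k + 1) ξ = lpMultiplier φ 1 (ξ / 2 ^ k) := by
  have : ξ / 2 ^ (k + 1) = ξ / 2 ^ k / 2 := by rw [pow_succ]; field_simp
  simp [lpMultiplier, this]

namespace IsLPCutoff

variable {φ : ℝ → ℂ}

theorem exists_enorm_kernel_le (h : IsLPCutoff φ) :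
    ∃ C : ℝ≥0∞, C ≠ ⊤ ∧ ∀ k x, ‖h.kernel k x‖ₑ ≤ C * decayKernel k x := by
  obtain ⟨C₀, hC₀, h₀⟩ := (h.kernel 0).exists_norm_le_div_one_add_sq
  obtain ⟨C₁, hC₁, h₁⟩ := (h.kernel 1).exists_norm_le_div_one_add_sq
  refine ⟨ENNReal.ofReal (C₀ + 2 * C₁), ENNReal.ofReal_ne_top, fun k x => ?_⟩
  rw [decayKernel, ← ENNReal.ofReal_mul (by positivity), ← ofReal_norm]
  refine ENNReal.ofReal_le_ofReal ?_
  rcases k with _ | k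
  · refine (h₀ x).trans ?_
    rw [pow_zero, one_mul, mul_one_div]
    gcongr
    linarith
  · have hk : h.kernel (k + 1) x = ((2 ^ k : ℝ) : ℂ) * h.kernel 1 (2 ^ k * x) := by
      rw [coe_kernel, coe_kernel, ← fourierInv_comp_div _ (by positivity : (0:ℝ) < 2 ^ k)]
      exact congrArg (fun f : ℝ → ℂ => 𝓕⁻ f x) (funext (lpMultiplier_succ φ k))
    rw [hk, norm_mul, Complex.norm_real, norm_eq_abs, abs_of_pos (by positivity)]
    calc (2:ℝ) ^ k * ‖h.kernel 1 (2 ^ k * x)‖ ≤ 2 ^ k * (C₁ / (1 + (2 ^ k * x) ^ 2)) := by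
          gcongr; exact h₁ _
      _ ≤ 2 * C₁ * (2 ^ (k + 1) / (1 + (2 ^ (k + 1) * x) ^ 2)) := by
          rw [mul_div_assoc', mul_div_assoc', div_le_div_iff₀ (by positivity) (by positivity),
            pow_succ' (2:ℝ) k]
          have : 0 ≤ 2 ^ k * C₁ := by positivity
          linear_combination 3 * this
      _ ≤ _ := by
          gcongr
          linarith

theorem exists_enorm_LPop_le (h : IsLPCutoff φ) :
    ∃ C : ℝ≥0∞, C ≠ ⊤ ∧ ∀ k u x,
      ‖LPop φ k u x‖ₑ ≤ C * decayConv k (fun y => ‖u y‖ₑ) x := by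
  obtain ⟨C, hC, hK⟩ := h.exists_enorm_kernel_le
  refine ⟨C, hC, fun k u x => ?_⟩
  rw [h.LPop_eq_conv, conv, decayConv, ← lintegral_const_mul' _ _ hC]
  refine (enorm_integral_le_lintegral_enorm _).trans (lintegral_mono fun y => ?_)
  rw [enorm_mul, mul_comm, ← mul_assoc]
  exact mul_le_mul_left (hK k _) _

theorem integrable_mul_kernel (h : IsLPCutoff φ) (k : ℕ) {u : ℝ → ℂ} (hu : Integrable u)
    (x : ℝ) : Integrable fun t => u t * h.kernel k (x - t) := by
  obtain ⟨B, hB⟩ := h.exists_norm_kernel_le k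
  exact hu.mul_bdd (c := B) ((h.kernel k).continuous.comp (by fun_prop)).aestronglyMeasurable
    (.of_forall fun t => hB _)

theorem LPop_sum_const_mul (h : IsLPCutoff φ) (k : ℕ) {ι : Type*} (S : Finset ι) (c : ι → ℂ)
    {u : ι → ℝ → ℂ} (hu : ∀ i, Integrable (u i)) (x : ℝ) :
    LPop φ k (fun y => ∑ i ∈ S, c i * u i y) x = ∑ i ∈ S, c i * LPop φ k (u i) x := by
  simp only [h.LPop_eq_conv, conv, Finset.sum_mul, mul_assoc]
  rw [integral_finsetSum _ fun i _ => (h.integrable_mul_kernel k (hu i) x).const_mul (c i)]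
  simp only [integral_const_mul]

end IsLPCutoff

/-- The weight `2 ^ (k * s)` of the `k`-th frequency band in `FNorm`. -/
def lpWeight (s : ℝ) (k : ℕ) : ℝ≥0∞ := ENNReal.ofReal ((2:ℝ) ^ ((k:ℝ) * s))

theorem mul_abs_le_of_mem_Icc {k l : ℕ} (hl : l ∈ Finset.Icc (k - 1) (k + 1)) (s : ℝ) :
    |((l:ℝ) - k) * s| ≤ |s| := by
  rw [Finset.mem_Icc] at hl
  have h1 : (l:ℝ) ≤ k + 1 := by exact_mod_cast hl.2
  have h2 : (k:ℝ) ≤ l + 1 := by exact_mod_cast (by omega : k ≤ l + 1)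
  rw [abs_mul]
  exact mul_le_of_le_one_left (abs_nonneg s) (abs_le.2 ⟨by linarith, by linarith⟩)

theorem lpWeight_neg_mul_lpWeight_le {k l : ℕ} (hl : l ∈ Finset.Icc (k - 1) (k + 1)) (s : ℝ) :
    lpWeight (-s) k * lpWeight s l ≤ ENNReal.ofReal (2 ^ |s|) := by
  rw [lpWeight, lpWeight, ← ENNReal.ofReal_mul (by positivity), ← Real.rpow_add two_pos]
  refine ENNReal.ofReal_le_ofReal (Real.rpow_le_rpow_of_exponent_le one_le_two ?_)
  have := (abs_le.1 (mul_abs_le_of_mem_Icc hl s)).2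
  linarith

theorem one_le_lpWeight_mul_lpWeight_neg {k l : ℕ} (hl : l ∈ Finset.Icc (k - 1) (k + 1)) (s : ℝ) :
    1 ≤ lpWeight s k * (ENNReal.ofReal (2 ^ |s|) * lpWeight (-s) l) := by
  rw [lpWeight, lpWeight, ← ENNReal.ofReal_mul (by positivity), ← ENNReal.ofReal_mul (by positivity),
    ← Real.rpow_add two_pos, ← Real.rpow_add two_pos, ENNReal.one_le_ofReal]
  refine Real.one_le_rpow one_le_two ?_
  have := (abs_le.1 (mul_abs_le_of_mem_Icc hl s)).2
  linarith

theorem FNorm_eq_mixedNorm (φ₀ : ℝ → ℂ) (p : ℝ) {q : ℝ} (hq : 0 ≤ q) (s : ℝ) (g : ℝ → ℂ) :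
    FNorm φ₀ p q s g = mixedNorm p q fun k x => lpWeight s k * ‖LPop φ₀ k g x‖ₑ := by
  simp only [FNorm, mixedNorm, lpWeight, ofReal_norm, ENNReal.mul_rpow_of_nonneg _ _ hq]
  simp only [ENNReal.ofReal_rpow_of_nonneg (Real.rpow_nonneg zero_le_two _) hq,
    ← Real.rpow_mul zero_le_two]

namespace IsLPCutoff

variable {φ : ℝ → ℂ}

theorem exists_norm_le (h : IsLPCutoff φ) : ∃ B, ∀ ξ, ‖φ ξ‖ ≤ B := by
  obtain ⟨B, -, hB⟩ := (h.schwartzMultiplier 0).decay 0 0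
  exact ⟨B, fun ξ => by simpa [coe_schwartzMultiplier, lpMultiplier] using hB ξ⟩

theorem sum_range_LPop (h : IsLPCutoff φ) (n : ℕ) {u : ℝ → ℂ} (hu : Integrable u) (x : ℝ) :
    ∑ k ∈ Finset.range (n + 1), LPop φ k u x
      = ∫ ξ : ℝ, 𝐞 (inner ℝ ξ x) • (𝓕 u ξ * φ (ξ / 2 ^ n)) := by
  rw [Finset.sum_congr rfl fun k _ => congrFun (h.LPop_eq_fourierInv k hu) x]
  simp only [Real.fourierInv_eq]
  rw [← integral_finsetSum]
  · refine integral_congr_ae (.of_forall fun ξ => ?_)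
    simp only [← Finset.smul_sum, ← Finset.mul_sum, sum_range_lpMultiplier]
  · intro k _
    have := h.integrable_fourier_mul_lpMultiplier k hu
    refine this.norm.mono' ?_ (.of_forall fun ξ => by rw [Circle.norm_smul])
    exact (Continuous.aestronglyMeasurable (by fun_prop)).smul this.aestronglyMeasurable

theorem norm_sum_range_LPop_le (h : IsLPCutoff φ) {B : ℝ} (hB : ∀ ξ, ‖φ ξ‖ ≤ B) (n : ℕ)
    (f : SchwartzMap ℝ ℂ) (x : ℝ) :
    ‖∑ k ∈ Finset.range (n + 1), LPop φ k f x‖ ≤ ∫ ξ, ‖𝓕 (f : ℝ → ℂ) ξ‖ * B := by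
  rw [h.sum_range_LPop n f.integrable]
  refine norm_integral_le_of_norm_le ?_ (.of_forall fun ξ => ?_)
  · exact ((𝓕 f : SchwartzMap ℝ ℂ).integrable.norm).mul_const B
  · rw [Circle.norm_smul, norm_mul]
    exact mul_le_mul_of_nonneg_left (hB _) (norm_nonneg _)

theorem tendsto_sum_range_LPop (h : IsLPCutoff φ) (f : SchwartzMap ℝ ℂ) (x : ℝ) :
    Filter.Tendsto (fun n => ∑ k ∈ Finset.range (n + 1), LPop φ k f x) Filter.atTop
      (nhds (f x)) := by
  obtain ⟨B, hB⟩ := h.exists_norm_le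
  have hf : f x = ∫ ξ : ℝ, 𝐞 (inner ℝ ξ x) • 𝓕 (f : ℝ → ℂ) ξ := by
    rw [← Real.fourierInv_eq, ← SchwartzMap.fourier_coe, ← SchwartzMap.fourierInv_coe,
      FourierTransform.fourierInv_fourier_eq]
  simp only [h.sum_range_LPop _ f.integrable, hf]
  have hc : Continuous (𝓕 (f : ℝ → ℂ)) := (𝓕 f : SchwartzMap ℝ ℂ).continuous
  refine tendsto_integral_of_dominated_convergence (fun ξ => ‖𝓕 (f : ℝ → ℂ) ξ‖ * B) ?_
    (((𝓕 f : SchwartzMap ℝ ℂ).integrable.norm).mul_const B) ?_ ?_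
  · intro n
    have := h.contDiff.continuous
    exact Continuous.aestronglyMeasurable (by fun_prop)
  · refine fun n => .of_forall fun ξ => ?_
    rw [Circle.norm_smul, norm_mul]
    exact mul_le_mul_of_nonneg_left (hB _) (norm_nonneg _)
  · refine .of_forall fun ξ => tendsto_const_nhds.congr' ?_
    obtain ⟨N, hN⟩ := pow_unbounded_of_one_lt |ξ| one_lt_two
    filter_upwards [Filter.eventually_ge_atTop N] with n hn
    have h2 : (2:ℝ) ^ N ≤ 2 ^ n := pow_le_pow_right₀ one_le_two hn
    have h3 : (0:ℝ) < 2 ^ n := by positivity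
    rw [h.eq_one, mul_one]
    rw [abs_div, abs_of_pos h3, div_le_iff₀ h3]
    linarith

theorem integrable_LPop_mul (h : IsLPCutoff φ) (k : ℕ) {f u : ℝ → ℂ} (hf : Integrable f)
    (hu : Integrable u) : Integrable fun x => LPop φ k f x * u x := by
  refine hu.bdd_mul (c := ∫ ξ, ‖𝓕 f ξ * lpMultiplier φ k ξ‖)
    (h.continuous_LPop k hf).aestronglyMeasurable (.of_forall fun x => ?_)
  rw [h.LPop_eq_fourierInv k hf, Real.fourierInv_eq]
  refine (norm_integral_le_integral_norm _).trans_eq ?_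
  simp only [Circle.norm_smul]

theorem tendsto_sum_range_integral_LPop_mul (h : IsLPCutoff φ) (f : SchwartzMap ℝ ℂ) {u : ℝ → ℂ}
    (hu : Integrable u) :
    Filter.Tendsto (fun n => ∑ k ∈ Finset.range (n + 1), ∫ x, LPop φ k f x * u x) Filter.atTop
      (nhds (∫ x, f x * u x)) := by
  obtain ⟨B, hB⟩ := h.exists_norm_le
  simp only [← integral_finsetSum _ fun k _ => h.integrable_LPop_mul k f.integrable hu,
    ← Finset.sum_mul]
  refine tendsto_integral_of_dominated_convergence
    (fun x => (∫ ξ, ‖𝓕 (f : ℝ → ℂ) ξ‖ * B) * ‖u x‖) ?_ (hu.norm.const_mul _) ?_ ?_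
  · intro n
    have : Continuous fun x => ∑ k ∈ Finset.range (n + 1), LPop φ k f x :=
      continuous_finsetSum _ fun k _ => h.continuous_LPop k f.integrable
    exact this.aestronglyMeasurable.mul hu.aestronglyMeasurable
  · refine fun n => .of_forall fun x => ?_
    rw [norm_mul]
    exact mul_le_mul_of_nonneg_right (h.norm_sum_range_LPop_le hB n f x) (norm_nonneg _)
  · exact .of_forall fun x => (h.tendsto_sum_range_LPop f x).mul_const _

theorem integral_LPop_mul_eq_sum (h : IsLPCutoff φ) (k : ℕ) {f u : ℝ → ℂ} (hf : Integrable f)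
    (hu : Integrable u) :
    ∫ x, LPop φ k f x * u x
      = ∑ l ∈ Finset.Icc (k - 1) (k + 1), ∫ x, LPop φ k f x * LPop φ l u x := by
  have hkf := h.integrable_LPop k hf
  have hneg : ∀ l, ∫ x, LPop (fun ξ => φ (-ξ)) l (LPop φ k f) x * u x
      = ∫ x, LPop φ k f x * LPop φ l u x := fun l => by
    simpa only [neg_neg] using h.comp_neg.integral_LPop_mul l hkf hu
  simp only [← hneg]
  rw [← integral_finsetSum _ fun l _ => h.comp_neg.integrable_LPop_mul l hkf hu]
  simp only [← Finset.sum_mul, h.sum_LPop_comp_neg_LPop k hf]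

end IsLPCutoff

theorem measurable_lpWeight_mul_enorm_LPop {φ : ℝ → ℂ} (h : IsLPCutoff φ) (s : ℝ) (k : ℕ)
    {u : ℝ → ℂ} (hu : Integrable u) : Measurable fun x => lpWeight s k * ‖LPop φ k u x‖ₑ :=
  (h.continuous_LPop k hu).measurable.enorm.const_mul _

namespace IsLPCutoff

variable {φ : ℝ → ℂ}

theorem enorm_integral_LPop_mul_le (h : IsLPCutoff φ) (s : ℝ) (k : ℕ) {f u : ℝ → ℂ}
    (hf : Integrable f) (hu : Integrable u) :
    ‖∫ x, LPop φ k f x * u x‖ₑ ≤ ∫⁻ x, (lpWeight s k * ‖LPop φ k f x‖ₑ) *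
      (ENNReal.ofReal (2 ^ |s|) *
        ∑ l ∈ Finset.Icc (k - 1) (k + 1), lpWeight (-s) l * ‖LPop φ l u x‖ₑ) := by
  rw [h.integral_LPop_mul_eq_sum k hf hu]
  have hm : ∀ l ∈ Finset.Icc (k - 1) (k + 1), Measurable fun x =>
      ‖LPop φ k f x * LPop φ l u x‖ₑ := fun l _ =>
    ((h.continuous_LPop k hf).mul (h.continuous_LPop l hu)).measurable.enorm
  calc _ ≤ ∑ l ∈ Finset.Icc (k - 1) (k + 1), ‖∫ x, LPop φ k f x * LPop φ l u x‖ₑ :=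
        enorm_sum_le _ _
    _ ≤ ∑ l ∈ Finset.Icc (k - 1) (k + 1), ∫⁻ x, ‖LPop φ k f x * LPop φ l u x‖ₑ :=
        Finset.sum_le_sum fun l _ => enorm_integral_le_lintegral_enorm _
    _ = ∫⁻ x, ∑ l ∈ Finset.Icc (k - 1) (k + 1), ‖LPop φ k f x * LPop φ l u x‖ₑ :=
        (lintegral_finsetSum _ hm).symm
    _ ≤ _ := by
        refine lintegral_mono fun x => ?_
        simp only [Finset.mul_sum]
        refine Finset.sum_le_sum fun l hl => ?_
        rw [enorm_mul]
        calc _ = 1 * (‖LPop φ k f x‖ₑ * ‖LPop φ l u x‖ₑ) := (one_mul _).symm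
          _ ≤ lpWeight s k * (ENNReal.ofReal (2 ^ |s|) * lpWeight (-s) l) *
                (‖LPop φ k f x‖ₑ * ‖LPop φ l u x‖ₑ) :=
              mul_le_mul_left (one_le_lpWeight_mul_lpWeight_neg hl s) _
          _ = _ := by ring

theorem enorm_integral_mul_le (h : IsLPCutoff φ) {p q p' q' : ℝ} (hp : p.HolderConjugate p')
    (hq : q.HolderConjugate q') (s : ℝ) (f : SchwartzMap ℝ ℂ) {u : ℝ → ℂ} (hu : Integrable u) :
    ‖∫ x, f x * u x‖ₑ
      ≤ ENNReal.ofReal (2 ^ |s|) * 4 * (FNorm φ p q s f * FNorm φ p' q' (-s) u) := by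
  have hmf := fun k => measurable_lpWeight_mul_enorm_LPop h s k f.integrable
  have hmu := fun k => measurable_lpWeight_mul_enorm_LPop h (-s) k hu
  refine le_of_tendsto' (h.tendsto_sum_range_integral_LPop_mul f hu).enorm fun n => ?_
  calc _ ≤ ∑ k ∈ Finset.range (n + 1), ‖∫ x, LPop φ k f x * u x‖ₑ := enorm_sum_le _ _
    _ ≤ ∑' k, ‖∫ x, LPop φ k f x * u x‖ₑ := ENNReal.sum_le_tsum _
    _ ≤ ∑' k, ∫⁻ x, (lpWeight s k * ‖LPop φ k f x‖ₑ) * (ENNReal.ofReal (2 ^ |s|) *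
          ∑ l ∈ Finset.Icc (k - 1) (k + 1), lpWeight (-s) l * ‖LPop φ l u x‖ₑ) :=
        ENNReal.tsum_le_tsum fun k => h.enorm_integral_LPop_mul_le s k f.integrable hu
    _ ≤ FNorm φ p q s f * mixedNorm p' q' fun k x => ENNReal.ofReal (2 ^ |s|) *
          ∑ l ∈ Finset.Icc (k - 1) (k + 1), lpWeight (-s) l * ‖LPop φ l u x‖ₑ := by
        rw [FNorm_eq_mixedNorm φ p hq.nonneg]
        exact tsum_lintegral_mul_le_mixedNorm_mul_mixedNorm hp hq hmf fun k =>
          (Finset.measurable_fun_sum _ fun l _ => hmu l).const_mul _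
    _ ≤ FNorm φ p q s f * (ENNReal.ofReal (2 ^ |s|) * (4 * FNorm φ p' q' (-s) u)) := by
        rw [mixedNorm_const_mul hp.symm.pos hq.symm.pos _ fun k =>
          Finset.measurable_fun_sum _ fun l _ => hmu l, FNorm_eq_mixedNorm φ p' hq.symm.nonneg]
        refine mul_le_mul_right (mul_le_mul_right ?_ _) _
        exact mixedNorm_adjacent_le hp.symm.pos hq.symm.lt.le hmu
    _ = _ := by ring

end IsLPCutoff

theorem decayConv_mono {g g' : ℝ → ℝ≥0∞} (hg : ∀ y, g y ≤ g' y) (k : ℕ) (x : ℝ) :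
    decayConv k g x ≤ decayConv k g' x :=
  lintegral_mono fun y => mul_le_mul_right (hg y) _

theorem decayConv_const_mul {c : ℝ≥0∞} (hc : c ≠ ⊤) (g : ℝ → ℝ≥0∞) (k : ℕ) (x : ℝ) :
    decayConv k (fun y => c * g y) x = c * decayConv k g x := by
  rw [decayConv, decayConv, ← lintegral_const_mul' _ _ hc]
  simp only [mul_left_comm]

theorem decayConv_finsetSum {ι : Type*} (S : Finset ι) {g : ι → ℝ → ℝ≥0∞}
    (hg : ∀ i, Measurable (g i)) (k : ℕ) (x : ℝ) :
    decayConv k (fun y => ∑ i ∈ S, g i y) x = ∑ i ∈ S, decayConv k (g i) x := by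
  simp only [decayConv, Finset.mul_sum]
  refine lintegral_finsetSum _ fun i _ => Measurable.mul ?_ (hg i)
  unfold decayKernel
  fun_prop

namespace IsLPCutoff

variable {φ : ℝ → ℂ}

theorem exists_FNorm_sum_LPop_le (h : IsLPCutoff φ) {p q p' q' : ℝ} (hp : p.HolderConjugate p')
    (hq : q.HolderConjugate q') (s : ℝ) : ∃ C : ℝ≥0∞, C ≠ ⊤ ∧
      ∀ (n : ℕ) (g : ℕ → ℝ → ℂ) (v : ℕ → ℝ → ℝ≥0∞), (∀ k, Integrable (g k)) →
        (∀ k, Measurable (v k)) → (∀ k x, ‖g k x‖ₑ ≤ v k x) →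
        FNorm φ p q (-s) (fun x => ∑ l ∈ Finset.range n,
          (((2:ℝ) ^ ((l:ℝ) * s) : ℝ) : ℂ) * LPop (fun ξ => φ (-ξ)) l (g l) x)
          ≤ C * mixedNorm p q v := by
  obtain ⟨C₁, hC₁, h₁⟩ := h.exists_enorm_LPop_le
  obtain ⟨C₂, hC₂, h₂⟩ := h.comp_neg.exists_enorm_LPop_le
  obtain ⟨A, hA, hFS⟩ := exists_mixedNorm_decayConv_le hp hq
  refine ⟨ENNReal.ofReal (2 ^ |s|) * C₁ * C₂ * (A * (4 * A)), by finiteness, ?_⟩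
  intro n g v hg hv hgv
  set D : ℕ → ℝ → ℝ≥0∞ := fun l => decayConv l (v l) with hD
  have hDm : ∀ l, Measurable (D l) := fun l => measurable_decayConv l (hv l)
  have hbound : ∀ k x, lpWeight (-s) k * ‖LPop φ k (fun x => ∑ l ∈ Finset.range n,
      (((2:ℝ) ^ ((l:ℝ) * s) : ℝ) : ℂ) * LPop (fun ξ => φ (-ξ)) l (g l) x) x‖ₑ
      ≤ ENNReal.ofReal (2 ^ |s|) * C₁ * C₂ *
        decayConv k (fun y => ∑ l ∈ Finset.Icc (k - 1) (k + 1), D l y) x := by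
    intro k x
    rw [h.LPop_sum_const_mul k _ _ fun l => h.comp_neg.integrable_LPop l (hg l),
      decayConv_finsetSum _ hDm, Finset.mul_sum]
    refine (mul_le_mul_right (enorm_sum_le _ _) _).trans ?_
    rw [Finset.mul_sum]
    refine (Finset.sum_le_sum_of_ne_zero (t := Finset.Icc (k - 1) (k + 1)) fun l _ hl => ?_).trans
      (Finset.sum_le_sum fun l hl => ?_)
    · by_contra hkl
      rw [h.LPop_LPop_comp_neg_eq_zero hkl (hg l), mul_zero, enorm_zero, mul_zero] at hl
      exact hl rfl
    · have hw : ‖(((2:ℝ) ^ ((l:ℝ) * s) : ℝ) : ℂ)‖ₑ = lpWeight s l := by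
        rw [lpWeight, ← ofReal_norm, Complex.norm_real, norm_of_nonneg (by positivity)]
      rw [enorm_mul, hw, ← mul_assoc, mul_assoc _ C₁ C₂, mul_assoc (ENNReal.ofReal _)]
      refine mul_le_mul' (lpWeight_neg_mul_lpWeight_le hl s) ?_
      rw [mul_assoc, ← decayConv_const_mul hC₂]
      refine (h₁ k _ x).trans (mul_le_mul_right (decayConv_mono (fun y => ?_) k x) _)
      exact (h₂ l _ y).trans (mul_le_mul_right (decayConv_mono (hgv l) l y) _)
  have hsum : ∀ k, Measurable fun y => ∑ l ∈ Finset.Icc (k - 1) (k + 1), D l y := fun k =>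
    Finset.measurable_fun_sum _ fun l _ => hDm l
  rw [FNorm_eq_mixedNorm φ p hq.nonneg]
  refine (mixedNorm_mono hp.nonneg hq.nonneg hbound).trans ?_
  rw [mixedNorm_const_mul hp.pos hq.pos _ fun k => measurable_decayConv k (hsum k)]
  have hfin : mixedNorm p q (fun k => decayConv k fun y =>
      ∑ l ∈ Finset.Icc (k - 1) (k + 1), D l y) ≤ A * (4 * (A * mixedNorm p q v)) :=
    calc _ ≤ A * mixedNorm p q fun k y => ∑ l ∈ Finset.Icc (k - 1) (k + 1), D l y := hFS _ hsum
      _ ≤ A * (4 * mixedNorm p q D) :=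
          mul_le_mul_right (mixedNorm_adjacent_le hp.pos hq.lt.le hDm) _
      _ ≤ A * (4 * (A * mixedNorm p q v)) :=
          mul_le_mul_right (mul_le_mul_right (hFS v hv) _) _
  refine (mul_le_mul_right hfin _).trans_eq ?_
  ring

end IsLPCutoff

theorem measurable_haarFn (j : ℕ) (μ : ℤ) : Measurable (haarFn j μ) :=
  (measurable_const.indicator measurableSet_Ico).sub (measurable_const.indicator measurableSet_Ico)

theorem norm_haarFn_le (j : ℕ) (μ : ℤ) (x : ℝ) : ‖haarFn j μ x‖ ≤ 2 := by
  have h : ∀ s : Set ℝ, ‖s.indicator (fun _ => (1:ℂ)) x‖ ≤ 1 := fun s =>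
    (norm_indicator_le_norm_self _ _).trans (by simp)
  refine (norm_sub_le _ _).trans ?_
  linarith [h (Set.Ico ((2:ℝ)^(-(j:ℤ)) * μ) ((2:ℝ)^(-(j:ℤ)) * (μ + 1/2))),
    h (Set.Ico ((2:ℝ)^(-(j:ℤ)) * (μ + 1/2)) ((2:ℝ)^(-(j:ℤ)) * (μ + 1)))]

theorem integrable_haarFn (j : ℕ) (μ : ℤ) : Integrable (haarFn j μ) :=
  ((integrable_indicator_iff measurableSet_Ico).2 (by simp)).sub
    ((integrable_indicator_iff measurableSet_Ico).2 (by simp))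

theorem integrable_haarProj (E : Finset (ℕ × ℤ)) (f : ℝ → ℂ) : Integrable (haarProj E f) :=
  integrable_finsetSum _ fun e _ => (integrable_haarFn e.1 e.2).const_mul _

theorem integral_haarProj_mul (E : Finset (ℕ × ℤ)) {f g : ℝ → ℂ} (hf : Integrable f)
    (hg : Integrable g) :
    ∫ x, haarProj E f x * g x = ∫ x, f x * haarProj E g x := by
  have hi : ∀ {u : ℝ → ℂ}, Integrable u → ∀ e : ℕ × ℤ,
      Integrable fun x => u x * haarFn e.1 e.2 x := fun hu e =>
    hu.mul_bdd (measurable_haarFn _ _).aestronglyMeasurable (.of_forall (norm_haarFn_le _ _))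
  have h1 : ∀ x, haarProj E f x * g x
      = ∑ e ∈ E, (2:ℂ)^e.1 * (∫ y, f y * haarFn e.1 e.2 y) * (g x * haarFn e.1 e.2 x) := by
    intro x
    rw [haarProj, Finset.sum_mul]
    exact Finset.sum_congr rfl fun e _ => by ring
  have h2 : ∀ x, f x * haarProj E g x
      = ∑ e ∈ E, (2:ℂ)^e.1 * (∫ y, g y * haarFn e.1 e.2 y) * (f x * haarFn e.1 e.2 x) := by
    intro x
    rw [haarProj, Finset.mul_sum]
    exact Finset.sum_congr rfl fun e _ => by ring
  simp only [h1, h2]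
  rw [integral_finsetSum _ fun e _ => (hi hg e).const_mul _,
    integral_finsetSum _ fun e _ => (hi hf e).const_mul _]
  refine Finset.sum_congr rfl fun e _ => ?_
  rw [integral_const_mul, integral_const_mul]
  ring

/-- The unimodular factor turning `z` into `‖z‖`. -/
def conjPhase (z : ℂ) : ℂ := (starRingEnd ℂ) z / ‖z‖

theorem mul_conjPhase (z : ℂ) : z * conjPhase z = ‖z‖ := by
  rcases eq_or_ne z 0 with rfl | hz
  · simp [conjPhase]
  · have : (‖z‖ : ℂ) ≠ 0 := by simpa using hz
    rw [conjPhase, mul_div_assoc', Complex.mul_conj', div_eq_iff this, sq]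

theorem norm_conjPhase_le (z : ℂ) : ‖conjPhase z‖ ≤ 1 := by
  rw [conjPhase, norm_div, RCLike.norm_conj, Complex.norm_real, norm_norm]
  exact div_self_le_one _

theorem measurable_conjPhase : Measurable conjPhase := by
  unfold conjPhase
  exact Complex.continuous_conj.measurable.div
    (Complex.measurable_ofReal.comp measurable_norm)

namespace IsLPCutoff

variable {φ : ℝ → ℂ}

theorem exists_tsum_lintegral_mul_eq (h : IsLPCutoff φ) (s : ℝ) {F : ℝ → ℂ} (hF : Integrable F)
    {v : ℕ → ℝ → ℝ≥0∞} {n : ℕ} (hv : ∀ k, Measurable (v k)) (hvn : ∀ k x, n ≤ k → v k x = 0)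
    {B : NNReal} (hvB : ∀ k x, v k x ≤ B) :
    ∃ g : ℕ → ℝ → ℂ, (∀ k, Measurable (g k)) ∧ (∀ k x, ‖g k x‖ₑ ≤ v k x) ∧
      ∑' k, ∫⁻ x, (lpWeight s k * ‖LPop φ k F x‖ₑ) * v k x =
        ‖∑ k ∈ Finset.range n, (((2:ℝ) ^ ((k:ℝ) * s) : ℝ) : ℂ) * ∫ x, LPop φ k F x * g k x‖ₑ := by
  have hvtop : ∀ k x, v k x ≠ ⊤ := fun k x => ((hvB k x).trans_lt ENNReal.coe_lt_top).ne
  set g : ℕ → ℝ → ℂ := fun k x => ((v k x).toReal : ℂ) * conjPhase (LPop φ k F x) with hgdef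
  have hLg : ∀ k x, LPop φ k F x * g k x = ((‖LPop φ k F x‖ * (v k x).toReal : ℝ) : ℂ) := by
    intro k x
    rw [hgdef]
    dsimp only
    rw [mul_left_comm, mul_conjPhase]
    push_cast
    ring
  refine ⟨g, fun k => ?_, fun k x => ?_, ?_⟩
  · exact (Complex.measurable_ofReal.comp (hv k).ennreal_toReal).mul
      (measurable_conjPhase.comp (h.continuous_LPop k hF).measurable)
  · rw [hgdef, enorm_mul]
    have h1 : ‖((v k x).toReal : ℂ)‖ₑ = v k x := by
      rw [← ofReal_norm, Complex.norm_real, norm_of_nonneg ENNReal.toReal_nonneg,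
        ENNReal.ofReal_toReal (hvtop k x)]
    have h2 : ‖conjPhase (LPop φ k F x)‖ₑ ≤ 1 := by
      rw [← ofReal_norm]
      exact ENNReal.ofReal_le_one.2 (norm_conjPhase_le _)
    rw [h1]
    exact mul_le_of_le_one_right' h2
  · rw [tsum_eq_sum (s := Finset.range n) fun k hk => by
      simp [hvn k _ (not_lt.1 fun hlt => hk (Finset.mem_range.2 hlt))]]
    have hmoment : ∀ k, ∫⁻ x, ‖LPop φ k F x‖ₑ * v k x
        = ENNReal.ofReal (∫ x, ‖LPop φ k F x‖ * (v k x).toReal) := by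
      intro k
      rw [ofReal_integral_eq_lintegral_ofReal]
      · refine lintegral_congr fun x => ?_
        rw [ENNReal.ofReal_mul (norm_nonneg _), ofReal_norm, ENNReal.ofReal_toReal (hvtop k x)]
      · refine (h.integrable_LPop k hF).norm.mul_bdd (c := B)
          (hv k).ennreal_toReal.aestronglyMeasurable (.of_forall fun x => ?_)
        rw [norm_of_nonneg ENNReal.toReal_nonneg]
        exact ENNReal.toReal_le_coe_of_le_coe (hvB k x)
      · exact .of_forall fun x => by positivity
    have hterm : ∀ k, ∫⁻ x, (lpWeight s k * ‖LPop φ k F x‖ₑ) * v k x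
        = ENNReal.ofReal ((2:ℝ) ^ ((k:ℝ) * s) * ∫ x, ‖LPop φ k F x‖ * (v k x).toReal) := by
      intro k
      rw [ENNReal.ofReal_mul (by positivity), ← hmoment, ← lpWeight]
      simp only [mul_assoc]
      exact lintegral_const_mul' _ _ ENNReal.ofReal_ne_top
    have hnn : ∀ k : ℕ, 0 ≤ (2:ℝ) ^ ((k:ℝ) * s) * ∫ x, ‖LPop φ k F x‖ * (v k x).toReal := fun k =>
      mul_nonneg (by positivity) (integral_nonneg fun x => by positivity)
    simp only [hterm, hLg, integral_complex_ofReal]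
    rw [← ENNReal.ofReal_sum_of_nonneg fun k _ => hnn k, ← ofReal_norm]
    congr 1
    rw [← norm_of_nonneg (Finset.sum_nonneg fun k _ => hnn k), ← Complex.norm_real]
    push_cast
    rfl

end IsLPCutoff

/-- Duality: boundedness of $P_E$ on $F^{-s}_{p',q'}$ with constant $A_0$ implies
boundedness on $F^{s}_{p,q}$ with constant $C A_0$. -/
theorem haar_projection_duality
    (p q s p' q' : ℝ) (hp : 1 < p) (hq : 1 < q)
    (hp' : 1/p + 1/p' = 1) (hq' : 1/q + 1/q' = 1)
    (φ₀ : ℝ → ℂ) (hφsmooth : ContDiff ℝ (⊤ : ℕ∞) φ₀) (hφcpt : HasCompactSupport φ₀)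
    (hφone : ∀ ξ : ℝ, |ξ| ≤ 4/3 → φ₀ ξ = 1)
    (hφzero : ∀ ξ : ℝ, 3/2 ≤ |ξ| → φ₀ ξ = 0) :
    ∃ C : ℝ, 0 < C ∧ ∀ (E : Finset (ℕ × ℤ)) (A₀ : ℝ), 0 ≤ A₀ →
      (∀ g : SchwartzMap ℝ ℂ,
        FNorm φ₀ p' q' (-s) (haarProj E g) ≤ ENNReal.ofReal A₀ * FNorm φ₀ p' q' (-s) g) →
      ∀ f : SchwartzMap ℝ ℂ,
        FNorm φ₀ p q s (haarProj E f) ≤ ENNReal.ofReal (C * A₀) * FNorm φ₀ p q s f := by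
  have h : IsLPCutoff φ₀ := ⟨hφsmooth, hφone, hφzero⟩
  have hpc : p.HolderConjugate p' :=
    Real.holderConjugate_iff.2 ⟨hp, by simpa only [one_div] using hp'⟩
  have hqc : q.HolderConjugate q' :=
    Real.holderConjugate_iff.2 ⟨hq, by simpa only [one_div] using hq'⟩
  obtain ⟨C₂, hC₂, h₂⟩ := h.exists_FNorm_sum_LPop_le hpc.symm hqc.symm s
  set K : ℝ≥0∞ := ENNReal.ofReal (2 ^ |s|) * 4 * C₂ with hK
  have hKtop : K ≠ ⊤ := by finiteness
  refine ⟨K.toReal + 1, by positivity, fun E A₀ hA₀ hE f => ?_⟩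
  have hKle : K ≤ ENNReal.ofReal (K.toReal + 1) := by
    conv_lhs => rw [← ENNReal.ofReal_toReal hKtop]
    exact ENNReal.ofReal_le_ofReal (by linarith)
  have hF := integrable_haarProj E f
  have hweak : FNorm φ₀ p q s (haarProj E f) ≤ K * ENNReal.ofReal A₀ * FNorm φ₀ p q s f := by
    rw [FNorm_eq_mixedNorm φ₀ p hqc.nonneg]
    refine mixedNorm_le_of_forall_dual hpc hqc
      (fun k => measurable_lpWeight_mul_enorm_LPop h s k hF) ?_
    rintro v n hv hvn hvs ⟨B, hvB⟩
    obtain ⟨g, hg, hgv, hsum⟩ := h.exists_tsum_lintegral_mul_eq s hF hv hvn hvB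
    rw [hsum]
    have hgB : ∀ k x, ‖g k x‖ ≤ B := fun k x => by
      have := (hgv k x).trans (hvB k x)
      rw [← ofReal_norm] at this
      exact (ENNReal.ofReal_le_coe).1 this
    have hgs : ∀ k (x : ℝ), n < |x| → g k x = 0 := fun k x hx => by
      have := (hgv k x).trans_eq (hvs k x hx)
      exact enorm_eq_zero.1 (le_antisymm this zero_le)
    have hgi : ∀ k, Integrable (g k) := fun k =>
      integrable_of_bounded_of_support (hg k) (hgB k) (hgs k)
    choose S hS using fun k => h.comp_neg.exists_schwartzMap_eq_LPop k (hg k) (hgB k) (hgs k)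
    set G : SchwartzMap ℝ ℂ :=
      ∑ l ∈ Finset.range n, (((2:ℝ) ^ ((l:ℝ) * s) : ℝ) : ℂ) • S l with hG
    have hGcoe : ⇑G = fun x => ∑ l ∈ Finset.range n,
        (((2:ℝ) ^ ((l:ℝ) * s) : ℝ) : ℂ) * LPop (fun ξ => φ₀ (-ξ)) l (g l) x := by
      ext x
      simp only [← hS]
      simp [hG]
    have hpair : ∑ k ∈ Finset.range n, (((2:ℝ) ^ ((k:ℝ) * s) : ℝ) : ℂ) *
        ∫ x, LPop φ₀ k (haarProj E f) x * g k x = ∫ x, f x * haarProj E G x := by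
      rw [← integral_haarProj_mul E f.integrable G.integrable, hGcoe]
      simp only [h.integral_LPop_mul _ hF (hgi _), Finset.mul_sum, mul_left_comm _ (Complex.ofReal _)]
      rw [integral_finsetSum]
      · simp only [integral_const_mul]
      · intro k _
        have := h.comp_neg.integrable_LPop_mul k (hgi k) hF
        exact (this.const_mul _).congr (.of_forall fun x => by ring)
    rw [hpair]
    have hGnorm : FNorm φ₀ p' q' (-s) G ≤ C₂ * mixedNorm p' q' v := by
      rw [hGcoe]
      exact h₂ n g v hgi hv hgv
    calc _ ≤ ENNReal.ofReal (2 ^ |s|) * 4 *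
          (FNorm φ₀ p q s f * FNorm φ₀ p' q' (-s) (haarProj E G)) :=
          h.enorm_integral_mul_le hpc hqc s f (integrable_haarProj E G)
      _ ≤ ENNReal.ofReal (2 ^ |s|) * 4 * (FNorm φ₀ p q s f *
            (ENNReal.ofReal A₀ * (C₂ * mixedNorm p' q' v))) :=
          mul_le_mul_right (mul_le_mul_right ((hE G).trans (mul_le_mul_right hGnorm _)) _) _
      _ = _ := by rw [hK]; ring
  refine hweak.trans (mul_le_mul_left ?_ _)
  rw [ENNReal.ofReal_mul (by positivity)]
  exact mul_le_mul_left hKle _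
end
end

section
/- Let 0 < q ≤ p < ∞. There exists a constant C (depending only on p and q) such that for every sequence of positive real numbers (r_k)_{k≥0} and every doubly indexed family (f_{k,n})_{k,n≥0} of Schwartz functions on ℝ such that the Fourier transform of f_{k,n} is supported in the interval [−r_k, r_k] for all n, one has ‖ (∑_{k,n≥0} 2^{−n} (𝔐_n^{r_k} f_{k,n})^q)^{1/q} ‖_{L^p(ℝ)} ≤ C · ‖ (∑_{k,n≥0} |f_{k,n}|^q)^{1/q} ‖_{L^p(ℝ)}, where for r > 0 and an integer n ≥ 0 the Peetre-type maximal function is 𝔐_n^{r} g(x) = sup_{|y| ≤ 2^{n+2}/r} |g(x+y)|. -/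
open MeasureTheory Real FourierTransform
open scoped ENNReal

noncomputable section

/-- The Peetre-type maximal function $\mathfrak M^r_n g(x)=\sup_{|y|\le 2^{n+2}/r}|g(x+y)|$. -/
def peetreMax (r : ℝ) (n : ℕ) (g : ℝ → ℂ) (x : ℝ) : ℝ :=
  sSup {t : ℝ | ∃ y : ℝ, |y| ≤ 2^(n+2)/r ∧ t = ‖g (x + y)‖}

/-- The Jensen inequality for powers, with respect to an arbitrary measure. -/
theorem rpow_lintegral_le {α : Type*} [MeasurableSpace α] {μ : Measure α} {h : α → ℝ≥0∞}
    (hh : AEMeasurable h μ) {s : ℝ} (hs : 1 ≤ s) :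
    (∫⁻ x, h x ∂μ) ^ s ≤ μ Set.univ ^ (s - 1) * ∫⁻ x, h x ^ s ∂μ := by
  have hs0 : 0 < s := by linarith
  have hinv : 1 / s ≤ 1 := by rw [div_le_one hs0]; exact hs
  have key := ENNReal.lintegral_mul_norm_pow_le (hh.pow_const s)
    (aemeasurable_const (b := (1 : ℝ≥0∞))) (p := 1 / s) (q := 1 - 1 / s)
    (by positivity) (by linarith) (by ring)
  simp only [← ENNReal.rpow_mul, mul_one_div_cancel hs0.ne', ENNReal.rpow_one, ENNReal.one_rpow,
    mul_one, lintegral_const, one_mul] at key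
  refine (ENNReal.rpow_le_rpow key hs0.le).trans (le_of_eq ?_)
  rw [ENNReal.mul_rpow_of_nonneg _ _ hs0.le, ← ENNReal.rpow_mul, ← ENNReal.rpow_mul,
    one_div_mul_cancel hs0.ne', ENNReal.rpow_one, mul_comm]
  congr 2
  field_simp

theorem rpow_le_of_le_mul_rpow {A B : ℝ≥0∞} (hA : A ≠ ∞) {q : ℝ} (hq : 0 < q)
    (h : A ≤ B * A ^ (1 - q)) : A ^ q ≤ B := by
  rcases eq_or_ne A 0 with rfl | h0
  · simp [hq]
  calc A ^ q = A * A ^ (q - 1) := by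
        conv_rhs => rw [← ENNReal.rpow_one A, ← ENNReal.rpow_mul, ← ENNReal.rpow_add _ _ h0 hA]
        congr 1
        ring
    _ ≤ B * A ^ (1 - q) * A ^ (q - 1) := by gcongr
    _ = B := by
        rw [mul_assoc, ← ENNReal.rpow_add _ _ h0 hA]
        simp

theorem add_rpow_le {s : ℝ} (hs : 1 ≤ s) (a b : ℝ≥0∞) :
    (a + b) ^ s ≤ a ^ s + ENNReal.ofReal s * (b * (a + b) ^ (s - 1)) := by
  have hs0 : 0 < s := by linarith
  rcases eq_or_ne a ∞ with rfl | ha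
  · simp [hs0]
  rcases eq_or_ne b ∞ with rfl | hb
  · have h1 : (∞ : ℝ≥0∞) ^ (s - 1) ≠ 0 := by
      simp [ENNReal.rpow_eq_zero_iff, hs]
    simp [ENNReal.top_mul h1, ENNReal.mul_top, hs0]
  rcases eq_or_ne (a + b) 0 with h0 | h0
  · simp [h0, hs0]
  lift a to NNReal using ha
  lift b to NNReal using hb
  have hpos : 0 < (a : ℝ) + b := by
    have : (a + b : NNReal) ≠ 0 := by exact_mod_cast h0
    exact_mod_cast pos_iff_ne_zero.2 this
  have real : ((a : ℝ) + b) ^ s ≤ a ^ s + s * (b * ((a : ℝ) + b) ^ (s - 1)) := by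
    have hx : -1 ≤ -((b : ℝ) / (a + b)) := by
      rw [neg_le_neg_iff, div_le_one hpos]
      simp
    have h1 := one_add_mul_self_le_rpow_one_add hx hs
    have h2 : 1 + -((b : ℝ) / (a + b)) = a / (a + b) := by field_simp; ring
    rw [h2, Real.div_rpow a.coe_nonneg hpos.le, le_div_iff₀ (Real.rpow_pos_of_pos hpos s)] at h1
    rw [Real.rpow_sub_one hpos.ne']
    have h3 : (1 + s * -((b : ℝ) / (a + b))) * ((a : ℝ) + b) ^ s
      = ((a : ℝ) + b) ^ s - s * (b * (((a : ℝ) + b) ^ s / (a + b))) := by ring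
    linarith
  have lifted : ENNReal.ofReal (((a : ℝ) + b) ^ s) ≤
      ENNReal.ofReal (a ^ s + s * (b * ((a : ℝ) + b) ^ (s - 1))) := ENNReal.ofReal_le_ofReal real
  rw [ENNReal.ofReal_add (by positivity) (by positivity), ENNReal.ofReal_mul hs0.le,
    ENNReal.ofReal_mul b.coe_nonneg, ← ENNReal.ofReal_rpow_of_pos hpos,
    ← ENNReal.ofReal_rpow_of_pos hpos,
    ← ENNReal.ofReal_rpow_of_nonneg a.coe_nonneg hs0.le,
    ENNReal.ofReal_add a.coe_nonneg b.coe_nonneg] at lifted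
  simpa using lifted

/-- Discrete integration by parts along the ordering of the indices by decreasing `t`. -/
theorem sum_rpow_le_sum_mul_partial_sum {ι : Type*} [DecidableEq ι] {s : ℝ} (hs : 1 ≤ s)
    (t : ι → ℝ) (a : ι → ℝ≥0∞) (I : Finset ι) :
    (∑ i ∈ I, a i) ^ s ≤
      ENNReal.ofReal s * ∑ j ∈ I, a j * (∑ i ∈ I with t j ≤ t i, a i) ^ (s - 1) := by
  have hs1 : 0 ≤ s - 1 := by linarith
  induction I using Finset.induction_on_min_value t with
  | empty => simp [show 0 < s by linarith]
  | insert b I hb hmin ih =>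
    rw [Finset.sum_insert hb, Finset.sum_insert hb, add_comm (a b), mul_add]
    refine (add_rpow_le hs _ _).trans ?_
    rw [add_comm (_ ^ s)]
    refine add_le_add (le_of_eq ?_) (ih.trans ?_)
    · congr 3
      rw [Finset.filter_true_of_mem (by simpa using hmin), Finset.sum_insert hb, add_comm]
    · gcongr
      exact Finset.subset_insert b I

/-- The average of `F` over the interval of radius `t` around `x`, up to a factor `2`. -/
def ballAvg (t : ℝ) (F : ℝ → ℝ≥0∞) (x : ℝ) : ℝ≥0∞ :=
  (ENNReal.ofReal t)⁻¹ * ∫⁻ y in Metric.closedBall x t, F y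

theorem ballAvg_eq_lintegral_indicator (t : ℝ) (F : ℝ → ℝ≥0∞) (x : ℝ) :
    ballAvg t F x = (ENNReal.ofReal t)⁻¹ *
      ∫⁻ y, {z : ℝ × ℝ | dist z.1 z.2 ≤ t}.indicator 1 (x, y) * F y := by
  rw [ballAvg, ← lintegral_indicator Metric.isClosed_closedBall.measurableSet]
  congr 2
  ext y
  by_cases h : dist x y ≤ t
  · rw [Set.indicator_of_mem (by simpa [dist_comm] using h), Set.indicator_of_mem (by exact h)]
    simp
  · rw [Set.indicator_of_notMem (by simpa [dist_comm] using h),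
      Set.indicator_of_notMem (by exact h)]
    simp

theorem measurable_dist_le_indicator (t : ℝ) :
    Measurable ({z : ℝ × ℝ | dist z.1 z.2 ≤ t}.indicator (1 : ℝ × ℝ → ℝ≥0∞)) :=
  measurable_one.indicator (measurableSet_le (by fun_prop) (by fun_prop))

theorem measurable_ballAvg (t : ℝ) {F : ℝ → ℝ≥0∞} (hF : Measurable F) :
    Measurable (ballAvg t F) := by
  have : ballAvg t F = fun x => _ := funext (ballAvg_eq_lintegral_indicator t F)
  rw [this]
  refine Measurable.const_mul ?_ _
  exact ((measurable_dist_le_indicator t).mul (hF.comp measurable_snd)).lintegral_prod_right'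

theorem lintegral_ballAvg_mul (t : ℝ) {F H : ℝ → ℝ≥0∞} (hF : Measurable F) (hH : Measurable H) :
    ∫⁻ x, ballAvg t F x * H x = ∫⁻ x, F x * ballAvg t H x := by
  have hm := measurable_dist_le_indicator t
  have left : ∀ x, ballAvg t F x * H x = (ENNReal.ofReal t)⁻¹ *
      ∫⁻ y, {z : ℝ × ℝ | dist z.1 z.2 ≤ t}.indicator 1 (x, y) * F y * H x := fun x => by
    rw [ballAvg_eq_lintegral_indicator, mul_assoc, lintegral_mul_const]
    exact (hm.comp measurable_prodMk_left).mul hF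
  have right : ∀ x, F x * ballAvg t H x = (ENNReal.ofReal t)⁻¹ *
      ∫⁻ y, {z : ℝ × ℝ | dist z.1 z.2 ≤ t}.indicator 1 (y, x) * F x * H y := fun x => by
    rw [ballAvg_eq_lintegral_indicator, mul_left_comm, ← lintegral_const_mul]
    · congr 2
      ext y
      rw [show {z : ℝ × ℝ | dist z.1 z.2 ≤ t}.indicator (1 : ℝ × ℝ → ℝ≥0∞) (x, y) =
        {z : ℝ × ℝ | dist z.1 z.2 ≤ t}.indicator 1 (y, x) by
          simp only [Set.indicator, Set.mem_ofPred_eq, dist_comm x y, Pi.one_apply]]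
      ring
    · exact (hm.comp measurable_prodMk_left).mul hH
  have joint : Measurable (Function.uncurry fun x y : ℝ =>
      {z : ℝ × ℝ | dist z.1 z.2 ≤ t}.indicator (1 : ℝ × ℝ → ℝ≥0∞) (x, y) * F y * H x) :=
    (hm.mul (hF.comp measurable_snd)).mul (hH.comp measurable_fst)
  simp_rw [left, right]
  have outer : Measurable fun x : ℝ => ∫⁻ y : ℝ,
      {z : ℝ × ℝ | dist z.1 z.2 ≤ t}.indicator (1 : ℝ × ℝ → ℝ≥0∞) (x, y) * F y * H x :=
    joint.lintegral_prod_right'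
  have inner : Measurable fun x : ℝ => ∫⁻ y : ℝ,
      {z : ℝ × ℝ | dist z.1 z.2 ≤ t}.indicator (1 : ℝ × ℝ → ℝ≥0∞) (y, x) * F x * H y :=
    joint.lintegral_prod_left'
  rw [lintegral_const_mul _ outer, lintegral_const_mul _ inner,
    lintegral_lintegral_swap joint.aemeasurable]

theorem ballAvg_const {t : ℝ} (ht : 0 < t) (c : ℝ≥0∞) (x : ℝ) :
    ballAvg t (fun _ => c) x = 2 * c := by
  have h0 : ENNReal.ofReal t ≠ 0 := by simpa using ht
  rw [ballAvg, lintegral_const, Measure.restrict_apply_univ, Real.volume_closedBall,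
    ENNReal.ofReal_mul zero_le_two, mul_comm c, mul_comm _ (ENNReal.ofReal t), mul_assoc,
    ENNReal.inv_mul_cancel_left h0 ENNReal.ofReal_ne_top]
  simp

theorem ballAvg_le_two_mul {t : ℝ} (F : ℝ → ℝ≥0∞) {x y : ℝ} (h : dist x y ≤ t) :
    ballAvg t F x ≤ 2 * ballAvg (2 * t) F y := by
  have hsub : Metric.closedBall x t ⊆ Metric.closedBall y (2 * t) :=
    Metric.closedBall_subset_closedBall' (by linarith)
  rw [ballAvg, ballAvg, ENNReal.ofReal_mul zero_le_two,
    ENNReal.mul_inv (by simp) (by simp), ← mul_assoc, ← mul_assoc, ENNReal.ofReal_ofNat,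
    ENNReal.mul_inv_cancel two_ne_zero (by simp), one_mul]
  gcongr

theorem lintegral_ballAvg_rpow_le {t : ℝ} (ht : 0 < t) {F : ℝ → ℝ≥0∞} (hF : Measurable F)
    {s : ℝ} (hs : 1 ≤ s) :
    ∫⁻ x, ballAvg t F x ^ s ≤ 2 ^ s * ∫⁻ x, F x ^ s := by
  have hs0 : 0 ≤ s := by linarith
  have h0 : ENNReal.ofReal t ≠ 0 := by simpa using ht
  have pointwise : ∀ x, ballAvg t F x ^ s ≤ 2 ^ (s - 1) * ballAvg t (fun y => F y ^ s) x := by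
    intro x
    rw [ballAvg, ENNReal.mul_rpow_of_nonneg _ _ hs0]
    refine (mul_le_mul_right (rpow_lintegral_le hF.aemeasurable hs) _).trans (le_of_eq ?_)
    rw [Measure.restrict_apply_univ, Real.volume_closedBall, ENNReal.ofReal_mul zero_le_two,
      ENNReal.mul_rpow_of_nonneg _ _ (by linarith), ballAvg, ENNReal.inv_rpow,
      ENNReal.rpow_sub _ _ h0 ENNReal.ofReal_ne_top, ENNReal.rpow_one, ENNReal.ofReal_ofNat,
      ENNReal.div_eq_inv_mul]
    have h1 : ENNReal.ofReal t ^ s ≠ 0 := by simp [ENNReal.rpow_eq_zero_iff, h0]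
    have h2 : ENNReal.ofReal t ^ s ≠ ∞ := by simp [hs0]
    calc (ENNReal.ofReal t ^ s)⁻¹ * (2 ^ (s - 1) * ((ENNReal.ofReal t)⁻¹ * ENNReal.ofReal t ^ s) *
          ∫⁻ y in Metric.closedBall x t, F y ^ s)
        = ((ENNReal.ofReal t ^ s)⁻¹ * ENNReal.ofReal t ^ s) * (2 ^ (s - 1) *
          ((ENNReal.ofReal t)⁻¹ * ∫⁻ y in Metric.closedBall x t, F y ^ s)) := by ring
      _ = _ := by rw [ENNReal.inv_mul_cancel h1 h2, one_mul]
  have mass := lintegral_ballAvg_mul t (hF.pow_const s) (measurable_const (a := (1 : ℝ≥0∞)))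
  simp only [mul_one, ballAvg_const ht] at mass
  calc ∫⁻ x, ballAvg t F x ^ s ≤ ∫⁻ x, 2 ^ (s - 1) * ballAvg t (fun y => F y ^ s) x :=
        lintegral_mono pointwise
    _ = 2 ^ (s - 1) * (2 * ∫⁻ x, F x ^ s) := by
        rw [lintegral_const_mul _ (measurable_ballAvg t (hF.pow_const s)), mass,
          lintegral_mul_const _ (hF.pow_const s), mul_comm 2]
    _ = 2 ^ s * ∫⁻ x, F x ^ s := by
        rw [ENNReal.rpow_sub _ _ two_ne_zero ENNReal.ofNat_ne_top, ENNReal.rpow_one, ← mul_assoc,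
          ENNReal.div_mul_cancel two_ne_zero ENNReal.ofNat_ne_top]

/-- Dual form of the Hardy-Littlewood maximal inequality, for finitely many functions. -/
theorem lintegral_sum_ballAvg_rpow_le {ι : Type*} {s : ℝ} (hs : 1 ≤ s) (I : Finset ι)
    (F : ι → ℝ → ℝ≥0∞) (hF : ∀ i, Measurable (F i)) (t : ι → ℝ) (ht : ∀ i, 0 < t i) :
    ∫⁻ x, (∑ i ∈ I, ballAvg (t i) (F i) x) ^ s ≤
      (ENNReal.ofReal s * 2 ^ s) ^ s * ∫⁻ x, (∑ i ∈ I, F i x) ^ s := by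
  classical
  have hs0 : 0 < s := by linarith
  have hs1 : 0 ≤ s - 1 := by linarith
  have hK : ENNReal.ofReal s * 2 ^ s ≠ 0 := by
    simp [hs0, ENNReal.rpow_eq_zero_iff]
  set K : ℝ≥0∞ := ENNReal.ofReal s * 2 ^ s with hKdef
  set Φ : ℝ≥0∞ := ∫⁻ x, (∑ i ∈ I, F i x) ^ s
  rcases eq_or_ne Φ ∞ with htop | hfin
  · rw [htop, ENNReal.mul_top (by simp [ENNReal.rpow_eq_zero_iff, hK, hs0.le])]
    exact le_top
  set A : ℝ≥0∞ := ⨆ τ : {τ : ι → ℝ // ∀ i, 0 < τ i},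
    ∫⁻ x, (∑ i ∈ I, ballAvg (τ.1 i) (F i) x) ^ s
  have measAvg : ∀ (τ : ι → ℝ) (J : Finset ι),
      Measurable fun x => ∑ i ∈ J, ballAvg (τ i) (F i) x := fun τ J =>
    Finset.measurable_fun_sum _ fun i _ => measurable_ballAvg _ (hF i)
  have measF : Measurable fun x => ∑ i ∈ I, F i x := Finset.measurable_fun_sum _ fun i _ => hF i
  have hAfin : A ≠ ∞ := by
    have bound : A ≤ (I.card : ℝ≥0∞) ^ (s - 1) * ∑ _i ∈ I, 2 ^ s * Φ := by
      refine iSup_le fun τ => ?_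
      calc ∫⁻ x, (∑ i ∈ I, ballAvg (τ.1 i) (F i) x) ^ s
          ≤ ∫⁻ x, (I.card : ℝ≥0∞) ^ (s - 1) * ∑ i ∈ I, ballAvg (τ.1 i) (F i) x ^ s :=
            lintegral_mono fun x => ENNReal.rpow_sum_le_const_mul_sum_rpow _ _ hs
        _ = (I.card : ℝ≥0∞) ^ (s - 1) * ∑ i ∈ I, ∫⁻ x, ballAvg (τ.1 i) (F i) x ^ s := by
            rw [lintegral_const_mul _ (Finset.measurable_fun_sum _ fun i _ =>
              (measurable_ballAvg _ (hF i)).pow_const s), lintegral_finsetSum _ fun i _ =>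
              (measurable_ballAvg _ (hF i)).pow_const s]
        _ ≤ _ := by
            gcongr with i hi
            refine (lintegral_ballAvg_rpow_le (τ.2 i) (hF i) hs).trans ?_
            refine mul_le_mul_right (lintegral_mono fun x => ENNReal.rpow_le_rpow ?_ hs0.le) _
            exact Finset.single_le_sum (f := fun i => F i x) (fun _ _ => zero_le) hi
    refine ne_top_of_le_ne_top ?_ bound
    refine ENNReal.mul_ne_top (ENNReal.rpow_ne_top_of_nonneg hs1 (by simp)) ?_
    refine (ENNReal.sum_lt_top.2 fun i _ => ?_).ne
    exact ENNReal.mul_lt_top (ENNReal.rpow_lt_top_of_nonneg hs0.le (by simp)) hfin.lt_top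
  have selfImprove : A ≤ K * Φ ^ (1 / s) * A ^ (1 - 1 / s) := by
    refine iSup_le fun ⟨τ, hτ⟩ => ?_
    set S : ℝ → ℝ≥0∞ := fun x => ∑ i ∈ I, ballAvg (2 * τ i) (F i) x with hS
    have measS : Measurable S := measAvg (fun i => 2 * τ i) I
    have slow : ∀ j ∈ I, ∀ y, ballAvg (τ j)
        (fun x => (∑ i ∈ I with τ j ≤ τ i, ballAvg (τ i) (F i) x) ^ (s - 1)) y ≤
          2 * (2 * S y) ^ (s - 1) := by
      intro j _ y
      rw [← ballAvg_const (hτ j) _ y, ballAvg, ballAvg]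
      refine mul_le_mul_right (setLIntegral_mono' Metric.isClosed_closedBall.measurableSet
        fun x hx => ?_) _
      refine ENNReal.rpow_le_rpow ?_ hs1
      rw [hS, Finset.mul_sum]
      refine (Finset.sum_le_sum fun i hi => ?_).trans
        (Finset.sum_le_sum_of_subset (Finset.filter_subset _ _))
      exact ballAvg_le_two_mul (F i)
        ((Metric.mem_closedBall.1 hx).trans (Finset.mem_filter.1 hi).2)
    calc ∫⁻ x, (∑ i ∈ I, ballAvg (τ i) (F i) x) ^ s
        ≤ ∫⁻ x, ENNReal.ofReal s * ∑ j ∈ I, ballAvg (τ j) (F j) x *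
            (∑ i ∈ I with τ j ≤ τ i, ballAvg (τ i) (F i) x) ^ (s - 1) :=
          lintegral_mono fun x => sum_rpow_le_sum_mul_partial_sum hs τ _ I
      _ = ENNReal.ofReal s * ∑ j ∈ I, ∫⁻ x, F j x * ballAvg (τ j)
            (fun x => (∑ i ∈ I with τ j ≤ τ i, ballAvg (τ i) (F i) x) ^ (s - 1)) x := by
          have hm : ∀ j ∈ I, Measurable fun x => ballAvg (τ j) (F j) x *
              (∑ i ∈ I with τ j ≤ τ i, ballAvg (τ i) (F i) x) ^ (s - 1) := fun j _ =>
            (measurable_ballAvg _ (hF j)).mul ((measAvg τ _).pow_const _)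
          rw [lintegral_const_mul _ (Finset.measurable_fun_sum _ hm), lintegral_finsetSum _ hm]
          congr 1
          exact Finset.sum_congr rfl fun j _ =>
            lintegral_ballAvg_mul _ (hF j) ((measAvg τ _).pow_const _)
      _ ≤ ENNReal.ofReal s * ∑ j ∈ I, ∫⁻ x, F j x * (2 * (2 * S x) ^ (s - 1)) := by
          gcongr with j hj x
          exact slow j hj x
      _ = K * ∫⁻ x, ((∑ i ∈ I, F i x) ^ s) ^ (1 / s) * (S x ^ s) ^ (1 - 1 / s) := by
          have hm : ∀ j ∈ I, Measurable fun x => F j x * (2 * (2 * S x) ^ (s - 1)) := fun j _ =>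
            (hF j).mul (((measS.const_mul 2).pow_const _).const_mul 2)
          rw [← lintegral_finsetSum _ hm,
            ← lintegral_const_mul _ (Finset.measurable_fun_sum _ hm),
            ← lintegral_const_mul _ (by fun_prop)]
          congr 1
          ext x
          rw [← Finset.sum_mul, ← ENNReal.rpow_mul, ← ENNReal.rpow_mul,
            mul_one_div_cancel hs0.ne', ENNReal.rpow_one, mul_sub, mul_one_div_cancel hs0.ne',
            mul_one, ENNReal.mul_rpow_of_nonneg _ _ hs1]
          have : (2 : ℝ≥0∞) ^ s = 2 * 2 ^ (s - 1) := by
            conv_rhs => rw [← ENNReal.rpow_one 2, ← ENNReal.rpow_mul,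
              ← ENNReal.rpow_add _ _ two_ne_zero ENNReal.ofNat_ne_top]
            ring_nf
          rw [hKdef, this]
          ring
      _ ≤ K * (Φ ^ (1 / s) * (∫⁻ x, S x ^ s) ^ (1 - 1 / s)) := by
          gcongr
          exact ENNReal.lintegral_mul_norm_pow_le (measF.pow_const s).aemeasurable
            (measS.pow_const s).aemeasurable (by positivity)
            (by rw [sub_nonneg, div_le_one hs0]; exact hs) (by ring)
      _ ≤ K * Φ ^ (1 / s) * A ^ (1 - 1 / s) := by
          have : 0 ≤ 1 - 1 / s := by rw [sub_nonneg, div_le_one hs0]; exact hs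
          rw [← mul_assoc K]
          refine mul_le_mul_right (ENNReal.rpow_le_rpow ?_ this) _
          exact le_iSup (fun τ : {τ : ι → ℝ // ∀ i, 0 < τ i} =>
            ∫⁻ x, (∑ i ∈ I, ballAvg (τ.1 i) (F i) x) ^ s)
            ⟨fun i => 2 * τ i, fun i => by have := hτ i; positivity⟩
  have root := rpow_le_of_le_mul_rpow hAfin (by positivity : 0 < 1 / s) selfImprove
  have := ENNReal.rpow_le_rpow root hs0.le
  rw [ENNReal.mul_rpow_of_nonneg _ _ hs0.le, ← ENNReal.rpow_mul, ← ENNReal.rpow_mul,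
    one_div_mul_cancel hs0.ne', ENNReal.rpow_one, ENNReal.rpow_one] at this
  exact (le_iSup (fun τ : {τ : ι → ℝ // ∀ i, 0 < τ i} =>
    ∫⁻ x, (∑ i ∈ I, ballAvg (τ.1 i) (F i) x) ^ s) ⟨t, ht⟩).trans this

theorem lintegral_tsum_ballAvg_rpow_le {ι : Type*} [Denumerable ι] {s : ℝ} (hs : 1 ≤ s)
    (F : ι → ℝ → ℝ≥0∞) (hF : ∀ i, Measurable (F i)) (t : ι → ℝ) (ht : ∀ i, 0 < t i) :
    ∫⁻ x, (∑' i, ballAvg (t i) (F i) x) ^ s ≤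
      (ENNReal.ofReal s * 2 ^ s) ^ s * ∫⁻ x, (∑' i, F i x) ^ s := by
  have hs0 : 0 < s := by linarith
  let e : ℕ ≃ ι := (Denumerable.eqv ι).symm
  have exhaust : ∀ x, (∑' i, ballAvg (t i) (F i) x) ^ s =
      ⨆ n, (∑ i ∈ Finset.range n, ballAvg (t (e i)) (F (e i)) x) ^ s := fun x => by
    rw [← e.tsum_eq, ENNReal.tsum_eq_iSup_nat]
    exact (ENNReal.orderIsoRpow s hs0).map_iSup _
  simp_rw [exhaust]
  rw [lintegral_iSup]
  · refine iSup_le fun n => (lintegral_sum_ballAvg_rpow_le hs (Finset.range n) (fun i => F (e i))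
      (fun i => hF _) (fun i => t (e i)) (fun i => ht _)).trans ?_
    gcongr with x
    rw [← e.tsum_eq]
    exact ENNReal.sum_le_tsum _
  · exact fun n => (Finset.measurable_fun_sum _ fun i _ =>
      measurable_ballAvg _ (hF _)).pow_const s
  · intro m n hmn x
    dsimp only
    gcongr

/-- Band-limited Schwartz functions are reproduced by convolution with a rescaled Schwartz kernel. -/
theorem exists_schwartz_reproducing_kernel :
    ∃ ψ : SchwartzMap ℝ ℂ, ∀ r : ℝ, 0 < r → ∀ g : SchwartzMap ℝ ℂ,
      (∀ ξ : ℝ, ξ ∉ Set.Icc (-r) r → 𝓕 ⇑g ξ = 0) →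
      ∀ z : ℝ, g z = ∫ u, g u * (r * ψ (r * (u - z))) := by
  let χ : ContDiffBump (0 : ℝ) := ⟨1, 2, one_pos, one_lt_two⟩
  have smooth : ContDiff ℝ (⊤ : ℕ∞) fun x => (χ x : ℂ) := Complex.ofRealCLM.contDiff.comp χ.contDiff
  have supp : HasCompactSupport fun x => (χ x : ℂ) :=
    χ.hasCompactSupport.comp_left (g := Complex.ofReal) Complex.ofReal_zero
  refine ⟨𝓕 (supp.toSchwartzMap smooth), fun r hr g hg z => ?_⟩
  let h : ℝ → ℂ := fun v => Complex.exp (↑(2 * π * (v * z)) * Complex.I) * (χ (v / r) : ℂ)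
  have hcont : Continuous h := by
    have : Continuous fun v => (χ (v / r) : ℂ) := smooth.continuous.comp (continuous_id.div_const r)
    exact Continuous.mul (by fun_prop) this
  have hcomp : HasCompactSupport h := by
    refine HasCompactSupport.mul_left ?_
    have := supp.comp_homeomorph (Homeomorph.mulRight₀ r⁻¹ (inv_ne_zero hr.ne'))
    simpa [Function.comp_def, div_eq_mul_inv] using this
  have hint : Integrable h := hcont.integrable_of_hasCompactSupport hcomp
  have transform : ∀ u, 𝓕 h u = r * 𝓕 (fun x => (χ x : ℂ)) (r * (u - z)) := by
    intro u
    rw [Real.fourier_eq', Real.fourier_eq']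
    have := Measure.integral_comp_div (fun x : ℝ =>
      Complex.exp (↑(-2 * π * (x * (r * (u - z)))) * Complex.I) * (χ x : ℂ)) r
    simp only [abs_of_pos hr, Complex.real_smul] at this
    simp only [smul_eq_mul, RCLike.inner_apply, conj_trivial]
    calc _ = ∫ v : ℝ, Complex.exp (↑(-2 * π * (v / r * (r * (u - z)))) * Complex.I) *
          (χ (v / r) : ℂ) := by
          congr 1
          ext v
          rw [← mul_assoc, ← Complex.exp_add]
          congr 2
          push_cast
          have : (r : ℂ) ≠ 0 := by exact_mod_cast hr.ne'
          field_simp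
          ring
      _ = _ := by
          rw [this]
          congr 2
          ext x
          rw [mul_comm x]
  have inversion : g z = ∫ v, 𝓕 ⇑g v • h v := by
    have inv := congrFun (g.continuous.fourierInv_fourier_eq g.integrable
      (by simpa [SchwartzMap.fourier_coe] using (𝓕 g).integrable)) z
    rw [← inv, Real.fourierInv_eq']
    congr 1
    ext v
    by_cases hv : v ∈ Set.Icc (-r) r
    · have one : χ (v / r) = 1 := χ.one_of_mem_closedBall (by
        rw [mem_closedBall_zero_iff, Real.norm_eq_abs, abs_div, abs_of_pos hr, div_le_one hr]
        exact abs_le.2 hv)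
      simp only [h, one, smul_eq_mul, RCLike.inner_apply, conj_trivial, Complex.ofReal_one, mul_one]
      rw [mul_comm z, mul_comm]
    · simp [hg v hv]
  have flip : ∫ v, 𝓕 ⇑g v • h v = ∫ u, g u • 𝓕 h u := by
    simpa using! VectorFourier.integral_fourierIntegral_smul_eq_flip (L := innerₗ ℝ)
      Real.continuous_fourierChar continuous_inner g.integrable hint
  rw [inversion, flip]
  congr 1
  ext u
  rw [transform, smul_eq_mul]
  congr 2

/-- The weight `(1 + r |u - z|)⁻¹`. -/
def decayWeight (r z u : ℝ) : ℝ≥0∞ := ENNReal.ofReal (1 + r * |u - z|)⁻¹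

theorem exists_enorm_le_lintegral_decayWeight_pow (N : ℕ) :
    ∃ D : ℝ, 0 < D ∧ ∀ r : ℝ, 0 < r → ∀ g : SchwartzMap ℝ ℂ,
      (∀ ξ : ℝ, ξ ∉ Set.Icc (-r) r → 𝓕 ⇑g ξ = 0) →
      ∀ z : ℝ, ‖g z‖ₑ ≤
        ENNReal.ofReal D * (ENNReal.ofReal r * ∫⁻ u, ‖g u‖ₑ * decayWeight r z u ^ N) := by
  obtain ⟨ψ, hψ⟩ := exists_schwartz_reproducing_kernel
  obtain ⟨D, hD, decay⟩ : ∃ D : ℝ, 0 < D ∧ ∀ v, ‖ψ v‖ ≤ D * ((1 + |v|)⁻¹) ^ N := by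
    refine ⟨2 ^ N * ((Finset.Iic (N, 0)).sup fun m => SchwartzMap.seminorm ℝ m.1 m.2) ψ + 1,
      by positivity, fun v => ?_⟩
    have h := SchwartzMap.one_add_le_sup_seminorm_apply (𝕜 := ℝ) (m := (N, 0)) le_rfl le_rfl ψ v
    rw [norm_iteratedFDeriv_zero, Real.norm_eq_abs] at h
    rw [inv_pow, ← div_eq_mul_inv, le_div_iff₀ (by positivity), mul_comm]
    linarith
  refine ⟨D, hD, fun r hr g hg z => ?_⟩
  rw [hψ r hr g hg z]
  refine (enorm_integral_le_lintegral_enorm _).trans ?_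
  rw [← lintegral_const_mul' _ _ ENNReal.ofReal_ne_top,
    ← lintegral_const_mul' _ _ ENNReal.ofReal_ne_top]
  refine lintegral_mono fun u => ?_
  have bound : ‖(r : ℂ) * ψ (r * (u - z))‖ₑ ≤
      ENNReal.ofReal D * (ENNReal.ofReal r * decayWeight r z u ^ N) := by
    rw [← ofReal_norm, decayWeight, ← ENNReal.ofReal_pow (by positivity),
      ← ENNReal.ofReal_mul hr.le, ← ENNReal.ofReal_mul hD.le, norm_mul, Complex.norm_real,
      Real.norm_eq_abs, abs_of_pos hr]
    refine ENNReal.ofReal_le_ofReal ?_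
    have := decay (r * (u - z))
    rw [abs_mul, abs_of_pos hr] at this
    nlinarith
  rw [enorm_mul]
  refine (mul_le_mul_right bound _).trans (le_of_eq ?_)
  ring

theorem decayWeight_mul_le {r : ℝ} (hr : 0 < r) (z y u : ℝ) :
    decayWeight r y u * decayWeight r z y ≤ decayWeight r z u := by
  rw [decayWeight, decayWeight, decayWeight, ← ENNReal.ofReal_mul (by positivity), ← mul_inv]
  refine ENNReal.ofReal_le_ofReal (inv_anti₀ (by positivity) ?_)
  have h := abs_sub_le u y z
  have h2 : 0 ≤ (r * |u - y|) * (r * |y - z|) := by positivity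
  nlinarith

theorem decayWeight_le_one {r : ℝ} (hr : 0 < r) (z u : ℝ) : decayWeight r z u ≤ 1 := by
  rw [decayWeight]
  refine ENNReal.ofReal_le_one.2 (inv_le_one_of_one_le₀ ?_)
  have : 0 ≤ r * |u - z| := by positivity
  linarith

theorem measurable_decayWeight (r z : ℝ) : Measurable (decayWeight r z) := by
  unfold decayWeight
  fun_prop

theorem decayWeight_sq_le_tsum_indicator {r : ℝ} (hr : 0 < r) (z u : ℝ) :
    decayWeight r z u ^ 2 ≤
      ∑' l : ℕ, 4 * (4⁻¹ : ℝ≥0∞) ^ l * (Metric.closedBall z (2 ^ l / r)).indicator 1 u := by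
  obtain ⟨l, hl, hle⟩ : ∃ l : ℕ, r * |u - z| ≤ 2 ^ l ∧
      ((1 + r * |u - z|)⁻¹) ^ 2 ≤ 4 * (4⁻¹ : ℝ) ^ l := by
    have hex : ∃ l : ℕ, r * |u - z| ≤ 2 ^ l := pow_unbounded_of_one_lt _ one_lt_two |>.imp
      fun _ => le_of_lt
    classical
    have h0 : 0 ≤ r * |u - z| := by positivity
    refine ⟨Nat.find hex, Nat.find_spec hex, ?_⟩
    rcases hfind : Nat.find hex with _ | m
    · have : (1 + r * |u - z|)⁻¹ ≤ 1 := inv_le_one_of_one_le₀ (by linarith)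
      have h1 : 0 ≤ (1 + r * |u - z|)⁻¹ := by positivity
      rw [pow_zero, mul_one]
      nlinarith
    · have hm := Nat.find_min hex (m := m) (by omega)
      rw [not_le] at hm
      have hpos : (0 : ℝ) < 2 ^ m := by positivity
      calc ((1 + r * |u - z|)⁻¹) ^ 2 ≤ ((2 ^ m : ℝ)⁻¹) ^ 2 := by
            gcongr
            linarith
        _ = 4 * (4⁻¹ : ℝ) ^ (m + 1) := by
            rw [← inv_pow, ← pow_mul, mul_comm m 2, pow_mul, pow_succ]
            norm_num
            ring
  refine le_trans ?_ (ENNReal.le_tsum l)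
  rw [Set.indicator_of_mem (by
    rw [Metric.mem_closedBall, Real.dist_eq, le_div_iff₀ hr, mul_comm]; exact hl),
    Pi.one_apply, mul_one, decayWeight, ← ENNReal.ofReal_pow (by positivity)]
  refine (ENNReal.ofReal_le_ofReal hle).trans (le_of_eq ?_)
  rw [ENNReal.ofReal_mul (by norm_num), ENNReal.ofReal_pow (by norm_num),
    ENNReal.ofReal_inv_of_pos (by norm_num)]
  simp

theorem lintegral_mul_decayWeight_sq_le {r : ℝ} (hr : 0 < r) (z : ℝ) {H : ℝ → ℝ≥0∞}
    (hH : Measurable H) :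
    ∫⁻ u, H u * decayWeight r z u ^ 2 ≤
      ∑' l : ℕ, 4 * (4⁻¹ : ℝ≥0∞) ^ l * ∫⁻ u in Metric.closedBall z (2 ^ l / r), H u := by
  calc ∫⁻ u, H u * decayWeight r z u ^ 2
      ≤ ∫⁻ u, ∑' l : ℕ, 4 * (4⁻¹ : ℝ≥0∞) ^ l *
          (Metric.closedBall z (2 ^ l / r)).indicator H u := by
        refine lintegral_mono fun u => ?_
        refine (mul_le_mul_right (decayWeight_sq_le_tsum_indicator hr z u) _).trans (le_of_eq ?_)
        rw [← ENNReal.tsum_mul_left]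
        congr 1
        ext l
        by_cases hu : u ∈ Metric.closedBall z (2 ^ l / r)
        · simp only [Set.indicator_of_mem hu, Pi.one_apply]
          ring
        · simp only [Set.indicator_of_notMem hu]
          ring
    _ = _ := by
        have hm : ∀ l : ℕ, Measurable ((Metric.closedBall z (2 ^ l / r)).indicator H) := fun l =>
          hH.indicator Metric.isClosed_closedBall.measurableSet
        rw [lintegral_tsum fun l => ((hm l).const_mul _).aemeasurable]
        congr 1
        ext l
        rw [lintegral_const_mul _ (hm l),
          lintegral_indicator Metric.isClosed_closedBall.measurableSet]

theorem lintegral_decayWeight_sq_le {r : ℝ} (hr : 0 < r) (z : ℝ) :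
    ENNReal.ofReal r * ∫⁻ u, decayWeight r z u ^ 2 ≤ 16 := by
  have h := lintegral_mul_decayWeight_sq_le hr z (measurable_const (a := (1 : ℝ≥0∞)))
  simp only [one_mul, lintegral_const, Measure.restrict_apply_univ, Real.volume_closedBall] at h
  refine (mul_le_mul_right h _).trans (le_of_eq ?_)
  rw [← ENNReal.tsum_mul_left]
  have term : ∀ l : ℕ, ENNReal.ofReal r *
      (4 * (4⁻¹ : ℝ≥0∞) ^ l * ENNReal.ofReal (2 * (2 ^ l / r))) = 8 * (2⁻¹ : ℝ≥0∞) ^ l := by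
    intro l
    have e4 : (4⁻¹ : ℝ≥0∞) = ENNReal.ofReal 4⁻¹ := by
      rw [ENNReal.ofReal_inv_of_pos (by norm_num)]; simp
    have e2 : (2⁻¹ : ℝ≥0∞) = ENNReal.ofReal 2⁻¹ := by
      rw [ENNReal.ofReal_inv_of_pos (by norm_num)]; simp
    rw [e4, e2, ← ENNReal.ofReal_ofNat 4, ← ENNReal.ofReal_ofNat 8,
      ← ENNReal.ofReal_pow (by norm_num), ← ENNReal.ofReal_pow (by norm_num),
      ← ENNReal.ofReal_mul (by norm_num), ← ENNReal.ofReal_mul (by positivity),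
      ← ENNReal.ofReal_mul (by positivity), ← ENNReal.ofReal_mul (by norm_num)]
    congr 1
    have : (4⁻¹ : ℝ) ^ l * 2 ^ l = 2⁻¹ ^ l := by rw [← mul_pow]; norm_num
    rw [← this]
    field_simp
    norm_num
  simp_rw [term]
  rw [ENNReal.tsum_mul_left, ENNReal.tsum_geometric, ENNReal.one_sub_inv_two, inv_inv]
  norm_num

theorem exists_enorm_rpow_le_of_le_one {q : ℝ} (hq : 0 < q) (hq1 : q ≤ 1) :
    ∃ D : ℝ≥0∞, D ≠ ∞ ∧ ∀ r : ℝ, 0 < r → ∀ g : SchwartzMap ℝ ℂ,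
      (∀ ξ : ℝ, ξ ∉ Set.Icc (-r) r → 𝓕 ⇑g ξ = 0) →
      ∀ z : ℝ, ‖g z‖ₑ ^ q ≤
        D * (ENNReal.ofReal r * ∫⁻ u, ‖g u‖ₑ ^ q * decayWeight r z u ^ 2) := by
  obtain ⟨N, hN⟩ := exists_nat_ge (2 / q)
  have hNq : 2 ≤ N * q := by rwa [div_le_iff₀ hq] at hN
  obtain ⟨D, -, hDg⟩ := exists_enorm_le_lintegral_decayWeight_pow N
  refine ⟨ENNReal.ofReal D, ENNReal.ofReal_ne_top, fun r hr g hg z => ?_⟩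
  set G : ℝ≥0∞ := ⨆ y, ‖g y‖ₑ * decayWeight r z y ^ N
  have hGfin : G ≠ ∞ := by
    refine ne_top_of_le_ne_top
      (ENNReal.ofReal_ne_top (r := SchwartzMap.seminorm ℝ 0 0 g)) (iSup_le fun y => ?_)
    refine (mul_le_of_le_one_right' (pow_le_one' (decayWeight_le_one hr z y) N)).trans ?_
    rw [← ofReal_norm]
    exact ENNReal.ofReal_le_ofReal (SchwartzMap.norm_le_seminorm ℝ g y)
  have split : ∀ u, ‖g u‖ₑ * decayWeight r z u ^ N ≤
      G ^ (1 - q) * (‖g u‖ₑ ^ q * decayWeight r z u ^ 2) := by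
    intro u
    set w := decayWeight r z u
    calc ‖g u‖ₑ * w ^ N = (‖g u‖ₑ * w ^ N) ^ (1 - q) * (‖g u‖ₑ * w ^ N) ^ q := by
          rw [← ENNReal.rpow_add_of_nonneg _ _ (by linarith) hq.le]
          simp
      _ ≤ G ^ (1 - q) * (‖g u‖ₑ ^ q * w ^ 2) := by
          refine mul_le_mul' (ENNReal.rpow_le_rpow
            (le_iSup (fun y => ‖g y‖ₑ * decayWeight r z y ^ N) u) (by linarith)) ?_
          rw [ENNReal.mul_rpow_of_nonneg _ _ hq.le, ← ENNReal.rpow_natCast, ← ENNReal.rpow_mul,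
            ← ENNReal.rpow_natCast w 2]
          refine mul_le_mul_right ?_ _
          exact ENNReal.rpow_le_rpow_of_exponent_ge (decayWeight_le_one hr z u) (by simpa using hNq)
  have selfImprove : G ≤
      ENNReal.ofReal D * (ENNReal.ofReal r * ∫⁻ u, ‖g u‖ₑ ^ q * decayWeight r z u ^ 2) *
        G ^ (1 - q) := by
    refine iSup_le fun y => ?_
    have hm : Measurable fun u => ‖g u‖ₑ ^ q * decayWeight r z u ^ 2 :=
      (g.continuous.measurable.enorm.pow_const q).mul ((measurable_decayWeight r z).pow_const 2)
    have hm' : Measurable fun u => ‖g u‖ₑ * decayWeight r y u ^ N :=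
      g.continuous.measurable.enorm.mul ((measurable_decayWeight r y).pow_const N)
    calc ‖g y‖ₑ * decayWeight r z y ^ N
        ≤ ENNReal.ofReal D * (ENNReal.ofReal r * ∫⁻ u, ‖g u‖ₑ * decayWeight r y u ^ N) *
          decayWeight r z y ^ N := by
          gcongr
          exact hDg r hr g hg y
      _ = ENNReal.ofReal D * (ENNReal.ofReal r *
          ∫⁻ u, ‖g u‖ₑ * decayWeight r y u ^ N * decayWeight r z y ^ N) := by
          rw [lintegral_mul_const _ hm']
          ring
      _ ≤ ENNReal.ofReal D * (ENNReal.ofReal r *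
          ∫⁻ u, G ^ (1 - q) * (‖g u‖ₑ ^ q * decayWeight r z u ^ 2)) := by
          refine mul_le_mul_right (mul_le_mul_right (lintegral_mono fun u => ?_) _) _
          refine le_trans ?_ (split u)
          rw [mul_assoc, ← mul_pow]
          gcongr
          exact decayWeight_mul_le hr z y u
      _ = _ := by
          rw [lintegral_const_mul _ hm]
          ring
  refine le_trans (ENNReal.rpow_le_rpow ?_ hq.le) (rpow_le_of_le_mul_rpow hGfin hq selfImprove)
  refine le_trans (le_of_eq ?_) (le_iSup (fun y => ‖g y‖ₑ * decayWeight r z y ^ N) z)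
  simp [decayWeight]

theorem exists_enorm_rpow_le_of_one_le {q : ℝ} (hq1 : 1 ≤ q) :
    ∃ D : ℝ≥0∞, D ≠ ∞ ∧ ∀ r : ℝ, 0 < r → ∀ g : SchwartzMap ℝ ℂ,
      (∀ ξ : ℝ, ξ ∉ Set.Icc (-r) r → 𝓕 ⇑g ξ = 0) →
      ∀ z : ℝ, ‖g z‖ₑ ^ q ≤
        D * (ENNReal.ofReal r * ∫⁻ u, ‖g u‖ₑ ^ q * decayWeight r z u ^ 2) := by
  have hq0 : 0 ≤ q := by linarith
  obtain ⟨D, -, hDg⟩ := exists_enorm_le_lintegral_decayWeight_pow 2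
  refine ⟨ENNReal.ofReal D ^ q * 16 ^ (q - 1), ENNReal.mul_ne_top
    (ENNReal.rpow_ne_top_of_nonneg hq0 ENNReal.ofReal_ne_top)
    (ENNReal.rpow_ne_top_of_nonneg (by linarith) ENNReal.ofNat_ne_top), fun r hr g hg z => ?_⟩
  have hw : Measurable fun u => decayWeight r z u ^ 2 := (measurable_decayWeight r z).pow_const 2
  have hg' : Measurable fun u => ‖g u‖ₑ := g.continuous.measurable.enorm
  set μ : Measure ℝ := ENNReal.ofReal r • volume.withDensity fun u => decayWeight r z u ^ 2 with hμ
  have toμ : ∀ H : ℝ → ℝ≥0∞, Measurable H →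
      ENNReal.ofReal r * ∫⁻ u, H u * decayWeight r z u ^ 2 = ∫⁻ u, H u ∂μ := by
    intro H hH
    rw [hμ, lintegral_smul_measure, lintegral_withDensity_eq_lintegral_mul _ hw hH, smul_eq_mul]
    simp only [Pi.mul_apply, mul_comm]
  have mass : μ Set.univ ≤ 16 := by
    have := toμ (fun _ => 1) measurable_const
    simp only [one_mul, lintegral_one] at this
    rw [← this]
    exact lintegral_decayWeight_sq_le hr z
  rw [toμ _ (hg'.pow_const q)]
  calc ‖g z‖ₑ ^ q ≤ (ENNReal.ofReal D * ∫⁻ u, ‖g u‖ₑ ∂μ) ^ q := by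
        rw [← toμ _ hg']
        exact ENNReal.rpow_le_rpow (hDg r hr g hg z) hq0
    _ = ENNReal.ofReal D ^ q * (∫⁻ u, ‖g u‖ₑ ∂μ) ^ q := ENNReal.mul_rpow_of_nonneg _ _ hq0
    _ ≤ ENNReal.ofReal D ^ q * (16 ^ (q - 1) * ∫⁻ u, ‖g u‖ₑ ^ q ∂μ) := by
        refine mul_le_mul_right ((rpow_lintegral_le hg'.aemeasurable hq1).trans ?_) _
        exact mul_le_mul_left (ENNReal.rpow_le_rpow mass (by linarith)) _
    _ = _ := (mul_assoc _ _ _).symm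

/-- Pointwise control of `|g|^q` by its own averages, for band-limited `g`. -/
theorem exists_enorm_rpow_le {q : ℝ} (hq : 0 < q) :
    ∃ D : ℝ≥0∞, D ≠ ∞ ∧ ∀ r : ℝ, 0 < r → ∀ g : SchwartzMap ℝ ℂ,
      (∀ ξ : ℝ, ξ ∉ Set.Icc (-r) r → 𝓕 ⇑g ξ = 0) →
      ∀ z : ℝ, ‖g z‖ₑ ^ q ≤
        D * (ENNReal.ofReal r * ∫⁻ u, ‖g u‖ₑ ^ q * decayWeight r z u ^ 2) :=
  (le_total q 1).elim (exists_enorm_rpow_le_of_le_one hq) exists_enorm_rpow_le_of_one_le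

theorem ofReal_peetreMax_rpow_le {r : ℝ} (hr : 0 < r) {n : ℕ} {g : ℝ → ℂ} {x q : ℝ} (hq : 0 < q)
    {B : ℝ≥0∞} (h : ∀ y : ℝ, |y| ≤ 2 ^ (n + 2) / r → ‖g (x + y)‖ₑ ^ q ≤ B) :
    ENNReal.ofReal (peetreMax r n g x) ^ q ≤ B := by
  rcases eq_or_ne B ∞ with rfl | hB
  · exact le_top
  rw [← ENNReal.le_rpow_inv_iff hq,
    ENNReal.ofReal_le_iff_le_toReal (ENNReal.rpow_ne_top_of_nonneg (by positivity) hB)]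
  refine csSup_le ⟨‖g (x + 0)‖, 0, by simp; positivity, rfl⟩ ?_
  rintro _ ⟨y, hy, rfl⟩
  rw [← ENNReal.ofReal_le_iff_le_toReal (ENNReal.rpow_ne_top_of_nonneg (by positivity) hB),
    ENNReal.le_rpow_inv_iff hq, ofReal_norm]
  exact h y hy

theorem exists_peetreMax_rpow_le_tsum_ballAvg {q : ℝ} (hq : 0 < q) :
    ∃ D : ℝ≥0∞, D ≠ ∞ ∧ ∀ r : ℝ, 0 < r → ∀ g : SchwartzMap ℝ ℂ,
      (∀ ξ : ℝ, ξ ∉ Set.Icc (-r) r → 𝓕 ⇑g ξ = 0) →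
      ∀ (n : ℕ) (x : ℝ),
        ENNReal.ofReal ((2 : ℝ) ^ (-(n : ℝ))) * ENNReal.ofReal (peetreMax r n g x) ^ q ≤
          D * ∑' l : ℕ,
            ballAvg (2 ^ (l + n + 3) / r) (fun u => (2⁻¹ : ℝ≥0∞) ^ l * ‖g u‖ₑ ^ q) x := by
  obtain ⟨D, hD, hDg⟩ := exists_enorm_rpow_le hq
  refine ⟨D * 32, ENNReal.mul_ne_top hD (by simp), fun r hr g hg n x => ?_⟩
  have hm : Measurable fun u => ‖g u‖ₑ ^ q := g.continuous.measurable.enorm.pow_const q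
  have term : ∀ l : ℕ, 4 * (4⁻¹ : ℝ≥0∞) ^ l * (ENNReal.ofReal r *
      ∫⁻ u in Metric.closedBall x (2 ^ (l + n + 3) / r), ‖g u‖ₑ ^ q) =
      2 ^ n * (32 * ballAvg (2 ^ (l + n + 3) / r) (fun u => (2⁻¹ : ℝ≥0∞) ^ l * ‖g u‖ₑ ^ q) x) := by
    intro l
    rw [ballAvg, lintegral_const_mul _ hm, ← ENNReal.ofReal_inv_of_pos (by positivity)]
    have coef : 4 * (4⁻¹ : ℝ≥0∞) ^ l * ENNReal.ofReal r =
        2 ^ n * (32 * (ENNReal.ofReal (2 ^ (l + n + 3) / r)⁻¹ * (2⁻¹ : ℝ≥0∞) ^ l)) := by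
      have e4 : (4⁻¹ : ℝ≥0∞) = ENNReal.ofReal 4⁻¹ := by
        rw [ENNReal.ofReal_inv_of_pos (by norm_num)]; simp
      have e2 : (2⁻¹ : ℝ≥0∞) = ENNReal.ofReal 2⁻¹ := by
        rw [ENNReal.ofReal_inv_of_pos (by norm_num)]; simp
      rw [e4, e2, ← ENNReal.ofReal_ofNat 4, ← ENNReal.ofReal_ofNat 32, ← ENNReal.ofReal_ofNat 2,
        ← ENNReal.ofReal_pow (by norm_num), ← ENNReal.ofReal_pow (by norm_num),
        ← ENNReal.ofReal_pow (by norm_num),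
        ← ENNReal.ofReal_mul (by norm_num), ← ENNReal.ofReal_mul (by positivity),
        ← ENNReal.ofReal_mul (by positivity), ← ENNReal.ofReal_mul (by norm_num),
        ← ENNReal.ofReal_mul (by positivity)]
      congr 1
      have : (4⁻¹ : ℝ) ^ l = 2⁻¹ ^ l * 2⁻¹ ^ l := by rw [← mul_pow]; norm_num
      rw [this, pow_add, pow_add, inv_pow]
      field_simp
      norm_num
    rw [← mul_assoc, coef]
    ring
  have sup : ENNReal.ofReal (peetreMax r n g x) ^ q ≤ 2 ^ n * (D * 32 * ∑' l : ℕ,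
      ballAvg (2 ^ (l + n + 3) / r) (fun u => (2⁻¹ : ℝ≥0∞) ^ l * ‖g u‖ₑ ^ q) x) := by
    refine ofReal_peetreMax_rpow_le hr hq fun y hy => ?_
    calc ‖g (x + y)‖ₑ ^ q
        ≤ D * (ENNReal.ofReal r * ∫⁻ u, ‖g u‖ₑ ^ q * decayWeight r (x + y) u ^ 2) :=
          hDg r hr g hg (x + y)
      _ ≤ D * (ENNReal.ofReal r * ∑' l : ℕ, 4 * (4⁻¹ : ℝ≥0∞) ^ l *
          ∫⁻ u in Metric.closedBall x (2 ^ (l + n + 3) / r), ‖g u‖ₑ ^ q) := by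
          gcongr
          refine (lintegral_mul_decayWeight_sq_le hr (x + y) hm).trans ?_
          gcongr with l
          refine Metric.closedBall_subset_closedBall' ?_
          rw [Real.dist_eq, add_sub_cancel_left]
          refine (add_le_add_right hy _).trans ?_
          rw [← add_div]
          gcongr
          calc (2 : ℝ) ^ l + 2 ^ (n + 2) ≤ 2 ^ (l + n + 2) + 2 ^ (l + n + 2) := by
                gcongr <;> first | omega | norm_num
            _ = 2 ^ (l + n + 3) := by ring
      _ = _ := by
          simp_rw [← ENNReal.tsum_mul_left]
          congr 1
          ext l
          rw [mul_left_comm (ENNReal.ofReal r), term]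
          ring
  refine (mul_le_mul_right sup _).trans (le_of_eq ?_)
  rw [← mul_assoc]
  have : ENNReal.ofReal ((2 : ℝ) ^ (-(n : ℝ))) * 2 ^ n = 1 := by
    rw [← ENNReal.ofReal_ofNat 2, ← ENNReal.ofReal_pow (by norm_num),
      ← ENNReal.ofReal_mul (by positivity), Real.rpow_neg (by norm_num), Real.rpow_natCast,
      inv_mul_cancel₀ (by positivity), ENNReal.ofReal_one]
  rw [this, one_mul]

/-- Vector-valued endpoint Peetre maximal inequality: for $0<q\le p<\infty$ and
band-limited $f_{k,n}$,
$\|(\sum_{k,n}2^{-n}(\mathfrak M^{r_k}_n f_{k,n})^q)^{1/q}\|_p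
\lesssim\|(\sum_{k,n}|f_{k,n}|^q)^{1/q}\|_p$. -/
theorem peetre_maximal_vector_inequality
    (p q : ℝ) (hq : 0 < q) (hqp : q ≤ p) :
    ∃ C : ℝ, 0 < C ∧
      ∀ (r : ℕ → ℝ), (∀ k, 0 < r k) →
      ∀ (f : ℕ → ℕ → SchwartzMap ℝ ℂ),
        (∀ k n, ∀ ξ : ℝ, ξ ∉ Set.Icc (-(r k)) (r k) → 𝓕 ⇑(f k n) ξ = 0) →
      (∫⁻ x : ℝ, (∑' (k : ℕ) (n : ℕ),
          ENNReal.ofReal ((2:ℝ)^(-(n:ℝ))) *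
            (ENNReal.ofReal (peetreMax (r k) n (⇑(f k n)) x))^q)^(p/q) ∂volume)^(1/p) ≤
        ENNReal.ofReal C *
      (∫⁻ x : ℝ, (∑' (k : ℕ) (n : ℕ),
          (ENNReal.ofReal ‖f k n x‖)^q)^(p/q) ∂volume)^(1/p) := by
  have hp : 0 < p := hq.trans_le hqp
  have hs : 1 ≤ p / q := by rwa [one_le_div hq]
  set s := p / q
  have hs0 : 0 < s := by linarith
  obtain ⟨D, hD, hDg⟩ := exists_peetreMax_rpow_le_tsum_ballAvg hq
  set K : ℝ≥0∞ := D ^ s * ((ENNReal.ofReal s * 2 ^ s) ^ s * 2 ^ s) with hK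
  have hKfin : K ^ (1 / p) ≠ ∞ := by
    have h2 : (2 : ℝ≥0∞) ^ s ≠ ∞ := ENNReal.rpow_ne_top_of_nonneg hs0.le ENNReal.ofNat_ne_top
    refine ENNReal.rpow_ne_top_of_nonneg (by positivity) (ENNReal.mul_ne_top
      (ENNReal.rpow_ne_top_of_nonneg hs0.le hD) (ENNReal.mul_ne_top ?_ h2))
    exact ENNReal.rpow_ne_top_of_nonneg hs0.le (ENNReal.mul_ne_top ENNReal.ofReal_ne_top h2)
  refine ⟨(K ^ (1 / p)).toReal + 1, by positivity, fun r hr f hf => ?_⟩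
  let F : ℕ × ℕ × ℕ → ℝ → ℝ≥0∞ := fun i u => (2⁻¹ : ℝ≥0∞) ^ i.2.2 * ‖f i.1 i.2.1 u‖ₑ ^ q
  let t : ℕ × ℕ × ℕ → ℝ := fun i => 2 ^ (i.2.2 + i.2.1 + 3) / r i.1
  have hF : ∀ i, Measurable (F i) := fun i =>
    ((f i.1 i.2.1).continuous.measurable.enorm.pow_const q).const_mul _
  have ht : ∀ i, 0 < t i := fun i => div_pos (by positivity) (hr _)
  have total : ∀ x, ∑' i, F i x = 2 * ∑' (k : ℕ) (n : ℕ), ENNReal.ofReal ‖f k n x‖ ^ q := by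
    intro x
    rw [ENNReal.tsum_prod', ← ENNReal.tsum_mul_left]
    congr 1
    ext k
    rw [ENNReal.tsum_prod', ← ENNReal.tsum_mul_left]
    congr 1
    ext n
    simp only [F]
    rw [ENNReal.tsum_mul_right, ENNReal.tsum_geometric, ENNReal.one_sub_inv_two, inv_inv,
      ofReal_norm]
  have measTotal : Measurable fun x => ∑' (k : ℕ) (n : ℕ), ENNReal.ofReal ‖f k n x‖ ^ q :=
    Measurable.tsum fun k => Measurable.tsum fun n =>
      (f k n).continuous.norm.measurable.ennreal_ofReal.pow_const q
  have pointwise : ∀ x, ∑' (k : ℕ) (n : ℕ), ENNReal.ofReal ((2:ℝ) ^ (-(n:ℝ))) *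
      ENNReal.ofReal (peetreMax (r k) n (⇑(f k n)) x) ^ q ≤ D * ∑' i, ballAvg (t i) (F i) x := by
    intro x
    rw [ENNReal.tsum_prod', ← ENNReal.tsum_mul_left]
    refine ENNReal.tsum_le_tsum fun k => ?_
    rw [ENNReal.tsum_prod', ← ENNReal.tsum_mul_left]
    exact ENNReal.tsum_le_tsum fun n => hDg (r k) (hr k) (f k n) (hf k n) n x
  have powered : ∫⁻ x : ℝ, (∑' (k : ℕ) (n : ℕ), ENNReal.ofReal ((2:ℝ) ^ (-(n:ℝ))) *
      ENNReal.ofReal (peetreMax (r k) n (⇑(f k n)) x) ^ q) ^ s ≤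
      K * ∫⁻ x : ℝ, (∑' (k : ℕ) (n : ℕ), ENNReal.ofReal ‖f k n x‖ ^ q) ^ s := by
    calc _ ≤ ∫⁻ x, D ^ s * (∑' i, ballAvg (t i) (F i) x) ^ s := by
          refine lintegral_mono fun x => ?_
          rw [← ENNReal.mul_rpow_of_nonneg _ _ hs0.le]
          exact ENNReal.rpow_le_rpow (pointwise x) hs0.le
      _ = D ^ s * ∫⁻ x, (∑' i, ballAvg (t i) (F i) x) ^ s :=
          lintegral_const_mul' _ _ (ENNReal.rpow_ne_top_of_nonneg hs0.le hD)
      _ ≤ D ^ s * ((ENNReal.ofReal s * 2 ^ s) ^ s * ∫⁻ x, (∑' i, F i x) ^ s) := by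
          gcongr
          exact lintegral_tsum_ballAvg_rpow_le hs F hF t ht
      _ = _ := by
          simp_rw [total, ENNReal.mul_rpow_of_nonneg _ _ hs0.le]
          rw [lintegral_const_mul _ (measTotal.pow_const s), hK]
          simp_rw [ENNReal.mul_rpow_of_nonneg _ _ hs0.le]
          ring
  refine (ENNReal.rpow_le_rpow powered (by positivity)).trans ?_
  rw [ENNReal.mul_rpow_of_nonneg _ _ (by positivity)]
  gcongr
  rw [← ENNReal.ofReal_toReal hKfin]
  exact ENNReal.ofReal_le_ofReal (by simp)
end
end

section
/- Let ψ : ℝ → ℂ be a smooth function supported in [−1/2, 1/2] with ∫_ℝ ψ = 0, and set ψₖ(x) = 2^k ψ(2^k x) for integers k ≥ 0. Let j ≥ k ≥ 0 be integers, μ ∈ ℤ, and put y_{j,μ} = 2^{−j}(μ + 1/2). Then the convolution h_{j,μ} * ψₖ is supported in the interval [y_{j,μ} − 2^{−k}, y_{j,μ} + 2^{−k}], and sup_{x∈ℝ} |h_{j,μ} * ψₖ(x)| ≤ (sup_{x∈ℝ} |ψ'(x)|) · 2^{2k−2j}. -/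
open MeasureTheory Real
open scoped ENNReal

noncomputable section

/-- The dilate $\psi_k(x)=2^k\psi(2^kx)$. -/
def psiDil (ψ : ℝ → ℂ) (k : ℕ) : ℝ → ℂ := fun x => (2:ℂ)^k * ψ ((2:ℝ)^k * x)

/-- Pairing a step function `𝟙_{[a, m)} - 𝟙_{[m, b)}` with a continuous function. -/
lemma integral_step_mul {f : ℝ → ℂ} (hf : Continuous f) {a m b : ℝ} (ham : a ≤ m) (hmb : m ≤ b) :
    ∫ t : ℝ, ((Set.Ico a m).indicator (fun _ => (1:ℂ)) t
      - (Set.Ico m b).indicator (fun _ => (1:ℂ)) t) * f t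
      = (∫ t in a..m, f t) - ∫ t in m..b, f t := by
  have hint : ∀ c d : ℝ, Integrable ((Set.Ico c d).indicator f) := fun c d =>
    (hf.continuousOn.integrableOn_Icc.mono_set Set.Ico_subset_Icc_self).integrable_indicator
      measurableSet_Ico
  have hval : ∀ c d : ℝ, c ≤ d → ∫ t, (Set.Ico c d).indicator f t = ∫ t in c..d, f t := by
    intro c d hcd
    rw [integral_indicator measurableSet_Ico, intervalIntegral.integral_of_le hcd,
      integral_Ico_eq_integral_Ioc]
  rw [← hval a m ham, ← hval m b hmb, ← integral_sub (hint a m) (hint m b)]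
  refine integral_congr_ae (Filter.Eventually.of_forall fun t => ?_)
  simp only [Set.indicator_apply]
  split_ifs <;> simp

/-- A step function of mean zero tested against a Lipschitz function gains a factor `δ`. -/
lemma norm_integral_step_sub_le {f : ℝ → ℂ} (hf : Continuous f) {L a δ : ℝ} (hδ : 0 ≤ δ)
    (hL : ∀ s t, ‖f s - f t‖ ≤ L * |s - t|) :
    ‖(∫ t in a..(a + δ), f t) - ∫ t in (a + δ)..(a + δ + δ), f t‖ ≤ L * δ * δ := by
  rw [← intervalIntegral.integral_comp_add_right f δ,
    ← intervalIntegral.integral_sub (hf.intervalIntegrable _ _)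
      ((by fun_prop : Continuous fun t => f (t + δ)).intervalIntegrable _ _)]
  refine (intervalIntegral.norm_integral_le_of_norm_le_const (C := L * δ) fun t _ => ?_).trans ?_
  · refine (hL t (t + δ)).trans_eq ?_
    rw [sub_add_cancel_left, abs_neg, abs_of_nonneg hδ]
  · rw [add_sub_cancel_left, abs_of_nonneg hδ]

/-- A compactly supported `C¹` function is Lipschitz with constant `sup ‖ψ'‖`. -/
lemma norm_sub_le_iSup_deriv {ψ : ℝ → ℂ} (hψ : ContDiff ℝ 1 ψ) (hc : HasCompactSupport ψ)
    (s t : ℝ) : ‖ψ s - ψ t‖ ≤ (⨆ y : ℝ, ‖deriv ψ y‖) * |s - t| := by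
  have hbdd : BddAbove (Set.range fun y => ‖deriv ψ y‖) :=
    (hψ.continuous_deriv le_rfl).norm.bddAbove_range_of_hasCompactSupport hc.deriv.norm
  simpa using convex_univ.norm_image_sub_le_of_norm_deriv_le
    (fun y _ => (hψ.differentiable one_ne_zero).differentiableAt)
    (fun y _ => le_ciSup hbdd y) (Set.mem_univ t) (Set.mem_univ s)

lemma haarFn_eq_zero {j : ℕ} {μ : ℤ} {t : ℝ}
    (ht : (2:ℝ)^(-(j:ℤ)) / 2 < |t - (2:ℝ)^(-(j:ℤ)) * (μ + 1/2)|) : haarFn j μ t = 0 := by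
  have hpos : (0:ℝ) < (2:ℝ)^(-(j:ℤ)) := by positivity
  unfold haarFn
  rw [Set.indicator_of_notMem, Set.indicator_of_notMem, sub_zero]
  all_goals
    rintro ⟨h₁, h₂⟩
    refine ht.not_ge (abs_le.2 ⟨?_, ?_⟩) <;> linarith

lemma psiDil_eq_zero {ψ : ℝ → ℂ} (hψ : Function.support ψ ⊆ Set.Icc (-(1/2) : ℝ) (1/2))
    {k : ℕ} {x : ℝ} (hx : (2:ℝ)^(-(k:ℤ)) / 2 < |x|) : psiDil ψ k x = 0 := by
  unfold psiDil
  rw [mul_eq_zero]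
  right
  by_contra h
  have hle : |(2:ℝ)^k * x| ≤ 1/2 := abs_le.2 (hψ h)
  have hpos : (0:ℝ) < 2^k := by positivity
  rw [abs_mul, abs_of_pos hpos] at hle
  rw [zpow_neg, zpow_natCast] at hx
  have := mul_lt_mul_of_pos_left hx hpos
  rw [← mul_div_assoc, mul_inv_cancel₀ hpos.ne'] at this
  linarith

lemma norm_psiDil_sub_le {ψ : ℝ → ℂ} {L : ℝ} (hL : ∀ s t, ‖ψ s - ψ t‖ ≤ L * |s - t|)
    (k : ℕ) (s t : ℝ) : ‖psiDil ψ k s - psiDil ψ k t‖ ≤ L * 2^(2 * k) * |s - t| := by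
  unfold psiDil
  rw [← mul_sub, norm_mul, norm_pow, RCLike.norm_ofNat]
  calc (2:ℝ)^k * ‖ψ (2^k * s) - ψ (2^k * t)‖
      ≤ 2^k * (L * |2^k * s - 2^k * t|) := by gcongr; exact hL _ _
    _ = L * 2^(2 * k) * |s - t| := by
      rw [← mul_sub, abs_mul, abs_of_pos (by positivity : (0:ℝ) < 2^k)]
      ring

/-- Support and size of $h_{j,\mu}*\psi_k$ for $k\le j$: it is supported in
$[y_{j,\mu}-2^{-k},y_{j,\mu}+2^{-k}]$ and bounded by $\|\psi'\|_\infty 2^{2k-2j}$. -/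
theorem haar_conv_psi_lowfreq
    (ψ : ℝ → ℂ) (hψsmooth : ContDiff ℝ (⊤ : ℕ∞) ψ)
    (hψsupp : Function.support ψ ⊆ Set.Icc (-(1/2) : ℝ) (1/2))
    (hψcanc : ∫ x : ℝ, ψ x = 0)
    (j k : ℕ) (hkj : k ≤ j) (μ : ℤ) :
    Function.support (conv (haarFn j μ) (psiDil ψ k)) ⊆
      Set.Icc ((2:ℝ)^(-(j:ℤ)) * (μ + 1/2) - (2:ℝ)^(-(k:ℤ)))
        ((2:ℝ)^(-(j:ℤ)) * (μ + 1/2) + (2:ℝ)^(-(k:ℤ))) ∧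
    ∀ x : ℝ, ‖conv (haarFn j μ) (psiDil ψ k) x‖ ≤
      (⨆ y : ℝ, ‖deriv ψ y‖) * (2:ℝ)^(2*(k:ℤ) - 2*(j:ℤ)) := by
  have hcont : Continuous (psiDil ψ k) := by
    have := hψsmooth.continuous
    unfold psiDil
    fun_prop
  have hcomp : HasCompactSupport ψ :=
    HasCompactSupport.of_support_subset_isCompact isCompact_Icc hψsupp
  have hLip := norm_sub_le_iSup_deriv (hψsmooth.of_le (by exact_mod_cast le_top)) hcomp
  constructor
  · have hjk : (2:ℝ)^(-(j:ℤ)) ≤ (2:ℝ)^(-(k:ℤ)) := zpow_le_zpow_right₀ one_le_two (by omega)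
    intro x hx
    by_contra hxn
    rw [← Real.closedBall_eq_Icc, Metric.mem_closedBall, Real.dist_eq, not_le] at hxn
    refine hx (integral_eq_zero_of_ae (Filter.Eventually.of_forall fun t => ?_))
    rcases lt_or_ge ((2:ℝ)^(-(j:ℤ)) / 2) |t - (2:ℝ)^(-(j:ℤ)) * (μ + 1/2)| with ht | ht
    · simp [haarFn_eq_zero ht]
    · have htri := abs_sub_le x t ((2:ℝ)^(-(j:ℤ)) * (μ + 1/2))
      simp [psiDil_eq_zero hψsupp (show (2:ℝ)^(-(k:ℤ)) / 2 < |x - t| by linarith)]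
  · intro x
    set L : ℝ := ⨆ y : ℝ, ‖deriv ψ y‖
    have hL0 : 0 ≤ L := Real.iSup_nonneg fun y => norm_nonneg _
    set a : ℝ := (2:ℝ)^(-(j:ℤ)) * μ with ha
    set δ : ℝ := (2:ℝ)^(-(j:ℤ)) / 2 with hδ
    have hδ0 : 0 ≤ δ := by positivity
    have hm : (2:ℝ)^(-(j:ℤ)) * (μ + 1/2) = a + δ := by rw [ha, hδ]; ring
    have hb : (2:ℝ)^(-(j:ℤ)) * (μ + 1) = a + δ + δ := by rw [ha, hδ]; ring
    have hfc : Continuous fun t => psiDil ψ k (x - t) := by fun_prop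
    have hconv : conv (haarFn j μ) (psiDil ψ k) x
        = (∫ t in a..(a + δ), psiDil ψ k (x - t))
          - ∫ t in (a + δ)..(a + δ + δ), psiDil ψ k (x - t) := by
      rw [← integral_step_mul hfc (by linarith) (by linarith)]
      simp only [conv, haarFn, hm, hb, ← ha]
    rw [hconv]
    refine (norm_integral_step_sub_le hfc hδ0 (L := L * 2^(2 * k)) fun s t => ?_).trans ?_
    · refine (norm_psiDil_sub_le hLip k _ _).trans_eq ?_
      rw [sub_sub_sub_cancel_left, abs_sub_comm]
    · have hpow : (2:ℝ)^(2*(k:ℤ) - 2*(j:ℤ)) = 2^(2 * k) * ((2:ℝ)^(-(j:ℤ)))^2 := by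
        rw [sub_eq_add_neg, zpow_add₀ two_ne_zero, ← zpow_natCast, ← zpow_natCast, ← zpow_mul]
        push_cast
        ring_nf
      have hnn : 0 ≤ L * (2^(2 * k) * ((2:ℝ)^(-(j:ℤ)))^2) := by positivity
      calc L * 2^(2 * k) * δ * δ = L * (2^(2 * k) * ((2:ℝ)^(-(j:ℤ)))^2) / 4 := by rw [hδ]; ring
        _ ≤ L * (2:ℝ)^(2*(k:ℤ) - 2*(j:ℤ)) := by rw [hpow]; linarith
end
end

section
/- Let ψ : ℝ → ℂ be a smooth function supported in [−1/2, 1/2] with ∫_ℝ ψ = 0, and set ψₖ(x) = 2^k ψ(2^k x) for integers k ≥ 0. Let k ≥ j ≥ 0 be integers and μ ∈ ℤ. If x ∈ ℝ satisfies min{ |x − 2^{−j}μ|, |x − 2^{−j}(μ + 1/2)|, |x − 2^{−j}(μ + 1)| } ≥ 2^{−k}, then h_{j,μ} * ψₖ(x) = 0. -/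
open MeasureTheory Real
open scoped ENNReal

noncomputable section

/-- Points closer to each other than `x` is to `a` lie on the same side of `a`. -/
lemma le_iff_le_of_abs_sub_lt {a t x : ℝ} (h : |x - t| < |x - a|) : a ≤ t ↔ a ≤ x := by
  grind

/-- The Haar function is constant on a neighbourhood of `x` that avoids its three jumps. -/
lemma haarFn_eq_of_abs_sub_lt {j : ℕ} {μ : ℤ} {t x : ℝ}
    (h₀ : |x - t| < |x - (2:ℝ)^(-(j:ℤ)) * μ|)
    (h₁ : |x - t| < |x - (2:ℝ)^(-(j:ℤ)) * (μ + 1/2)|)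
    (h₂ : |x - t| < |x - (2:ℝ)^(-(j:ℤ)) * (μ + 1)|) :
    haarFn j μ t = haarFn j μ x := by
  simp only [haarFn, Set.indicator_apply, Set.mem_Ico, ← not_le,
    le_iff_le_of_abs_sub_lt h₀, le_iff_le_of_abs_sub_lt h₁, le_iff_le_of_abs_sub_lt h₂]

/-- Dilation preserves vanishing mean. -/
lemma integral_psiDil_eq_zero {ψ : ℝ → ℂ} (hψ : ∫ x : ℝ, ψ x = 0) (k : ℕ) :
    ∫ x : ℝ, psiDil ψ k x = 0 := by
  simp only [psiDil, integral_const_mul, Measure.integral_comp_mul_left, hψ, smul_zero, mul_zero]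

/-- If `ψ` is supported in `[-1/2, 1/2]`, then its dilate vanishes at distance `2^{-k}` from `0`. -/
lemma psiDil_eq_zero_of_le_abs {ψ : ℝ → ℂ}
    (hψ : Function.support ψ ⊆ Set.Icc (-(1/2) : ℝ) (1/2)) {k : ℕ} {y : ℝ}
    (hy : (2:ℝ)^(-(k:ℤ)) ≤ |y|) : psiDil ψ k y = 0 := by
  have hnot : ψ ((2:ℝ)^k * y) = 0 := by
    by_contra hne
    have habs : |(2:ℝ)^k * y| ≤ 1/2 := abs_le.2 (hψ hne)
    have hk : (0:ℝ) < 2^k := by positivity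
    rw [zpow_neg, zpow_natCast, inv_le_iff_one_le_mul₀' hk] at hy
    rw [abs_mul, abs_of_pos hk] at habs
    linarith
  rw [psiDil, hnot, mul_zero]

/-- Vanishing of $h_{j,\mu}*\psi_k$ for $k\ge j$ away from the three exceptional
points of $h_{j,\mu}$. -/
theorem haar_conv_psi_highfreq_vanish
    (ψ : ℝ → ℂ) (hψsmooth : ContDiff ℝ (⊤ : ℕ∞) ψ)
    (hψsupp : Function.support ψ ⊆ Set.Icc (-(1/2) : ℝ) (1/2))
    (hψcanc : ∫ x : ℝ, ψ x = 0)
    (j k : ℕ) (hjk : j ≤ k) (μ : ℤ) (x : ℝ)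
    (hx : (2:ℝ)^(-(k:ℤ)) ≤
      min (|x - (2:ℝ)^(-(j:ℤ)) * μ|)
        (min (|x - (2:ℝ)^(-(j:ℤ)) * (μ + 1/2)|) (|x - (2:ℝ)^(-(j:ℤ)) * (μ + 1)|))) :
    conv (haarFn j μ) (psiDil ψ k) x = 0 := by
  have hmul (t : ℝ) : haarFn j μ t * psiDil ψ k (x - t) =
      haarFn j μ x * psiDil ψ k (x - t) := by
    rcases le_or_gt ((2:ℝ)^(-(k:ℤ))) |x - t| with hfar | hnear
    · rw [psiDil_eq_zero_of_le_abs hψsupp hfar, mul_zero, mul_zero]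
    · obtain ⟨h₀, h₁, h₂⟩ : _ ∧ _ ∧ _ := by simpa only [le_min_iff] using hx
      rw [haarFn_eq_of_abs_sub_lt (hnear.trans_le h₀) (hnear.trans_le h₁) (hnear.trans_le h₂)]
  simp only [conv, hmul, integral_const_mul]
  rw [integral_sub_left_eq_self (psiDil ψ k) volume x, integral_psiDil_eq_zero hψcanc, mul_zero]
end
end

section
/- Let ψ : ℝ → ℂ be a smooth function supported in [−1/2, 1/2] with ∫_ℝ ψ = 0, and set ψₖ(x) = 2^k ψ(2^k x) for integers k ≥ 0. Let 0 < p ≤ ∞. There exists a constant C (depending only on p and ψ) such that for all integers k ≥ j ≥ 0 and all μ ∈ ℤ one has ‖h_{j,μ} * ψₖ‖_{L^p(ℝ)} ≤ C · 2^{−k/p}. -/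
open MeasureTheory Real
open scoped ENNReal

noncomputable section

lemma norm_haarFn_le_one (j : ℕ) (μ : ℤ) (t : ℝ) : ‖haarFn j μ t‖ ≤ 1 := by
  unfold haarFn Set.indicator
  split_ifs <;> simp

/-- An indicator of `[a, b)` is constant on `[x - r, x + r]` if `a` and `b` lie outside it. -/
lemma indicator_Ico_eq_of_notMem_closedBall {a b r x t : ℝ}
    (ha : x ∉ Metric.closedBall a r) (hb : x ∉ Metric.closedBall b r) (ht : |x - t| ≤ r) :
    (Set.Ico a b).indicator (fun _ => (1 : ℂ)) t =
      (Set.Ico a b).indicator (fun _ => (1 : ℂ)) x := by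
  rw [Metric.mem_closedBall, Real.dist_eq, not_le, lt_abs] at ha hb
  rw [abs_le] at ht
  have hmem : t ∈ Set.Ico a b ↔ x ∈ Set.Ico a b := by
    simp only [Set.mem_Ico]
    constructor
    · rintro ⟨h, h'⟩
      constructor
      · rcases ha with ha | ha <;> linarith
      · rcases hb with hb | hb <;> linarith
    · rintro ⟨h, h'⟩
      constructor
      · rcases ha with ha | ha <;> linarith
      · rcases hb with hb | hb <;> linarith
  simp only [Set.indicator, hmem]

/-- The `r`-neighbourhood of the three discontinuities of `haarFn j μ`. -/
def haarJumpNhd (j : ℕ) (μ : ℤ) (r : ℝ) : Set ℝ :=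
  Metric.closedBall ((2:ℝ)^(-(j:ℤ)) * μ) r ∪
    (Metric.closedBall ((2:ℝ)^(-(j:ℤ)) * (μ + 1/2)) r ∪
      Metric.closedBall ((2:ℝ)^(-(j:ℤ)) * (μ + 1)) r)

lemma volume_haarJumpNhd_le (j : ℕ) (μ : ℤ) {r : ℝ} (hr : 0 ≤ r) :
    volume (haarJumpNhd j μ r) ≤ ENNReal.ofReal (6 * r) := by
  have h : 6 * r = 2 * r + (2 * r + 2 * r) := by ring
  rw [h, ENNReal.ofReal_add (by positivity) (by positivity),
    ENNReal.ofReal_add (by positivity) (by positivity)]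
  refine (measure_union_le _ _).trans (add_le_add (Real.volume_closedBall _ _).le ?_)
  refine (measure_union_le _ _).trans ?_
  rw [Real.volume_closedBall, Real.volume_closedBall]

lemma haarFn_eq_of_notMem_haarJumpNhd {j : ℕ} {μ : ℤ} {r x t : ℝ}
    (hx : x ∉ haarJumpNhd j μ r) (ht : |x - t| ≤ r) : haarFn j μ t = haarFn j μ x := by
  simp only [haarJumpNhd, Set.mem_union, not_or] at hx
  obtain ⟨ha, hb, hc⟩ := hx
  unfold haarFn
  rw [indicator_Ico_eq_of_notMem_closedBall ha hb ht,
    indicator_Ico_eq_of_notMem_closedBall hb hc ht]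

lemma integral_psiDil (ψ : ℝ → ℂ) (k : ℕ) : ∫ x, psiDil ψ k x = ∫ x, ψ x := by
  unfold psiDil
  rw [integral_const_mul, Measure.integral_comp_mul_left ψ, abs_of_nonneg (by positivity),
    Complex.real_smul, ← mul_assoc]
  push_cast
  rw [mul_inv_cancel₀ (pow_ne_zero k two_ne_zero), one_mul]

lemma integral_norm_psiDil (ψ : ℝ → ℂ) (k : ℕ) : ∫ x, ‖psiDil ψ k x‖ = ∫ x, ‖ψ x‖ := by
  simp only [psiDil, norm_mul]
  rw [integral_const_mul, Measure.integral_comp_mul_left (fun x => ‖ψ x‖),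
    abs_of_nonneg (by positivity), smul_eq_mul, ← mul_assoc]
  simp

lemma integrable_psiDil {ψ : ℝ → ℂ} (hψ : Integrable ψ) (k : ℕ) : Integrable (psiDil ψ k) :=
  (hψ.comp_mul_left' (by positivity)).const_mul _

lemma norm_conv_haarFn_psiDil_le {ψ : ℝ → ℂ} (hψ : Integrable ψ) (j k : ℕ) (μ : ℤ) (x : ℝ) :
    ‖conv (haarFn j μ) (psiDil ψ k) x‖ ≤ ∫ y, ‖ψ y‖ := by
  rw [← integral_norm_psiDil ψ k, ← integral_sub_left_eq_self (fun y => ‖psiDil ψ k y‖) volume x]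
  refine norm_integral_le_of_norm_le ((integrable_psiDil hψ k).comp_sub_left x).norm
    (Filter.Eventually.of_forall fun t => ?_)
  rw [norm_mul]
  exact mul_le_of_le_one_left (norm_nonneg _) (norm_haarFn_le_one j μ t)

lemma conv_haarFn_psiDil_eq_zero {ψ : ℝ → ℂ}
    (hψsupp : Function.support ψ ⊆ Set.Icc (-(1/2) : ℝ) (1/2))
    (hψcanc : ∫ x : ℝ, ψ x = 0) {j k : ℕ} {μ : ℤ} {x : ℝ}
    (hx : x ∉ haarJumpNhd j μ (((2:ℝ)^k)⁻¹ / 2)) :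
    conv (haarFn j μ) (psiDil ψ k) x = 0 := by
  have hconst : ∀ t, haarFn j μ t * psiDil ψ k (x - t) = haarFn j μ x * psiDil ψ k (x - t) := by
    intro t
    by_cases h : ψ ((2:ℝ)^k * (x - t)) = 0
    · simp [psiDil, h]
    · have hmem := abs_le.2 (hψsupp h)
      rw [abs_mul, abs_of_pos (by positivity : (0:ℝ) < 2 ^ k)] at hmem
      rw [haarFn_eq_of_notMem_haarJumpNhd hx]
      rw [div_eq_mul_inv, ← one_div (2:ℝ), le_inv_mul_iff₀ (by positivity)]
      exact hmem
  unfold conv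
  simp_rw [hconst]
  rw [integral_const_mul, integral_sub_left_eq_self (psiDil ψ k) volume x, integral_psiDil,
    hψcanc, mul_zero]

/-- $L^p$ bound for $h_{j,\mu}*\psi_k$, $k\ge j$:
$\|h_{j,\mu}*\psi_k\|_p\le C2^{-k/p}$, $0<p\le\infty$. -/
theorem haar_conv_psi_highfreq_Lp
    (ψ : ℝ → ℂ) (hψsmooth : ContDiff ℝ (⊤ : ℕ∞) ψ)
    (hψsupp : Function.support ψ ⊆ Set.Icc (-(1/2) : ℝ) (1/2))
    (hψcanc : ∫ x : ℝ, ψ x = 0)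
    (p : ℝ≥0∞) (hp : 0 < p) :
    ∃ C : ℝ, 0 < C ∧ ∀ (j k : ℕ), j ≤ k → ∀ μ : ℤ,
      eLpNorm (conv (haarFn j μ) (psiDil ψ k)) p volume ≤
        ENNReal.ofReal (C * (2:ℝ)^(-(k:ℝ)/p.toReal)) := by
  have hψint : Integrable ψ := hψsmooth.continuous.integrable_of_hasCompactSupport
    (HasCompactSupport.of_support_subset_isCompact isCompact_Icc hψsupp)
  set M : ℝ := ∫ y, ‖ψ y‖
  have hM0 : 0 ≤ M := integral_nonneg fun _ => norm_nonneg _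
  refine ⟨(M + 1) * 3 ^ (1 / p.toReal), by positivity, fun j k _ μ => ?_⟩
  set S := haarJumpNhd j μ (((2:ℝ)^k)⁻¹ / 2)
  have hpt : ∀ x, ‖conv (haarFn j μ) (psiDil ψ k) x‖ ≤ ‖S.indicator (fun _ => M + 1) x‖ := by
    intro x
    by_cases hx : x ∈ S
    · rw [Set.indicator_of_mem hx, Real.norm_of_nonneg (by positivity)]
      linarith [norm_conv_haarFn_psiDil_le hψint j k μ x]
    · rw [conv_haarFn_psiDil_eq_zero hψsupp hψcanc hx, norm_zero]
      exact norm_nonneg _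
  have hvol : volume S ≤ ENNReal.ofReal (3 * (2:ℝ) ^ (-(k:ℝ))) := by
    refine (volume_haarJumpNhd_le j μ (by positivity)).trans_eq ?_
    rw [Real.rpow_neg zero_le_two, Real.rpow_natCast]
    ring_nf
  calc eLpNorm (conv (haarFn j μ) (psiDil ψ k)) p volume
      ≤ eLpNorm (S.indicator fun _ => M + 1) p volume := eLpNorm_mono hpt
    _ ≤ ‖M + 1‖ₑ * volume S ^ (1 / p.toReal) := eLpNorm_indicator_const_le _ _
    _ ≤ ENNReal.ofReal (M + 1) *
        ENNReal.ofReal (3 * (2:ℝ) ^ (-(k:ℝ))) ^ (1 / p.toReal) := by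
      rw [Real.enorm_of_nonneg (by positivity)]
      gcongr
    _ = ENNReal.ofReal ((M + 1) * 3 ^ (1 / p.toReal) * (2:ℝ)^(-(k:ℝ)/p.toReal)) := by
      rw [ENNReal.ofReal_rpow_of_nonneg (by positivity) (by positivity),
        ← ENNReal.ofReal_mul (by positivity), Real.mul_rpow (by positivity) (by positivity),
        ← Real.rpow_mul zero_le_two, mul_one_div, mul_assoc]
end
end
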